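/- Let γ be a relatively extremal knot in ℝⁿ (n ≥ 2) with image K, and suppose there exists s₀ with κγ(s₀) < sup_s κγ(s). Then i(K,ℝⁿ) = R_O(K) = MDC(K)/2. -/

import Mathlib

open Set Filter MeasureTheory
open scoped RealInnerProductSpace Topology ENNReal

noncomputable section

/-- Euclidean space `ℝⁿ`. -/
abbrev Euc (n : ℕ) := EuclideanSpace ℝ (Fin n)

/-- Generalized curvature `κγ(s)` of a curve with derivative `γd` and parameter domain `D`:
the limsup, as `x, y → s` with `x ≠ y`, of `∠(γd x, γd y) / |x - y|`, expressed as the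
infimum of all eventual bounds. -/
def curvAt {n : ℕ} (γd : ℝ → Euc n) (D : Set ℝ) (s : ℝ) : ℝ :=
  sInf {Λ : ℝ | 0 ≤ Λ ∧ ∃ δ > 0, ∀ x ∈ D, ∀ y ∈ D, x ≠ y →
    |x - s| < δ → |y - s| < δ →
    InnerProductGeometry.angle (γd x) (γd y) ≤ Λ * |x - y|}

/-- `κγ(s) < Λ`: there are `δ > 0` and `Λ' < Λ` bounding the angle dilation near `s`. -/
def CurvLt {n : ℕ} (γd : ℝ → Euc n) (D : Set ℝ) (s Λ : ℝ) : Prop :=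
  ∃ δ > 0, ∃ Λ' < Λ, ∀ x ∈ D, ∀ y ∈ D, x ≠ y → |x - s| < δ → |y - s| < δ →
    InnerProductGeometry.angle (γd x) (γd y) ≤ Λ' * |x - y|

/-- `f` restricted to `[a, c]` is a planar circular arc of radius `1/Λ`
of length in `[0, 2π/Λ)`. -/
def IsArc {n : ℕ} (Λ : ℝ) (f : ℝ → Euc n) (a c : ℝ) : Prop :=
  c - a < 2 * Real.pi / Λ ∧
  ∃ (o u e : Euc n) (s₁ : ℝ), ‖u‖ = 1 ∧ ‖e‖ = 1 ∧ ⟪u, e⟫ = 0 ∧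
    ∀ s ∈ Icc a c,
      f s = o + (Λ⁻¹ * Real.cos (Λ * (s - s₁))) • u + (Λ⁻¹ * Real.sin (Λ * (s - s₁))) • e

/-- `f` restricted to `[a, c]` is a planar circular arc of radius `r`. -/
def IsArcR {n : ℕ} (r : ℝ) (f : ℝ → Euc n) (a c : ℝ) : Prop :=
  ∃ (o u e : Euc n) (s₁ : ℝ), ‖u‖ = 1 ∧ ‖e‖ = 1 ∧ ⟪u, e⟫ = 0 ∧
    ∀ s ∈ Icc a c,
      f s = o + (r * Real.cos ((s - s₁) / r)) • u + (r * Real.sin ((s - s₁) / r)) • e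

/-- `O_p(v, r)`: the union of the open balls of radius `r` tangent to `v^⊥` at `p`. -/
def Odisk {n : ℕ} (p v : Euc n) (r : ℝ) : Set (Euc n) :=
  {x | ∃ w : Euc n, ‖w‖ = 1 ∧ ⟪w, v⟫ = 0 ∧ ‖x - p - r • w‖ < r}

/-- Ball radius `R_O` of the curve `f` (with derivative/tangent field `γd`) on domain `D`. -/
def RO {n : ℕ} (f γd : ℝ → Euc n) (D : Set ℝ) : ℝ :=
  sInf {r : ℝ | 0 < r ∧ ∃ s ∈ D, ∃ t ∈ D, ∃ w : Euc n,
    ‖w‖ = 1 ∧ ⟪w, γd s⟫ = 0 ∧ ‖f t - f s - r • w‖ < r}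

/-- Minimal double critical distance of the curve `f` with tangent field `γd`. -/
def MDC {n : ℕ} (f γd : ℝ → Euc n) : ℝ :=
  sInf {d : ℝ | ∃ x y : ℝ, f x ≠ f y ∧ ⟪f x - f y, γd x⟫ = 0 ∧
    ⟪f x - f y, γd y⟫ = 0 ∧ d = ‖f x - f y‖}

/-- Normal injectivity radius `i(K, ℝⁿ)` of the curve `f` with tangent field `γd`. -/
def injRad {n : ℕ} (f γd : ℝ → Euc n) : ℝ :=
  sSup ({0} ∪ {r : ℝ | 0 < r ∧ ∀ s t : ℝ, ∀ u w : Euc n,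
    ⟪u, γd s⟫ = 0 → ⟪w, γd t⟫ = 0 → ‖u‖ < r → ‖w‖ < r →
    f s + u = f t + w → f s = f t ∧ u = w})

/-- A knot: a simple closed unit-speed `C^{1,1}` curve, as an `L`-periodic map `ℝ → ℝⁿ`,
injective on `[0, L)`, with `‖γ'‖ ≡ 1` and `γ'` Lipschitz. -/
structure Knot (n : ℕ) where
  L : ℝ
  Lpos : 0 < L
  f : ℝ → Euc n
  fd : ℝ → Euc n
  per : ∀ s, f (s + L) = f s
  perd : ∀ s, fd (s + L) = fd s
  deriv : ∀ s, HasDerivAt f (fd s) s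
  unit : ∀ s, ‖fd s‖ = 1
  lipd : ∃ C : NNReal, LipschitzWith C fd
  inj : InjOn f (Ico 0 L)

/-- Ropelength `ℓ_e(γ) = L / R_O(K)`. -/
def Knot.ropelength {n : ℕ} (k : Knot n) : ℝ := k.L / RO k.f k.fd univ

/-- The set `I_c` of parameters realizing the minimal double critical distance. -/
def Knot.Ic {n : ℕ} (k : Knot n) : Set ℝ :=
  {x | ∃ y : ℝ, k.f x ≠ k.f y ∧ ⟪k.f x - k.f y, k.fd x⟫ = 0 ∧
    ⟪k.f x - k.f y, k.fd y⟫ = 0 ∧ ‖k.f x - k.f y‖ = MDC k.f k.fd}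

/-- `sup_s κγ(s)` for a knot. -/
def Knot.supCurv {n : ℕ} (k : Knot n) : ℝ := ⨆ s : ℝ, curvAt k.fd univ s

/-- Analytic focal distance `F_k(γ) = (sup_s κγ(s))⁻¹`. -/
def Knot.Fk {n : ℕ} (k : Knot n) : ℝ := (k.supCurv)⁻¹

/-- Two knots are in the same knot class: after rescaling their domains to `ℝ/ℤ`
(realized by `1`-periodic maps `ℝ → ℝⁿ`), they are joined by a continuous homotopy
through injective loops. -/
def SameKnotClass {n : ℕ} (k₁ k₂ : Knot n) : Prop :=
  ∃ H : ℝ → ℝ → Euc n,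
    ContinuousOn (fun z : ℝ × ℝ => H z.1 z.2) (Icc 0 1 ×ˢ univ) ∧
    (∀ t s, H t (s + 1) = H t s) ∧
    (∀ s, H 0 s = k₁.f (k₁.L * s)) ∧
    (∀ s, H 1 s = k₂.f (k₂.L * s)) ∧
    ∀ t ∈ Icc (0 : ℝ) 1, InjOn (H t) (Ico 0 1)

/-- A knot is relatively extremal: a relative minimum of ropelength within its knot class
with respect to the `C¹` topology (on rescaled parametrizations). -/
def RelativelyExtremal {n : ℕ} (k : Knot n) : Prop :=
  ∃ ε > 0, ∀ η : Knot n, SameKnotClass k η →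
    (∀ s : ℝ, ‖η.f (η.L * s) - k.f (k.L * s)‖ +
      ‖η.L • η.fd (η.L * s) - k.L • k.fd (k.L * s)‖ < ε) →
    k.ropelength ≤ η.ropelength

/-- The class `C(p, q; v, w; Λ)`: unit-speed `C^{1,1}` curves `γ : [0, L] → ℝⁿ`
(`L` not fixed) from `p` to `q` with initial/terminal directions `v, w`
and `Λ`-Lipschitz derivative (curvature at most `Λ`). -/
structure CurveCC (n : ℕ) (p q v w : Euc n) (Λ : ℝ) where
  L : ℝ
  Lnn : 0 ≤ L
  f : ℝ → Euc n
  fd : ℝ → Euc n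
  deriv : ∀ s ∈ Icc (0 : ℝ) L, HasDerivWithinAt f (fd s) (Icc 0 L) s
  unit : ∀ s ∈ Icc (0 : ℝ) L, ‖fd s‖ = 1
  lip : LipschitzOnWith Λ.toNNReal fd (Icc 0 L)
  i0 : f 0 = p
  id0 : fd 0 = v
  iL : f L = q
  idL : fd L = w

/-- A `C¹` closed curve of period `L` with nowhere-vanishing derivative. -/
structure ClosedC1 (n : ℕ) (L : ℝ) where
  f : ℝ → Euc n
  fd : ℝ → Euc n
  per : ∀ s, f (s + L) = f s
  perd : ∀ s, fd (s + L) = fd s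
  deriv : ∀ s, HasDerivAt f (fd s) s
  nz : ∀ s, fd s ≠ 0

/-- A simple closed `C^{1,1}` curve of period `L` with nowhere-vanishing derivative. -/
structure ClosedC11 (n : ℕ) (L : ℝ) extends ClosedC1 n L where
  lipd : ∃ C : NNReal, LipschitzWith C fd
  inj : InjOn f (Ico 0 L)

/-- The unit tangent field of `c` is `C`-Lipschitz with respect to the arclength of `c`. -/
def TangentLip {n : ℕ} {L : ℝ} (c : ClosedC1 n L) (C : ℝ) : Prop :=
  ∀ x y : ℝ, x ≤ y →
    ‖‖c.fd y‖⁻¹ • c.fd y - ‖c.fd x‖⁻¹ • c.fd x‖ ≤ C * ∫ t in x..y, ‖c.fd t‖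

/-- Pointwise geometric focal distance `F_g(γ(s))` of the curve `f` with domain `D`. -/
def FgPt {n : ℕ} (f fd : ℝ → Euc n) (D : Set ℝ) (s : ℝ) : ℝ :=
  sInf {r : ℝ | 0 < r ∧ f s ∈ closure (Odisk (f s) (fd s) r ∩ (f '' D))}

end

section LipschitzCalculus

variable {E : Type*} [NormedAddCommGroup E] [InnerProductSpace ℝ E]

/-- A bounded measurable real function is interval integrable. -/
lemma intervalIntegrable_of_bounded {F : Type*} [NormedAddCommGroup F] {f : ℝ → F} {B : ℝ}
    (hf : AEStronglyMeasurable f volume) (hB : ∀ s, ‖f s‖ ≤ B) (a b : ℝ) :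
    IntervalIntegrable f volume a b := by
  rw [intervalIntegrable_iff]
  refine Measure.integrableOn_of_bounded (M := B) ?_ hf (ae_of_all _ hB)
  simp

/-- A Lipschitz curve moves at most by the integral of an almost everywhere bound on the norm of
its derivative. -/
lemma LipschitzWith.norm_sub_le_integral [FiniteDimensional ℝ E] {C : NNReal} {g : ℝ → E}
    (hg : LipschitzWith C g) {ρ : ℝ → ℝ} {a b : ℝ} (hab : a ≤ b)
    (hρ : IntervalIntegrable ρ volume a b) (h : ∀ᵐ s, ‖deriv g s‖ ≤ ρ s) :
    ‖g b - g a‖ ≤ ∫ s in a..b, ρ s := by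
  set w := g b - g a with hw
  set φ : ℝ → ℝ := fun s => ⟪w, g s⟫ with hφ
  have hlip : LipschitzWith (‖w‖₊ * C) φ := by
    refine LipschitzWith.of_dist_le_mul fun x y => ?_
    rw [Real.dist_eq, hφ, ← inner_sub_right]
    refine (abs_real_inner_le_norm _ _).trans ?_
    push_cast
    rw [mul_assoc]
    gcongr
    rw [← dist_eq_norm]
    exact hg.dist_le_mul x y
  have hac : AbsolutelyContinuousOnInterval φ a b :=
    (hlip.lipschitzOnWith (s := uIcc a b)).absolutelyContinuousOnInterval
  have h1 := hac.integral_deriv_eq_sub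
  have h2 : φ b - φ a = ‖w‖ ^ 2 := by
    rw [hφ]; simp only; rw [← inner_sub_right, ← hw, real_inner_self_eq_norm_sq]
  have h3 : ∫ s in a..b, deriv φ s ≤ ∫ s in a..b, ‖w‖ * ρ s := by
    refine intervalIntegral.integral_mono_ae hab hac.intervalIntegrable_deriv (hρ.const_mul _) ?_
    filter_upwards [h, hg.ae_differentiableAt_real] with s hs hd
    have : HasDerivAt φ ⟪w, deriv g s⟫ s := by
      simpa using (hasDerivAt_const s w).inner ℝ hd.hasDerivAt
    rw [this.deriv]
    exact (real_inner_le_norm _ _).trans (by gcongr)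
  rw [intervalIntegral.integral_const_mul, h1, h2] at h3
  have h0 : 0 ≤ ∫ s in a..b, ρ s := by
    refine intervalIntegral.integral_nonneg_of_ae hab ?_
    filter_upwards [h] with s hs using (norm_nonneg _).trans hs
  rcases (norm_nonneg w).eq_or_lt with h4 | h4
  · rw [← h4]; exact h0
  · nlinarith

/-- A Lipschitz curve whose derivative is bounded by `Λ` is `Λ`-Lipschitz. -/
lemma LipschitzWith.of_norm_deriv_le [FiniteDimensional ℝ E] {C : NNReal} {g : ℝ → E}
    (hg : LipschitzWith C g) {Λ : ℝ} (h : ∀ᵐ s, ‖deriv g s‖ ≤ Λ) (x y : ℝ) :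
    ‖g x - g y‖ ≤ Λ * |x - y| := by
  wlog hxy : y ≤ x generalizing x y
  · rw [norm_sub_rev, abs_sub_comm]; exact this y x (le_of_not_ge hxy)
  have := hg.norm_sub_le_integral hxy (ρ := fun _ => Λ) (by simp) h
  rw [abs_of_nonneg (by linarith)]
  simpa [mul_comm] using this

/-- Normalization does not increase distances outside the open unit ball. -/
lemma norm_normalize_sub_le {u v : E} (hu : 1 ≤ ‖u‖) (hv : 1 ≤ ‖v‖) :
    ‖‖u‖⁻¹ • u - ‖v‖⁻¹ • v‖ ≤ ‖u - v‖ := by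
  have hu0 : 0 < ‖u‖ := by linarith
  have hv0 : 0 < ‖v‖ := by linarith
  refine (sq_le_sq₀ (norm_nonneg _) (norm_nonneg _)).1 ?_
  rw [norm_sub_sq_real, norm_sub_sq_real, norm_smul, norm_smul, real_inner_smul_left,
    real_inner_smul_right]
  simp only [norm_inv, norm_norm]
  rw [inv_mul_cancel₀ hu0.ne', inv_mul_cancel₀ hv0.ne']
  have hi : ⟪u, v⟫ ≤ ‖u‖ * ‖v‖ := real_inner_le_norm u v
  set t := ‖u‖⁻¹ * (‖v‖⁻¹ * ⟪u, v⟫) with ht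
  have hit : ⟪u, v⟫ = t * (‖u‖ * ‖v‖) := by rw [ht]; field_simp
  have ht1 : t ≤ 1 := by
    have : 0 < ‖u‖ * ‖v‖ := by positivity
    nlinarith
  rw [hit]
  have : 1 ≤ ‖u‖ * ‖v‖ := by nlinarith
  nlinarith [sq_nonneg (‖u‖ - ‖v‖)]

end LipschitzCalculus

section UnitSpeed

variable {E : Type*} [NormedAddCommGroup E] [InnerProductSpace ℝ E]

lemma mul_le_inner_sub_of_le_inner {f fd : ℝ → E} (hd : ∀ s, HasDerivAt f (fd s) s) {v : E}
    {m x y : ℝ} (hxy : x ≤ y) (h : ∀ z ∈ Icc x y, m ≤ ⟪fd z, v⟫) :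
    m * (y - x) ≤ ⟪f y - f x, v⟫ := by
  have hφ : ∀ z, HasDerivAt (fun z => ⟪f z, v⟫) ⟪fd z, v⟫ z := fun z => by
    simpa using (hd z).inner ℝ (hasDerivAt_const z v)
  have := (convex_Icc x y).mul_sub_le_image_sub_of_le_deriv (f := fun z => ⟪f z, v⟫) (C := m)
    (fun z _ => (hφ z).continuousAt.continuousWithinAt)
    (fun z _ => (hφ z).differentiableAt.differentiableWithinAt)
    (fun z hz => by rw [(hφ z).deriv]; exact h z (interior_subset hz))
    x (left_mem_Icc.2 hxy) y (right_mem_Icc.2 hxy) hxy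
  rwa [inner_sub_left]

lemma one_sub_norm_le_inner {u v : E} (hv : ‖v‖ = 1) : 1 - ‖u - v‖ ≤ ⟪u, v⟫ := by
  have h1 : ⟪u, v⟫ = 1 + ⟪u - v, v⟫ := by
    rw [inner_sub_left, real_inner_self_eq_norm_sq, hv]; ring
  have h2 := abs_le.1 (abs_real_inner_le_norm (u - v) v)
  rw [hv, mul_one] at h2
  linarith [h2.1]

lemma norm_sub_le_of_unit_speed {f fd : ℝ → E} (hd : ∀ s, HasDerivAt f (fd s) s)
    (hu : ∀ s, ‖fd s‖ = 1) (x y : ℝ) : ‖f y - f x‖ ≤ |y - x| := by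
  simpa using (convex_univ (𝕜 := ℝ) (E := ℝ)).norm_image_sub_le_of_norm_hasDerivWithin_le
    (f := f) (f' := fd) (C := 1) (fun z _ => (hd z).hasDerivWithinAt) (fun z _ => (hu z).le)
    (mem_univ x) (mem_univ y)

/-- Near a foot point `s` of a perpendicular from `c` which is shorter than the curvature radius,
the distance to `c` is strictly minimal at `s`. -/
lemma norm_sub_center_lt {f fd : ℝ → E} (hd : ∀ s, HasDerivAt f (fd s) s)
    (hu : ∀ s, ‖fd s‖ = 1) {Λ : ℝ} (hΛ : 0 < Λ) (hlip : ∀ x y, ‖fd x - fd y‖ ≤ Λ * |x - y|)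
    {s x r : ℝ} {c : E} (hperp : ⟪f s - c, fd s⟫ = 0) (hr : ‖f s - c‖ ≤ r)
    (hxs : x ≠ s) (hx : |x - s| ≤ (1 - r * Λ) / (2 * Λ)) :
    ‖f s - c‖ < ‖f x - c‖ := by
  set δ := (1 - r * Λ) / (2 * Λ) with hδ
  have hδΛ : δ * (2 * Λ) = 1 - r * Λ := by rw [hδ]; field_simp
  have hδ0 : 0 < δ := lt_of_lt_of_le (abs_pos.2 (sub_ne_zero.2 hxs)) hx
  have hder : ∀ z, HasDerivAt (fun z => ‖f z - c‖ ^ 2) (2 * ⟪f z - c, fd z⟫) z := fun z =>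
    ((hd z).sub_const c).norm_sq
  have hcont : Continuous fun z => ‖f z - c‖ ^ 2 :=
    continuous_iff_continuousAt.2 fun z => (hder z).continuousAt
  have hkey : ∀ z, z ≠ s → |z - s| ≤ δ → 0 < (z - s) * ⟪f z - c, fd z⟫ := by
    intro z hz hzδ
    have hpos : 0 < |z - s| := abs_pos.2 (sub_ne_zero.2 hz)
    have e1 : ⟪f z - c, fd z⟫ = ⟪f z - f s, fd z⟫ + ⟪f s - c, fd z - fd s⟫ := by
      rw [inner_sub_right, hperp, sub_zero, ← inner_add_left]; congr 1; abel
    have e2 : |⟪f s - c, fd z - fd s⟫| ≤ r * (Λ * |z - s|) :=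
      (abs_real_inner_le_norm _ _).trans
        (mul_le_mul hr (hlip z s) (norm_nonneg _) ((norm_nonneg _).trans hr))
    have e3 : (1 - Λ * |z - s|) * |z - s| ^ 2 ≤ (z - s) * ⟪f z - f s, fd z⟫ := by
      have hin : ∀ y, |y - z| ≤ |z - s| → 1 - Λ * |z - s| ≤ ⟪fd y, fd z⟫ := fun y hy => by
        have := one_sub_norm_le_inner (u := fd y) (hu z)
        have := hlip y z
        have : Λ * |y - z| ≤ Λ * |z - s| := by gcongr
        linarith
      rcases lt_or_gt_of_ne hz with hlt | hlt
      · have := mul_le_inner_sub_of_le_inner hd hlt.le (v := fd z) (m := 1 - Λ * |z - s|)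
          fun y hy => hin y (by
            rw [abs_of_nonneg (by linarith [hy.1]), abs_of_nonpos (by linarith)]
            linarith [hy.2])
        have e4 : ⟪f z - f s, fd z⟫ = -⟪f s - f z, fd z⟫ := by
          rw [← inner_neg_left]; congr 1; abel
        rw [e4, sq_abs]
        nlinarith
      · have := mul_le_inner_sub_of_le_inner hd hlt.le (v := fd z) (m := 1 - Λ * |z - s|)
          fun y hy => hin y (by
            rw [abs_of_nonpos (by linarith [hy.2]), abs_of_nonneg (by linarith)]
            linarith [hy.1])
        rw [sq_abs]
        nlinarith
    have e5 : -(|z - s| * (r * (Λ * |z - s|))) ≤ (z - s) * ⟪f s - c, fd z - fd s⟫ := by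
      have := neg_abs_le ((z - s) * ⟪f s - c, fd z - fd s⟫)
      rw [abs_mul] at this
      nlinarith
    rw [e1, mul_add]
    have e6 : 0 < |z - s| ^ 2 * (1 - Λ * |z - s| - r * Λ) := by
      have : Λ * |z - s| ≤ Λ * δ := by gcongr
      have : 0 < Λ * δ := by positivity
      have : 0 < |z - s| ^ 2 := by positivity
      apply mul_pos this; nlinarith
    nlinarith
  refine lt_of_pow_lt_pow_left₀ 2 (norm_nonneg _) ?_
  rcases lt_or_gt_of_ne hxs with hlt | hlt
  · have hanti : StrictAntiOn (fun z => ‖f z - c‖ ^ 2) (Icc x s) := by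
      refine strictAntiOn_of_deriv_neg (convex_Icc x s) hcont.continuousOn fun z hz => ?_
      rw [interior_Icc] at hz
      rw [(hder z).deriv]
      rw [abs_of_neg (by linarith)] at hx
      have := hkey z hz.2.ne (by rw [abs_of_neg (by linarith [hz.2])]; linarith [hz.1])
      have h2 := hz.2
      nlinarith
    exact hanti (left_mem_Icc.2 hlt.le) (right_mem_Icc.2 hlt.le) hlt
  · have hmono : StrictMonoOn (fun z => ‖f z - c‖ ^ 2) (Icc s x) := by
      refine strictMonoOn_of_deriv_pos (convex_Icc s x) hcont.continuousOn fun z hz => ?_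
      rw [interior_Icc] at hz
      rw [(hder z).deriv]
      rw [abs_of_pos (by linarith)] at hx
      have := hkey z hz.1.ne' (by rw [abs_of_pos (by linarith [hz.1])]; linarith [hz.2])
      have h2 := hz.1
      nlinarith
    exact hmono (left_mem_Icc.2 hlt.le) (right_mem_Icc.2 hlt.le) hlt

/-- A closed ball centred on the inner normal lies, apart from the point of tangency, in the
larger open ball tangent at the same point. -/
lemma norm_sub_smul_lt_of_norm_le {b w : E} {ρ r : ℝ} (hw : ‖w‖ = 1) (hρ : 0 < ρ) (hr : ρ < r)
    (hb : ‖b‖ ≤ ρ) (hne : b ≠ -(ρ • w)) : ‖b - (r - ρ) • w‖ < r := by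
  refine lt_of_pow_lt_pow_left₀ 2 (by linarith) ?_
  have h1 : 0 < ‖b + ρ • w‖ ^ 2 := by
    have : b + ρ • w ≠ 0 := fun h => hne (eq_neg_of_add_eq_zero_left h)
    positivity
  rw [norm_add_sq_real, norm_smul, real_inner_smul_right, hw, Real.norm_of_nonneg hρ.le] at h1
  rw [norm_sub_sq_real, norm_smul, real_inner_smul_right, hw,
    Real.norm_of_nonneg (by linarith : (0 : ℝ) ≤ r - ρ)]
  have h2 : ‖b‖ ^ 2 ≤ ρ ^ 2 := by gcongr
  have h3 : -ρ < ⟪b, w⟫ := by nlinarith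
  nlinarith

end UnitSpeed

namespace Knot

variable {n : ℕ} (k : Knot n)

lemma continuous_f : Continuous k.f :=
  continuous_iff_continuousAt.2 fun s => (k.deriv s).continuousAt

lemma continuous_fd : Continuous k.fd := k.lipd.choose_spec.continuous

lemma exists_norm_fd_sub_le : ∃ C > 0, ∀ x y, ‖k.fd x - k.fd y‖ ≤ C * |x - y| := by
  obtain ⟨C, hC⟩ := k.lipd
  refine ⟨C + 1, by positivity, fun x y => ?_⟩
  have := hC.dist_le_mul x y
  rw [dist_eq_norm, Real.dist_eq] at this
  nlinarith [abs_nonneg (x - y)]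

lemma exists_mem_Ico (s : ℝ) (a : ℝ) :
    ∃ s' ∈ Ico a (a + k.L), k.f s = k.f s' ∧ k.fd s = k.fd s' := by
  have hp : Function.Periodic (fun s => (k.f s, k.fd s)) k.L := fun s => by
    simp only [k.per, k.perd]
  obtain ⟨s', h, h'⟩ := hp.exists_mem_Ico k.Lpos s a
  exact ⟨s', h, Prod.ext_iff.1 h'⟩

lemma f_add_ne (s : ℝ) {h : ℝ} (h0 : 0 < h) (hL : h < k.L) : k.f (s + h) ≠ k.f s := by
  have hp : Function.Periodic k.f k.L := k.per
  set m := ⌊s / k.L⌋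
  have hm1 : (m : ℝ) * k.L ≤ s := by
    have := Int.floor_le (s / k.L); rwa [le_div_iff₀ k.Lpos] at this
  have hm2 : s < (m + 1 : ℝ) * k.L := by
    have := Int.lt_floor_add_one (s / k.L); rwa [div_lt_iff₀ k.Lpos] at this
  have e1 : k.f s = k.f (s - m * k.L) := (hp.sub_int_mul_eq m).symm
  have e2 : k.f (s + h) = k.f (s + h - m * k.L) := (hp.sub_int_mul_eq m).symm
  have hmem : s - m * k.L ∈ Ico 0 k.L := ⟨by linarith, by linarith⟩
  intro he
  rw [e1, e2] at he
  by_cases hc : s + h - m * k.L < k.L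
  · have := k.inj ⟨by linarith, hc⟩ hmem he
    linarith
  · rw [← hp.sub_eq] at he
    have := k.inj ⟨by linarith, by linarith⟩ hmem he
    linarith

/-- A diameter of the knot is a double critical pair. -/
lemma exists_double_critical : ∃ x y : ℝ, k.f x ≠ k.f y ∧ ⟪k.f x - k.f y, k.fd x⟫ = 0 ∧
    ⟪k.f x - k.f y, k.fd y⟫ = 0 := by
  have hL := k.Lpos
  have hcont : Continuous fun p : ℝ × ℝ => ‖k.f p.1 - k.f p.2‖ ^ 2 := by
    have := k.continuous_f; fun_prop
  obtain ⟨⟨x, y⟩, -, hmax⟩ := ((isCompact_Icc (a := (0 : ℝ)) (b := k.L)).prod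
    (isCompact_Icc (a := (0 : ℝ)) (b := k.L))).exists_isMaxOn
      ⟨(0, 0), by simp [hL.le]⟩ hcont.continuousOn
  have hglob : ∀ a b, ‖k.f a - k.f b‖ ^ 2 ≤ ‖k.f x - k.f y‖ ^ 2 := fun a b => by
    obtain ⟨a', ha, ha', -⟩ := k.exists_mem_Ico a 0
    obtain ⟨b', hb, hb', -⟩ := k.exists_mem_Ico b 0
    rw [zero_add] at ha hb
    rw [ha', hb']
    exact hmax (a := (a', b')) ⟨Ico_subset_Icc_self ha, Ico_subset_Icc_self hb⟩
  refine ⟨x, y, fun he => ?_, ?_, ?_⟩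
  · have h1 := hglob (0 + k.L / 2) 0
    rw [he, sub_self, norm_zero] at h1
    refine k.f_add_ne 0 (half_pos hL) (half_lt_self hL) (sub_eq_zero.1 (norm_eq_zero.1 ?_))
    nlinarith [norm_nonneg (k.f (0 + k.L / 2) - k.f 0)]
  · have hder := ((k.deriv x).sub_const (k.f y)).norm_sq
    have := (IsLocalMax.hasDerivAt_eq_zero (Filter.Eventually.of_forall fun a => hglob a y) hder)
    linarith
  · have hder := ((k.deriv y).const_sub (k.f x)).norm_sq
    have := (IsLocalMax.hasDerivAt_eq_zero (Filter.Eventually.of_forall fun b => hglob x b) hder)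
    rw [inner_neg_right] at this
    linarith

lemma RO_nonneg : 0 ≤ RO k.f k.fd univ := Real.sInf_nonneg fun _ h => h.1.le

lemma RO_bddBelow : BddBelow {r : ℝ | 0 < r ∧ ∃ s ∈ univ, ∃ t ∈ univ, ∃ w : Euc n,
    ‖w‖ = 1 ∧ ⟪w, k.fd s⟫ = 0 ∧ ‖k.f t - k.f s - r • w‖ < r} := ⟨0, fun _ h => h.1.le⟩

lemma RO_le_half {x y : ℝ} (hne : k.f x ≠ k.f y) (hx : ⟪k.f x - k.f y, k.fd x⟫ = 0) :
    RO k.f k.fd univ ≤ ‖k.f x - k.f y‖ / 2 := by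
  set d := k.f y - k.f x with hd
  have hd0 : 0 < ‖d‖ := norm_pos_iff.2 (sub_ne_zero.2 hne.symm)
  rw [norm_sub_rev, ← hd]
  refine le_of_forall_gt fun r hr => lt_of_le_of_lt
    (csInf_le k.RO_bddBelow (a := (r + ‖d‖ / 2) / 2) ?_) (by linarith)
  set q := (r + ‖d‖ / 2) / 2 with hq
  have hq1 : ‖d‖ < 2 * q := by linarith
  have e : d - q • (‖d‖⁻¹ • d) = (1 - q * ‖d‖⁻¹) • d := by rw [sub_smul, one_smul, smul_smul]
  refine ⟨by linarith, x, mem_univ _, y, mem_univ _, ‖d‖⁻¹ • d, ?_, ?_, ?_⟩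
  · rw [norm_smul, norm_inv, norm_norm, inv_mul_cancel₀ hd0.ne']
  · rw [real_inner_smul_left, hd, ← neg_sub, inner_neg_left, hx]; simp
  · rw [e, norm_smul, Real.norm_eq_abs, ← abs_of_pos hd0, ← abs_mul, abs_of_pos hd0, sub_mul,
      mul_assoc, inv_mul_cancel₀ hd0.ne', abs_lt]
    constructor <;> linarith

lemma RO_lt_iff {r : ℝ} (hr : 0 < r) : RO k.f k.fd univ < r ↔
    ∃ s t : ℝ, ∃ w : Euc n, ‖w‖ = 1 ∧ ⟪w, k.fd s⟫ = 0 ∧ ‖k.f t - k.f s - r • w‖ < r := by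
  constructor
  · intro h
    by_cases hS : {r : ℝ | 0 < r ∧ ∃ s ∈ univ, ∃ t ∈ univ, ∃ w : Euc n,
      ‖w‖ = 1 ∧ ⟪w, k.fd s⟫ = 0 ∧ ‖k.f t - k.f s - r • w‖ < r}.Nonempty
    · obtain ⟨q, ⟨-, s, -, t, -, w, hw, hws, hq⟩, hqr⟩ := exists_lt_of_csInf_lt hS h
      refine ⟨s, t, w, hw, hws, ?_⟩
      have e : k.f t - k.f s - r • w = (k.f t - k.f s - q • w) - (r - q) • w := by
        rw [sub_smul]; abel
      rw [e]
      refine (norm_sub_le _ _).trans_lt ?_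
      rw [norm_smul, hw, Real.norm_of_nonneg (by linarith)]
      linarith
    · exfalso
      obtain ⟨x, y, hne, hx, -⟩ := k.exists_double_critical
      set d := k.f y - k.f x with hd
      have hd0 : 0 < ‖d‖ := norm_pos_iff.2 (sub_ne_zero.2 hne.symm)
      refine hS ⟨‖d‖, hd0, x, mem_univ _, y, mem_univ _, ‖d‖⁻¹ • d, ?_, ?_, ?_⟩
      · rw [norm_smul, norm_inv, norm_norm, inv_mul_cancel₀ hd0.ne']
      · rw [real_inner_smul_left, hd, ← neg_sub, inner_neg_left, hx]; simp
      · rw [smul_smul, mul_inv_cancel₀ hd0.ne', one_smul, ← hd, sub_self, norm_zero]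
        exact hd0
  · rintro ⟨s, t, w, hw, hws, h⟩
    set m := ‖k.f t - k.f s - r • w‖ with hm
    have hm0 : 0 ≤ m := norm_nonneg _
    refine lt_of_le_of_lt (csInf_le k.RO_bddBelow (a := (2 * r + m) / 3) ?_) (by linarith)
    refine ⟨by linarith, s, mem_univ _, t, mem_univ _, w, hw, hws, ?_⟩
    have e : k.f t - k.f s - ((2 * r + m) / 3) • w
        = (k.f t - k.f s - r • w) + ((r - m) / 3) • w := by
      rw [show (2 * r + m) / 3 = r - (r - m) / 3 by ring, sub_smul]; abel
    rw [e]
    refine (norm_add_le _ _).trans_lt ?_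
    rw [norm_smul, hw, Real.norm_of_nonneg (by linarith), ← hm]
    linarith

lemma le_norm_of_le_RO {r : ℝ} (hr : 0 < r) (h : r ≤ RO k.f k.fd univ) (s t : ℝ) {w : Euc n}
    (hw : ‖w‖ = 1) (hws : ⟪w, k.fd s⟫ = 0) : r ≤ ‖k.f t - k.f s - r • w‖ := by
  by_contra! hlt
  exact absurd ((k.RO_lt_iff hr).2 ⟨s, t, w, hw, hws, hlt⟩) (not_lt.2 h)

lemma RO_lt_of_tangent_ball {s t ρ r : ℝ} {c : Euc n} (hs : ⟪c - k.f s, k.fd s⟫ = 0)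
    (hsρ : ‖c - k.f s‖ = ρ) (ht : ‖c - k.f t‖ ≤ ρ) (hne : k.f t ≠ k.f s) (hr : ρ < r) :
    RO k.f k.fd univ < r := by
  have hρ : 0 < ρ := by
    refine lt_of_le_of_ne (hsρ ▸ norm_nonneg _) fun h0 => hne ?_
    rw [← h0, norm_eq_zero, sub_eq_zero] at hsρ
    rw [← h0, norm_le_zero_iff, sub_eq_zero] at ht
    rw [← ht, ← hsρ]
  refine (k.RO_lt_iff (hρ.trans hr)).2 ⟨s, t, ρ⁻¹ • (c - k.f s), ?_, ?_, ?_⟩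
  · rw [norm_smul, hsρ, norm_inv, Real.norm_of_nonneg hρ.le, inv_mul_cancel₀ hρ.ne']
  · rw [real_inner_smul_left, hs, mul_zero]
  · have hu : ρ • ρ⁻¹ • (c - k.f s) = c - k.f s := by
      rw [smul_smul, mul_inv_cancel₀ hρ.ne', one_smul]
    have e : k.f t - k.f s - r • ρ⁻¹ • (c - k.f s)
        = (k.f t - c) - (r - ρ) • ρ⁻¹ • (c - k.f s) := by
      rw [sub_smul, hu]; abel
    rw [e]
    refine norm_sub_smul_lt_of_norm_le ?_ hρ hr (by rwa [norm_sub_rev]) ?_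
    · rw [norm_smul, hsρ, norm_inv, Real.norm_of_nonneg hρ.le, inv_mul_cancel₀ hρ.ne']
    · rw [hu]
      intro h
      apply hne
      have : k.f t - c + c = -(c - k.f s) + c := by rw [h]
      simpa using this

/-- The normal injectivity radius of a knot equals its ball radius. -/
lemma injRad_eq_RO : injRad k.f k.fd = RO k.f k.fd univ := by
  have hL := k.Lpos
  set J : Set ℝ := {r : ℝ | 0 < r ∧ ∀ s t : ℝ, ∀ u w : Euc n,
    ⟪u, k.fd s⟫ = 0 → ⟪w, k.fd t⟫ = 0 → ‖u‖ < r → ‖w‖ < r →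
    k.f s + u = k.f t + w → k.f s = k.f t ∧ u = w} with hJ
  have hle : ∀ r ∈ J, r ≤ RO k.f k.fd univ := by
    rintro r ⟨hr, h⟩
    by_contra! hlt
    obtain ⟨q, hq, hqr⟩ := exists_between hlt
    have hq0 : 0 < q := k.RO_nonneg.trans_lt hq
    obtain ⟨s, t, w, hw, hws, hb⟩ := (k.RO_lt_iff hq0).1 hq
    set c := k.f s + q • w with hc
    have hcont : Continuous fun x => ‖k.f x - c‖ ^ 2 := by have := k.continuous_f; fun_prop
    obtain ⟨t', -, hmin⟩ := (isCompact_Icc (a := (0 : ℝ)) (b := k.L)).exists_isMinOn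
      ⟨0, by simp [hL.le]⟩ hcont.continuousOn
    have hglob : ∀ x, ‖k.f t' - c‖ ^ 2 ≤ ‖k.f x - c‖ ^ 2 := fun x => by
      obtain ⟨a', ha, ha', -⟩ := k.exists_mem_Ico x 0
      rw [zero_add] at ha
      rw [ha']
      exact hmin (Ico_subset_Icc_self ha)
    have hperp := IsLocalMin.hasDerivAt_eq_zero (Filter.Eventually.of_forall hglob)
      ((k.deriv t').sub_const c).norm_sq
    have hlt' : ‖k.f t' - c‖ < q := by
      refine lt_of_le_of_lt ((sq_le_sq₀ (norm_nonneg _) (norm_nonneg _)).1 (hglob t)) ?_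
      rwa [hc, ← sub_sub]
    have := h s t' (q • w) (c - k.f t') (by rw [real_inner_smul_left, hws, mul_zero])
      (by rw [← neg_sub, inner_neg_left]; linarith)
      (by rw [norm_smul, hw, Real.norm_of_nonneg hq0.le]; linarith)
      (by rw [norm_sub_rev]; linarith) (by rw [hc]; abel)
    have h2 : ‖q • w‖ = ‖c - k.f t'‖ := by rw [this.2]
    rw [norm_smul, hw, Real.norm_of_nonneg hq0.le, norm_sub_rev] at h2
    linarith
  have hub : ∀ r ∈ ({0} ∪ J : Set ℝ), r ≤ RO k.f k.fd univ := by
    rintro r (rfl | h)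
    · exact k.RO_nonneg
    · exact hle r h
  refine le_antisymm (csSup_le ⟨0, Or.inl rfl⟩ hub) ?_
  refine le_csSup ⟨_, hub⟩ ?_
  rcases k.RO_nonneg.eq_or_lt with h0 | h0
  · exact Or.inl h0.symm
  refine Or.inr ⟨h0, fun s t u w hu hw hus hwt he => ?_⟩
  suffices hst : k.f s = k.f t by
    refine ⟨hst, ?_⟩
    rwa [hst, add_right_inj] at he
  by_contra hne
  have key : ∀ s t : ℝ, ∀ u w : Euc n, ⟪u, k.fd s⟫ = 0 → ‖u‖ < RO k.f k.fd univ →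
      ‖w‖ ≤ ‖u‖ → k.f s + u = k.f t + w → k.f t ≠ k.f s → False := by
    intro s t u w hu hus hwu he hne
    have e1 : k.f s + u - k.f s = u := by abel
    have e2 : k.f s + u - k.f t = w := by rw [he]; abel
    exact lt_irrefl _ (k.RO_lt_of_tangent_ball (c := k.f s + u) (s := s) (t := t) (ρ := ‖u‖)
      (by rwa [e1]) (by rw [e1]) (by rwa [e2]) hne hus)
  rcases le_total ‖w‖ ‖u‖ with h | h
  · exact key s t u w hu hus h he (Ne.symm hne)
  · exact key t s w u hw hwt h he.symm hne

lemma MDC_bddBelow : BddBelow {d : ℝ | ∃ x y : ℝ, k.f x ≠ k.f y ∧ ⟪k.f x - k.f y, k.fd x⟫ = 0 ∧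
    ⟪k.f x - k.f y, k.fd y⟫ = 0 ∧ d = ‖k.f x - k.f y‖} :=
  ⟨0, by rintro _ ⟨x, y, -, -, -, rfl⟩; exact norm_nonneg _⟩

lemma MDC_le {x y : ℝ} (hne : k.f x ≠ k.f y) (hx : ⟪k.f x - k.f y, k.fd x⟫ = 0)
    (hy : ⟪k.f x - k.f y, k.fd y⟫ = 0) : MDC k.f k.fd ≤ ‖k.f x - k.f y‖ :=
  csInf_le k.MDC_bddBelow ⟨x, y, hne, hx, hy, rfl⟩

lemma RO_le_half_MDC : RO k.f k.fd univ ≤ MDC k.f k.fd / 2 := by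
  rw [le_div_iff₀ two_pos]
  obtain ⟨x, y, hne, hx, hy⟩ := k.exists_double_critical
  refine le_csInf ⟨_, x, y, hne, hx, hy, rfl⟩ ?_
  rintro _ ⟨x, y, hne, hx, -, rfl⟩
  linarith [k.RO_le_half hne hx]

end Knot

namespace Knot

variable {n : ℕ} (k : Knot n)

/-- If the ball radius is smaller than the curvature radius, it is attained by a ball tangent to
the knot at one point and touching the knot at another point. -/
lemma exists_tangent_ball {Λ : ℝ} (hΛ : 0 < Λ)
    (hlip : ∀ x y, ‖k.fd x - k.fd y‖ ≤ Λ * |x - y|) (hRO : RO k.f k.fd univ * Λ < 1) :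
    ∃ s t : ℝ, ∃ w : Euc n, k.f s ≠ k.f t ∧ ‖w‖ = 1 ∧ ⟪w, k.fd s⟫ = 0 ∧
      ‖k.f t - k.f s - RO k.f k.fd univ • w‖ ≤ RO k.f k.fd univ := by
  set R := RO k.f k.fd univ with hR
  have hR0 : 0 ≤ R := k.RO_nonneg
  obtain ⟨r₁, hr₁, hr₁Λ⟩ := exists_between (show R < 1 / Λ by rwa [lt_div_iff₀ hΛ])
  have hr₁Λ' : r₁ * Λ < 1 := by rwa [lt_div_iff₀ hΛ] at hr₁Λ
  set δ := (1 - r₁ * Λ) / (2 * Λ) with hδ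
  have hδ0 : 0 < δ := by apply div_pos <;> linarith
  set S : Set (ℝ × ℝ × Euc n) := (Icc 0 k.L ×ˢ Icc δ (k.L - δ) ×ˢ Metric.sphere 0 1) ∩
    {p | ⟪p.2.2, k.fd p.1⟫ = 0} with hS
  have hScomp : IsCompact S := by
    refine (isCompact_Icc.prod (isCompact_Icc.prod (isCompact_sphere 0 1))).inter_right ?_
    have := k.continuous_fd
    exact isClosed_eq (by fun_prop) continuous_const
  have hcont : Continuous fun p : ℝ × ℝ × Euc n =>
      ‖k.f (p.1 + p.2.1) - k.f p.1 - R • p.2.2‖ := by have := k.continuous_f; fun_prop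
  have hmem : ∀ r, R < r → r < r₁ → ∃ p ∈ S,
      ‖k.f (p.1 + p.2.1) - k.f p.1 - R • p.2.2‖ ≤ r + (r - R) := by
    intro r hr hrr
    have hr0 : 0 < r := hR0.trans_lt hr
    obtain ⟨s₀, t₀, w, hw, hws, hb⟩ := (k.RO_lt_iff hr0).1 hr
    obtain ⟨s, hs, hfs, hfds⟩ := k.exists_mem_Ico s₀ 0
    obtain ⟨t, ht, hft, -⟩ := k.exists_mem_Ico t₀ s
    rw [hfs, hft] at hb
    rw [hfds] at hws
    rw [zero_add] at hs
    have hloc : ∀ x, |x - s| ≤ δ → k.f x ≠ k.f t := by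
      intro x hx he
      have hc1 : k.f s - (k.f s + r • w) = -(r • w) := by abel
      have hc2 : ‖k.f s - (k.f s + r • w)‖ = r := by
        rw [hc1, norm_neg, norm_smul, hw, Real.norm_of_nonneg hr0.le, mul_one]
      have hxs : x ≠ s := by
        rintro rfl
        rw [← he, sub_self, zero_sub, norm_neg, norm_smul, hw, Real.norm_of_nonneg hr0.le] at hb
        linarith
      have := norm_sub_center_lt k.deriv k.unit hΛ hlip (c := k.f s + r • w) (r := r₁) (x := x)
        (by rw [hc1, inner_neg_left, real_inner_smul_left, hws]; simp) (by linarith) hxs hx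
      rw [hc2, ← sub_sub, he] at this
      linarith
    have h1 : δ < t - s := by
      by_contra! h
      exact hloc t (by rw [abs_of_nonneg (by linarith [ht.1])]; exact h) rfl
    have h2 : t - s < k.L - δ := by
      by_contra! h
      refine hloc (t - k.L) ?_ (by rw [← k.per, sub_add_cancel])
      rw [abs_of_nonpos (by linarith [ht.2])]
      linarith
    refine ⟨(s, t - s, w), ⟨⟨⟨hs.1, hs.2.le⟩, ⟨h1.le, h2.le⟩, by simpa using hw⟩, hws⟩, ?_⟩
    simp only [add_sub_cancel]
    have e : k.f t - k.f s - R • w = (k.f t - k.f s - r • w) + (r - R) • w := by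
      rw [sub_smul]; abel
    rw [e]
    refine (norm_add_le _ _).trans ?_
    rw [norm_smul, hw, Real.norm_of_nonneg (by linarith)]
    linarith
  obtain ⟨r, hr, hrr⟩ := exists_between hr₁
  obtain ⟨p₀, hp₀, -⟩ := hmem r hr hrr
  obtain ⟨⟨s, h, w⟩, hp, hmin⟩ := hScomp.exists_isMinOn ⟨p₀, hp₀⟩ hcont.continuousOn
  obtain ⟨⟨-, hh, hw⟩, hws⟩ := hp
  have hhL : h ≤ k.L - δ := hh.2
  refine ⟨s, s + h, w, (k.f_add_ne s (hδ0.trans_le hh.1) (by linarith)).symm, by simpa using hw,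
    hws, ?_⟩
  refine le_of_forall_gt fun q hq => ?_
  obtain ⟨r, hr, hrr⟩ := exists_between (show R < min r₁ ((R + q) / 2) from
    lt_min hr₁ (by linarith))
  obtain ⟨p, hp, hle⟩ := hmem r hr (hrr.trans_le (min_le_left _ _))
  have h3 := (hmin hp).trans hle
  have h4 := hrr.trans_le (min_le_right _ _)
  simp only at h3
  linarith

lemma exists_perp_near {Λ r : ℝ} (hΛ : 0 < Λ)
    (hlip : ∀ x y, ‖k.fd x - k.fd y‖ ≤ Λ * |x - y|) (hr : r * Λ < 1) {s : ℝ} {c : Euc n}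
    (hs : ⟪k.f s - c, k.fd s⟫ = 0) (hsr : ‖k.f s - c‖ = r) {η : ℝ} (hη : 0 < η) :
    ∃ μ > 0, ∀ c', ‖c' - c‖ < μ → ‖k.f s - c'‖ < r →
      ∃ s', |s' - s| ≤ η ∧ ⟪c' - k.f s', k.fd s'⟫ = 0 ∧ ‖c' - k.f s'‖ < r := by
  set δ := min η ((1 - r * Λ) / (2 * Λ)) with hδ
  have hδ0 : 0 < δ := lt_min hη (by apply div_pos <;> linarith)
  have h1 : r < ‖k.f (s + δ) - c‖ := by
    rw [← hsr]
    refine norm_sub_center_lt k.deriv k.unit hΛ hlip hs hsr.le (by linarith) ?_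
    rw [add_sub_cancel_left, abs_of_pos hδ0]; exact min_le_right _ _
  have h2 : r < ‖k.f (s - δ) - c‖ := by
    rw [← hsr]
    refine norm_sub_center_lt k.deriv k.unit hΛ hlip hs hsr.le (by linarith) ?_
    rw [sub_sub_cancel_left, abs_neg, abs_of_pos hδ0]; exact min_le_right _ _
  refine ⟨min (‖k.f (s + δ) - c‖ - r) (‖k.f (s - δ) - c‖ - r), lt_min (by linarith) (by linarith),
    fun c' hc' hlt => ?_⟩
  have h3 := hc'.trans_le (min_le_left _ _)
  have h4 := hc'.trans_le (min_le_right _ _)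
  have hfar : ∀ x, ‖c' - c‖ < ‖k.f x - c‖ - r → r < ‖k.f x - c'‖ := fun x hx => by
    have : ‖k.f x - c‖ ≤ ‖k.f x - c'‖ + ‖c' - c‖ := norm_sub_le_norm_sub_add_norm_sub _ _ _
    linarith
  have hcont : Continuous fun x => ‖k.f x - c'‖ ^ 2 := by have := k.continuous_f; fun_prop
  obtain ⟨s', hs', hmin⟩ := (isCompact_Icc (a := s - δ) (b := s + δ)).exists_isMinOn
    ⟨s, by constructor <;> linarith⟩ hcont.continuousOn
  have hle : ‖k.f s' - c'‖ < r := by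
    refine lt_of_le_of_lt ((sq_le_sq₀ (norm_nonneg _) (norm_nonneg _)).1
      (hmin (a := s) ⟨by linarith, by linarith⟩)) hlt
  have hne1 : s' ≠ s - δ := by rintro rfl; linarith [hfar _ h4]
  have hne2 : s' ≠ s + δ := by rintro rfl; linarith [hfar _ h3]
  have hloc : IsLocalMin (fun x => ‖k.f x - c'‖ ^ 2) s' :=
    hmin.isLocalMin (Icc_mem_nhds (lt_of_le_of_ne hs'.1 hne1.symm) (lt_of_le_of_ne hs'.2 hne2))
  have hperp := hloc.hasDerivAt_eq_zero ((k.deriv s').sub_const c').norm_sq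
  refine ⟨s', ?_, ?_, by rwa [norm_sub_rev]⟩
  · rw [abs_le]
    have := min_le_left η ((1 - r * Λ) / (2 * Λ))
    constructor <;> linarith [hs'.1, hs'.2]
  · rw [← neg_sub, inner_neg_left]; linarith

/-- If the ball radius is smaller than the curvature radius, then it is half the length of a
double critical pair. -/
lemma exists_double_critical_of_RO_lt {Λ : ℝ} (hΛ : 0 < Λ)
    (hlip : ∀ x y, ‖k.fd x - k.fd y‖ ≤ Λ * |x - y|) (hRO : RO k.f k.fd univ * Λ < 1) :
    ∃ x y : ℝ, k.f x ≠ k.f y ∧ ⟪k.f x - k.f y, k.fd x⟫ = 0 ∧ ⟪k.f x - k.f y, k.fd y⟫ = 0 ∧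
      ‖k.f x - k.f y‖ = 2 * RO k.f k.fd univ := by
  obtain ⟨s, t, w, hst, hw, hws, hle⟩ := k.exists_tangent_ball hΛ hlip hRO
  set R := RO k.f k.fd univ with hR
  have hR0 : 0 < R := by
    refine lt_of_le_of_ne k.RO_nonneg fun h0 => hst ?_
    rw [← h0, zero_smul, sub_zero, norm_le_zero_iff, sub_eq_zero] at hle
    exact hle.symm
  set c := k.f s + R • w with hc
  have hsc : k.f s - c = -(R • w) := by rw [hc]; abel
  have hscR : ‖k.f s - c‖ = R := by
    rw [hsc, norm_neg, norm_smul, hw, Real.norm_of_nonneg hR0.le, mul_one]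
  have hsperp : ⟪k.f s - c, k.fd s⟫ = 0 := by
    rw [hsc, inner_neg_left, real_inner_smul_left, hws]; simp
  have hge : ∀ x, R ≤ ‖k.f x - c‖ := fun x => by
    rw [hc, ← sub_sub]; exact k.le_norm_of_le_RO hR0 le_rfl s x hw hws
  have htcR : ‖k.f t - c‖ = R := le_antisymm (by rwa [hc, ← sub_sub]) (hge t)
  have htperp : ⟪k.f t - c, k.fd t⟫ = 0 := by
    have hloc : IsLocalMin (fun x => ‖k.f x - c‖ ^ 2) t :=
      Filter.Eventually.of_forall fun x => by
        simp only; rw [htcR]; have := hge x; gcongr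
    have := hloc.hasDerivAt_eq_zero ((k.deriv t).sub_const c).norm_sq
    linarith
  set a := k.f s - c with ha
  set b := k.f t - c with hb
  suffices hab : a + b = 0 by
    have e : k.f s - k.f t = a - b := by rw [ha, hb]; abel
    have hb' : b = -a := (neg_eq_of_add_eq_zero_right hab).symm
    have ha' : a = -b := by rw [hb', neg_neg]
    refine ⟨s, t, hst, ?_, ?_, ?_⟩
    · rw [e, hb', sub_neg_eq_add, inner_add_left, hsperp, add_zero]
    · rw [e, ha', inner_sub_left, inner_neg_left, htperp]; simp
    · rw [e, hb', sub_neg_eq_add, ← two_smul ℝ, norm_smul, hscR]; simp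
  by_contra hz
  set z := a + b with hzdef
  have hz0 : 0 < ‖z‖ ^ 2 := by positivity
  have hzz : ‖z‖ ^ 2 = 2 * (R ^ 2 + ⟪a, b⟫) := by
    rw [hzdef, norm_add_sq_real, hscR, htcR]; ring
  have hza : ⟪a, z⟫ = ‖z‖ ^ 2 / 2 := by
    rw [hzz, hzdef, inner_add_right, real_inner_self_eq_norm_sq, hscR]; ring
  have hzb : ⟪b, z⟫ = ‖z‖ ^ 2 / 2 := by
    rw [hzz, hzdef, inner_add_right, real_inner_self_eq_norm_sq, htcR, real_inner_comm]; ring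
  have hnear : ∀ ε : ℝ, 0 < ε → ε < 1 → ∀ v, ‖v‖ = R → ⟪v, z⟫ = ‖z‖ ^ 2 / 2 → ‖v - ε • z‖ < R := by
    intro ε hε hε1 v hv hvz
    refine lt_of_pow_lt_pow_left₀ 2 hR0.le ?_
    rw [norm_sub_sq_real, hv, real_inner_smul_right, hvz, norm_smul, Real.norm_of_nonneg hε.le,
      mul_pow]
    nlinarith [mul_pos hε hz0, mul_pos (mul_pos hε hz0) (sub_pos.2 hε1)]
  obtain ⟨η, hη, hsep⟩ : ∃ η > 0, ∀ x y, |x - s| ≤ η → |y - t| ≤ η → k.f y ≠ k.f x := by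
    have hpos : 0 < ‖k.f s - k.f t‖ := norm_pos_iff.2 (sub_ne_zero.2 hst)
    refine ⟨‖k.f s - k.f t‖ / 3, by positivity, fun x y hx hy he => ?_⟩
    have h1 := norm_sub_le_of_unit_speed k.deriv k.unit x s
    have h2 := norm_sub_le_of_unit_speed k.deriv k.unit t y
    have h3 : ‖k.f s - k.f t‖ ≤ ‖k.f s - k.f x‖ + ‖k.f x - k.f t‖ :=
      norm_sub_le_norm_sub_add_norm_sub _ _ _
    rw [abs_sub_comm] at h1
    rw [← he] at h3 h1
    linarith
  obtain ⟨μ₁, hμ₁, h1⟩ := k.exists_perp_near hΛ hlip hRO hsperp hscR hη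
  obtain ⟨μ₂, hμ₂, h2⟩ := k.exists_perp_near hΛ hlip hRO htperp htcR hη
  have hzn : 0 < ‖z‖ := norm_pos_iff.2 hz
  set ε := min (1 / 2) (min μ₁ μ₂ / (2 * ‖z‖)) with hε
  have hε0 : 0 < ε := lt_min (by norm_num) (div_pos (lt_min hμ₁ hμ₂) (by positivity))
  have hε1 : ε < 1 := (min_le_left _ _).trans_lt (by norm_num)
  have hεz : ε * ‖z‖ < min μ₁ μ₂ := by
    have : ε ≤ min μ₁ μ₂ / (2 * ‖z‖) := min_le_right _ _
    rw [le_div_iff₀ (by positivity)] at this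
    have := lt_min hμ₁ hμ₂
    linarith
  have hcc : ‖c + ε • z - c‖ = ε * ‖z‖ := by
    rw [add_sub_cancel_left, norm_smul, Real.norm_of_nonneg hε0.le]
  obtain ⟨s', hs', hs'p, hs'R⟩ := h1 (c + ε • z) (by rw [hcc]; exact hεz.trans_le (min_le_left _ _))
    (by rw [← sub_sub]; exact hnear ε hε0 hε1 _ hscR hza)
  obtain ⟨t', ht', ht'p, ht'R⟩ := h2 (c + ε • z)
    (by rw [hcc]; exact hεz.trans_le (min_le_right _ _))
    (by rw [← sub_sub]; exact hnear ε hε0 hε1 _ htcR hzb)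
  rcases le_total ‖c + ε • z - k.f t'‖ ‖c + ε • z - k.f s'‖ with h | h
  · exact lt_irrefl _ (k.RO_lt_of_tangent_ball hs'p rfl h (hsep s' t' hs' ht') hs'R)
  · exact lt_irrefl _ (k.RO_lt_of_tangent_ball ht'p rfl h (hsep s' t' hs' ht').symm ht'R)

end Knot

section

variable {E : Type*} [NormedAddCommGroup E] [InnerProductSpace ℝ E]

lemma norm_sub_eq_two_mul_sin {u v : E} (hu : ‖u‖ = 1) (hv : ‖v‖ = 1) :
    ‖u - v‖ = 2 * Real.sin (InnerProductGeometry.angle u v / 2) := by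
  have h0 := InnerProductGeometry.angle_nonneg u v
  have hπ := InnerProductGeometry.angle_le_pi u v
  have hsin : 0 ≤ Real.sin (InnerProductGeometry.angle u v / 2) :=
    Real.sin_nonneg_of_nonneg_of_le_pi (by linarith) (by linarith)
  refine (sq_eq_sq₀ (norm_nonneg _) (by positivity)).1 ?_
  have hc := InnerProductGeometry.cos_angle_mul_norm_mul_norm u v
  rw [hu, hv, mul_one, mul_one] at hc
  rw [norm_sub_sq_real, hu, hv, ← hc, mul_pow, Real.sin_sq_eq_half_sub,
    mul_div_cancel₀ _ (two_ne_zero)]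
  ring

lemma norm_sub_le_angle {u v : E} (hu : ‖u‖ = 1) (hv : ‖v‖ = 1) :
    ‖u - v‖ ≤ InnerProductGeometry.angle u v := by
  rw [norm_sub_eq_two_mul_sin hu hv]
  have := Real.sin_le (x := InnerProductGeometry.angle u v / 2)
    (by have := InnerProductGeometry.angle_nonneg u v; linarith)
  linarith

lemma angle_mul_le_norm_sub {u v : E} (hu : ‖u‖ = 1) (hv : ‖v‖ = 1) :
    InnerProductGeometry.angle u v * (1 - ‖u - v‖ ^ 2 / 4) ≤ ‖u - v‖ := by
  have hs := norm_sub_eq_two_mul_sin hu hv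
  have h0 := InnerProductGeometry.angle_nonneg u v
  have hπ := InnerProductGeometry.angle_le_pi u v
  set θ := InnerProductGeometry.angle u v
  set c := ‖u - v‖
  have h2 : θ ≤ 2 * c := by
    have h3 := Real.mul_le_sin (x := θ / 2) (by linarith) (by linarith)
    have h4 : θ / 4 ≤ 2 / Real.pi * (θ / 2) := by
      rw [div_mul_div_comm, div_le_div_iff₀ (by norm_num) (by positivity)]
      nlinarith [Real.pi_le_four]
    linarith
  rcases h0.eq_or_lt with h0 | h0
  · rw [← h0, zero_mul]; exact norm_nonneg _
  have h5 := Real.sin_gt_sub_cube (x := θ / 2) (by linarith)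
  have h6 : θ ^ 2 ≤ 4 * c ^ 2 := by nlinarith
  nlinarith [mul_le_mul_of_nonneg_left h6 h0.le, mul_nonneg h0.le (sq_nonneg c)]

lemma min_mul_norm_sub_le {u v : E} (hu : ‖u‖ = 1) (hv : ‖v‖ = 1) {a b m : ℝ} (hm : 0 ≤ m)
    (ha : m ≤ a) (hb : m ≤ b) : m * ‖u - v‖ ≤ ‖a • u - b • v‖ := by
  refine le_of_sq_le_sq ?_ (norm_nonneg _)
  rw [mul_pow, norm_sub_sq_real, norm_sub_sq_real, norm_smul, norm_smul, real_inner_smul_left,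
    real_inner_smul_right, hu, hv, Real.norm_of_nonneg (hm.trans ha),
    Real.norm_of_nonneg (hm.trans hb)]
  have h1 : ⟪u, v⟫ ≤ 1 := by simpa [hu, hv] using real_inner_le_norm u v
  have h2 : m * m ≤ a * b := mul_le_mul ha hb hm (hm.trans ha)
  nlinarith [sq_nonneg (a - b), mul_le_mul_of_nonneg_right h2 (sub_nonneg.2 h1)]

end

namespace Knot

variable {n : ℕ} (k : Knot n)

lemma norm_perp_le {R : ℝ} (hR : 0 < R) (hle : R ≤ RO k.f k.fd univ) (s t : ℝ) :
    2 * R * ‖k.f t - k.f s - ⟪k.f t - k.f s, k.fd s⟫ • k.fd s‖ ≤ ‖k.f t - k.f s‖ ^ 2 := by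
  set d := k.f t - k.f s with hd
  set p := d - ⟪d, k.fd s⟫ • k.fd s with hp
  rcases eq_or_ne p 0 with h0 | h0
  · rw [h0]; simp
  have hp0 : 0 < ‖p‖ := norm_pos_iff.2 h0
  have hps : ⟪p, k.fd s⟫ = 0 := by
    rw [hp, inner_sub_left, real_inner_smul_left, real_inner_self_eq_norm_sq, k.unit]; ring
  have hdp : ⟪d, p⟫ = ‖p‖ ^ 2 := by
    have : d = p + ⟪d, k.fd s⟫ • k.fd s := by rw [hp]; abel
    rw [← real_inner_self_eq_norm_sq]
    conv_lhs => rw [this]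
    rw [inner_add_left, real_inner_smul_left, real_inner_comm p (k.fd s), hps]; ring
  have h := k.le_norm_of_le_RO hR hle s t (w := ‖p‖⁻¹ • p)
    (by rw [norm_smul, norm_inv, norm_norm, inv_mul_cancel₀ hp0.ne'])
    (by rw [real_inner_smul_left, hps, mul_zero])
  rw [← hd] at h
  have h2 := pow_le_pow_left₀ hR.le h 2
  rw [norm_sub_sq_real, norm_smul, norm_smul, norm_inv, norm_norm, inv_mul_cancel₀ hp0.ne',
    real_inner_smul_right, real_inner_smul_right, hdp, Real.norm_of_nonneg hR.le] at h2
  have e : R * (‖p‖⁻¹ * ‖p‖ ^ 2) = R * ‖p‖ := by field_simp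
  rw [e] at h2
  linarith

lemma norm_fd_sub_mul_le {R C : ℝ} (hR : 0 < R) (hle : R ≤ RO k.f k.fd univ)
    (hC : ∀ x y, ‖k.fd x - k.fd y‖ ≤ C * |x - y|) (hC0 : 0 ≤ C) {s t : ℝ} (hst : s < t)
    (h1 : C * (t - s) ≤ 1) :
    (1 - C * (t - s)) * ‖k.fd t - k.fd s‖ ≤ R⁻¹ * (t - s) := by
  set d := k.f t - k.f s with hd
  have hh : 0 < t - s := sub_pos.2 hst
  have hnear : ∀ z ∈ Icc s t, ∀ y ∈ Icc s t, 1 - C * (t - s) ≤ ⟪k.fd z, k.fd y⟫ := by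
    intro z hz y hy
    have h2 := one_sub_norm_le_inner (u := k.fd z) (k.unit y)
    have h3 := hC z y
    have h4 : |z - y| ≤ t - s := by
      rw [abs_le]; constructor <;> linarith [hz.1, hz.2, hy.1, hy.2]
    nlinarith
  have hP : ∀ y ∈ Icc s t, (1 - C * (t - s)) * (t - s) ≤ ⟪d, k.fd y⟫ := fun y hy =>
    mul_le_inner_sub_of_le_inner k.deriv hst.le fun z hz => hnear z hz y hy
  have hdn : ‖d‖ ^ 2 ≤ (t - s) ^ 2 := by
    have := norm_sub_le_of_unit_speed k.deriv k.unit s t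
    rw [abs_of_pos hh] at this
    gcongr
  have hp := k.norm_perp_le hR hle s t
  have hp' := k.norm_perp_le hR hle t s
  have e : k.f s - k.f t = -d := by rw [hd]; abel
  rw [e, inner_neg_left, norm_neg, neg_smul, ← neg_sub', norm_neg] at hp'
  rw [← hd] at hp
  have h5 := min_mul_norm_sub_le (k.unit t) (k.unit s)
    (mul_nonneg (sub_nonneg.2 h1) hh.le) (hP t (right_mem_Icc.2 hst.le))
    (hP s (left_mem_Icc.2 hst.le))
  have h6 : ‖⟪d, k.fd t⟫ • k.fd t - ⟪d, k.fd s⟫ • k.fd s‖ ≤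
      ‖d - ⟪d, k.fd s⟫ • k.fd s‖ + ‖d - ⟪d, k.fd t⟫ • k.fd t‖ := by
    rw [show ⟪d, k.fd t⟫ • k.fd t - ⟪d, k.fd s⟫ • k.fd s =
      (d - ⟪d, k.fd s⟫ • k.fd s) - (d - ⟪d, k.fd t⟫ • k.fd t) by abel]
    exact norm_sub_le _ _
  have h7 : R * ((t - s) * ((1 - C * (t - s)) * ‖k.fd t - k.fd s‖)) ≤ (t - s) * (t - s) := by
    nlinarith
  rw [inv_mul_eq_div, le_div_iff₀ hR]
  refine le_of_mul_le_mul_left ?_ hh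
  linarith

/-- The tangent field is Lipschitz with constant the inverse of the ball radius. -/
lemma norm_fd_sub_le_of_le_RO {R : ℝ} (hR : 0 < R) (hle : R ≤ RO k.f k.fd univ) (x y : ℝ) :
    ‖k.fd x - k.fd y‖ ≤ R⁻¹ * |x - y| := by
  obtain ⟨C, hC0, hC⟩ := k.exists_norm_fd_sub_le
  refine k.lipd.choose_spec.of_norm_deriv_le (ae_of_all _ fun s => ?_) x y
  refine le_of_forall_gt_imp_ge_of_dense fun Λ hΛ => ?_
  have hR' : 0 < R⁻¹ := inv_pos.2 hR
  have hΛ0 : 0 < Λ := hR'.trans hΛ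
  have hδ : 0 < (1 - R⁻¹ / Λ) / C := by
    apply div_pos _ hC0
    rw [sub_pos, div_lt_one hΛ0]; exact hΛ
  have key : ∀ a b : ℝ, a < b → b - a < (1 - R⁻¹ / Λ) / C → ‖k.fd b - k.fd a‖ ≤ Λ * (b - a) := by
    intro a b hab hb
    rw [lt_div_iff₀ hC0] at hb
    have h0 : 0 < R⁻¹ / Λ := by positivity
    have h1 := k.norm_fd_sub_mul_le hR hle hC hC0.le hab (by linarith)
    have h2 : R⁻¹ / Λ * ‖k.fd b - k.fd a‖ ≤ R⁻¹ * (b - a) :=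
      (mul_le_mul_of_nonneg_right (by linarith) (norm_nonneg _)).trans h1
    rw [div_mul_eq_mul_div, mul_div_assoc] at h2
    have h3 := le_of_mul_le_mul_left h2 hR'
    rwa [div_le_iff₀ hΛ0, mul_comm] at h3
  refine norm_deriv_le_of_lip' hΛ0.le ?_
  filter_upwards [Metric.ball_mem_nhds s hδ] with z hz
  rw [Metric.mem_ball, Real.dist_eq] at hz
  rw [Real.norm_eq_abs]
  rcases lt_trichotomy z s with h | rfl | h
  · rw [abs_of_neg (by linarith)] at hz ⊢
    rw [norm_sub_rev, neg_sub]
    exact key z s h (by linarith)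
  · simp
  · rw [abs_of_pos (by linarith)] at hz ⊢
    exact key s z h hz

lemma curvAt_le {Λ : ℝ} (hΛ : 0 < Λ) (hlip : ∀ x y, ‖k.fd x - k.fd y‖ ≤ Λ * |x - y|) (s : ℝ) :
    curvAt k.fd univ s ≤ Λ := by
  refine le_of_forall_gt_imp_ge_of_dense fun Λ₁ hΛ₁ => ?_
  have hΛ₁0 : 0 < Λ₁ := hΛ.trans hΛ₁
  refine csInf_le ⟨0, fun _ h => h.1⟩ ⟨hΛ₁0.le, min (1 / (2 * Λ)) ((Λ₁ - Λ) / (Λ₁ * Λ)),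
    lt_min (by positivity) (div_pos (by linarith) (by positivity)), ?_⟩
  rintro x - y - - hx hy
  have hx1 := hx.trans_le (min_le_left _ _)
  have hx2 := hx.trans_le (min_le_right _ _)
  have hy1 := hy.trans_le (min_le_left _ _)
  have hy2 := hy.trans_le (min_le_right _ _)
  rw [lt_div_iff₀ (by positivity)] at hx1 hx2 hy1 hy2
  have hxy : |x - y| ≤ |x - s| + |y - s| := by
    rw [abs_sub_comm y s]; exact abs_sub_le x s y
  have hc := hlip x y
  have hc0 := norm_nonneg (k.fd x - k.fd y)
  have hc1 : ‖k.fd x - k.fd y‖ ≤ 1 := by nlinarith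
  have h := angle_mul_le_norm_sub (k.unit x) (k.unit y)
  have hc2 : Λ₁ * ‖k.fd x - k.fd y‖ ≤ 2 * (Λ₁ - Λ) := by
    have : Λ₁ * ‖k.fd x - k.fd y‖ ≤ Λ₁ * (Λ * (|x - s| + |y - s|)) := by gcongr; nlinarith
    nlinarith
  have h0 := InnerProductGeometry.angle_nonneg (k.fd x) (k.fd y)
  set θ := InnerProductGeometry.angle (k.fd x) (k.fd y)
  set c := ‖k.fd x - k.fd y‖
  have h3 : Λ ≤ Λ₁ * (1 - c ^ 2 / 4) := by nlinarith
  have h4 : Λ * θ ≤ Λ * (Λ₁ * |x - y|) := by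
    calc Λ * θ ≤ Λ₁ * (1 - c ^ 2 / 4) * θ := by gcongr
      _ = Λ₁ * (θ * (1 - c ^ 2 / 4)) := by ring
      _ ≤ Λ₁ * (Λ * |x - y|) := by exact mul_le_mul_of_nonneg_left (h.trans hc) hΛ₁0.le
      _ = Λ * (Λ₁ * |x - y|) := by ring
  exact le_of_mul_le_mul_left h4 hΛ

lemma exists_norm_fd_sub_le_near {Λ s : ℝ} (h : curvAt k.fd univ s < Λ)
    (hlip : ∀ x y, ‖k.fd x - k.fd y‖ ≤ Λ * |x - y|) :
    ∃ Λ' < Λ, 0 ≤ Λ' ∧ ∃ δ > 0, ∀ x y, |x - s| < δ → |y - s| < δ →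
      ‖k.fd x - k.fd y‖ ≤ Λ' * |x - y| := by
  rcases Set.eq_empty_or_nonempty {Λ : ℝ | 0 ≤ Λ ∧ ∃ δ > 0, ∀ x ∈ univ, ∀ y ∈ univ, x ≠ y →
    |x - s| < δ → |y - s| < δ →
    InnerProductGeometry.angle (k.fd x) (k.fd y) ≤ Λ * |x - y|} with he | hne
  · exfalso
    have hΛ : 0 < Λ := by rwa [curvAt, he, Real.sInf_empty] at h
    have h1 : Λ * (Real.pi / 2) ∈ (∅ : Set ℝ) := by
      rw [← he]
      refine ⟨by positivity, 1, one_pos, fun x _ y _ _ _ _ => ?_⟩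
      have hs := norm_sub_eq_two_mul_sin (k.unit x) (k.unit y)
      have h0 := InnerProductGeometry.angle_nonneg (k.fd x) (k.fd y)
      have hπ := InnerProductGeometry.angle_le_pi (k.fd x) (k.fd y)
      have h3 := Real.mul_le_sin (x := InnerProductGeometry.angle (k.fd x) (k.fd y) / 2)
        (by linarith) (by linarith)
      rw [div_mul_div_comm, div_le_iff₀ (by positivity)] at h3
      have := hlip x y
      nlinarith [Real.pi_pos]
    exact h1
  · obtain ⟨Λ', ⟨h0, δ, hδ, hb⟩, hlt⟩ := exists_lt_of_csInf_lt hne h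
    refine ⟨Λ', hlt, h0, δ, hδ, fun x y hx hy => ?_⟩
    rcases eq_or_ne x y with rfl | hxy
    · simp
    · exact (norm_sub_le_angle (k.unit x) (k.unit y)).trans
        (hb x (mem_univ _) y (mem_univ _) hxy hx hy)

end Knot

namespace Knot

variable {n : ℕ} (k : Knot n)

/-- `g` is a closed curve of period `1` with derivative `gd` which is `c`-close in `C¹` to the
knot `k` rescaled to period `1`. -/
structure Near (c : ℝ) (g gd : ℝ → Euc n) : Prop where
  per : ∀ s, g (s + 1) = g s
  hasDeriv : ∀ s, HasDerivAt g (gd s) s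
  close : ∀ s, ‖g s - k.f (k.L * s)‖ ≤ c
  closed : ∀ s, ‖gd s - k.L • k.fd (k.L * s)‖ ≤ c

variable {k} {c C : ℝ} {g gd : ℝ → Euc n}

lemma Near.nonneg (hg : k.Near c g gd) : 0 ≤ c := (norm_nonneg _).trans (hg.close 0)

lemma hasDerivAt_rescale (k : Knot n) (s : ℝ) :
    HasDerivAt (fun s => k.f (k.L * s)) (k.L • k.fd (k.L * s)) s := by
  have h := ((hasDerivAt_id s).const_mul k.L)
  rw [mul_one] at h
  exact (k.deriv (k.L * s)).scomp s h

lemma Near.inner_pos (hg : k.Near c g gd) (hC : ∀ x y, ‖k.fd x - k.fd y‖ ≤ C * |x - y|)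
    (hc : c ≤ k.L / 8) (x : ℝ) {h : ℝ} (h0 : 0 < h) (hC0 : 0 ≤ C) (hCh : C * (k.L * h) ≤ 1 / 2) :
    0 < ⟪g (x + h) - g x, gd x⟫ := by
  have hL := k.Lpos
  have hc0 := hg.nonneg
  have hx : ∀ z, ‖gd z‖ ≤ k.L + c := fun z => by
    have := norm_le_norm_add_norm_sub' (gd z) (k.L • k.fd (k.L * z))
    rw [norm_smul, k.unit, Real.norm_of_nonneg hL.le, mul_one] at this
    linarith [hg.closed z]
  have key : ∀ z ∈ Icc x (x + h), k.L ^ 2 / 8 ≤ ⟪gd z, gd x⟫ := by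
    intro z hz
    set u := k.fd (k.L * z)
    set v := k.fd (k.L * x)
    have h1 : 1 / 2 ≤ ⟪u, v⟫ := by
      have h2 := one_sub_norm_le_inner (u := u) (k.unit (k.L * x))
      have h3 := hC (k.L * z) (k.L * x)
      rw [← mul_sub, abs_mul, abs_of_pos hL, abs_of_nonneg (by linarith [hz.1])] at h3
      have h4 : C * (k.L * (z - x)) ≤ C * (k.L * h) := by gcongr; linarith [hz.2]
      linarith
    have e : ⟪gd z, gd x⟫ = k.L ^ 2 * ⟪u, v⟫ + k.L * ⟪u, gd x - k.L • v⟫ +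
        ⟪gd z - k.L • u, gd x⟫ := by
      simp only [inner_sub_left, inner_sub_right, real_inner_smul_left, real_inner_smul_right]
      ring
    have h5 := abs_le.1 ((abs_real_inner_le_norm u (gd x - k.L • v)).trans
      (mul_le_mul (k.unit _).le (hg.closed x) (norm_nonneg _) zero_le_one))
    have h6 := abs_le.1 ((abs_real_inner_le_norm (gd z - k.L • u) (gd x)).trans
      (mul_le_mul (hg.closed z) (hx x) (norm_nonneg _) hc0))
    rw [e]
    nlinarith [h5.1, h6.1]
  have := mul_le_inner_sub_of_le_inner hg.hasDeriv (by linarith) key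
  rw [add_sub_cancel_left] at this
  exact lt_of_lt_of_le (by positivity) this

variable (k)

lemma exists_near_ne : ∃ c > 0, ∀ g gd : ℝ → Euc n, k.Near c g gd →
    ∀ x h : ℝ, 0 < h → h < 1 → g (x + h) ≠ g x := by
  obtain ⟨C, hC0, hC⟩ := k.exists_norm_fd_sub_le
  have hL := k.Lpos
  set δ := 1 / (2 * C * k.L) with hδ
  have hCδ : C * (k.L * δ) = 1 / 2 := by rw [hδ]; field_simp
  have hcont : Continuous fun p : ℝ × ℝ => ‖k.f (k.L * (p.1 + p.2)) - k.f (k.L * p.1)‖ := by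
    have := k.continuous_f; fun_prop
  obtain ⟨m, hm, hmin⟩ : ∃ m > 0, ∀ x h, δ ≤ h → h ≤ 1 - δ →
      m ≤ ‖k.f (k.L * (x + h)) - k.f (k.L * x)‖ := by
    have hcomp : IsCompact (Icc (0 : ℝ) 1 ×ˢ Icc δ (1 - δ)) := isCompact_Icc.prod isCompact_Icc
    have hpos : ∀ p ∈ Icc (0 : ℝ) 1 ×ˢ Icc δ (1 - δ),
        0 < ‖k.f (k.L * (p.1 + p.2)) - k.f (k.L * p.1)‖ := by
      rintro ⟨x, h⟩ ⟨-, hh⟩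
      have hδ0 : 0 < δ := by positivity
      simp only at hh ⊢
      rw [norm_pos_iff, sub_ne_zero, mul_add]
      refine k.f_add_ne _ (mul_pos hL (hδ0.trans_le hh.1)) ?_
      nlinarith [hh.2]
    obtain ⟨m, hm, hmin⟩ := hcomp.exists_forall_le' hcont.continuousOn hpos
    refine ⟨m, hm, fun x h h1 h2 => ?_⟩
    have hp : Function.Periodic (fun x => ‖k.f (k.L * (x + h)) - k.f (k.L * x)‖) 1 := fun x => by
      simp only
      rw [show k.L * (x + 1 + h) = k.L * (x + h) + k.L by ring,
        show k.L * (x + 1) = k.L * x + k.L by ring, k.per, k.per]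
    obtain ⟨y, hy, hxy⟩ := hp.exists_mem_Ico₀ one_pos x
    rw [hxy]
    exact hmin (y, h) ⟨⟨hy.1, hy.2.le⟩, h1, h2⟩
  refine ⟨min (k.L / 8) (m / 3), by positivity, fun g gd hg x h h0 h1 he => ?_⟩
  rcases le_or_gt h δ with hh | hh
  · have := hg.inner_pos hC (min_le_left _ _) x h0 hC0.le
      (by rw [← hCδ]; gcongr)
    rw [he, sub_self, inner_zero_left] at this
    exact lt_irrefl _ this
  rcases le_or_gt h (1 - δ) with hh' | hh'
  · have h2 := hmin x h hh.le hh'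
    have h3 := (hg.close (x + h)).trans (min_le_right _ _)
    have h4 := (hg.close x).trans (min_le_right _ _)
    rw [he, norm_sub_rev] at h3
    have h5 := norm_sub_le_norm_sub_add_norm_sub (k.f (k.L * (x + h))) (g x) (k.f (k.L * x))
    linarith
  · have := hg.inner_pos hC (min_le_left _ _) (x + h - 1) (h := 1 - h) (by linarith) hC0.le
      (by rw [← hCδ]; gcongr; linarith)
    rw [show x + h - 1 + (1 - h) = x by ring, ← hg.per (x + h - 1),
      show x + h - 1 + 1 = x + h by ring, he, sub_self, inner_zero_left] at this
    exact lt_irrefl _ this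

lemma exists_near_injOn : ∃ c > 0, ∀ g gd : ℝ → Euc n, k.Near c g gd → InjOn g (Ico 0 1) := by
  obtain ⟨c, hc, h⟩ := k.exists_near_ne
  refine ⟨c, hc, fun g gd hg x hx y hy hxy => ?_⟩
  rcases lt_trichotomy x y with hlt | rfl | hlt
  · have := h g gd hg x (y - x) (by linarith) (by linarith [hx.1, hy.2])
    rw [add_sub_cancel] at this
    exact absurd hxy.symm this
  · rfl
  · have := h g gd hg y (x - y) (by linarith) (by linarith [hy.1, hx.2])
    rw [add_sub_cancel] at this
    exact absurd hxy this

lemma exists_near_sameKnotClass : ∃ c > 0, ∀ η : Knot n,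
    k.Near c (fun s => η.f (η.L * s)) (fun s => η.L • η.fd (η.L * s)) → SameKnotClass k η := by
  obtain ⟨c, hc, h⟩ := k.exists_near_injOn
  refine ⟨c, hc, fun η hη => ⟨fun t s => k.f (k.L * s) + t • (η.f (η.L * s) - k.f (k.L * s)),
    ?_, ?_, ?_, ?_, ?_⟩⟩
  · have h1 := k.continuous_f
    have h2 := η.continuous_f
    exact Continuous.continuousOn (by fun_prop)
  · intro t s
    simp only [mul_add, mul_one, k.per, η.per]
  · intro s; simp
  · intro s; simp
  · rintro t ⟨ht0, ht1⟩
    refine h _ (fun s => k.L • k.fd (k.L * s) +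
      t • (η.L • η.fd (η.L * s) - k.L • k.fd (k.L * s))) ⟨?_, ?_, ?_, ?_⟩
    · intro s
      simp only [mul_add, mul_one, k.per, η.per]
    · intro s
      exact (k.hasDerivAt_rescale s).add
        (((η.hasDerivAt_rescale s).sub (k.hasDerivAt_rescale s)).const_smul t)
    · intro s
      rw [add_sub_cancel_left, norm_smul, Real.norm_of_nonneg ht0]
      exact (mul_le_of_le_one_left (norm_nonneg _) ht1).trans (hη.close s)
    · intro s
      rw [add_sub_cancel_left, norm_smul, Real.norm_of_nonneg ht0]
      exact (mul_le_of_le_one_left (norm_nonneg _) ht1).trans (hη.closed s)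

lemma abs_inner_le_of_close {E : Type*} [NormedAddCommGroup E] [InnerProductSpace ℝ E]
    {d d' v v' : E} {a b B D : ℝ} (h : ⟪d', v'⟫ = 0) (hd : ‖d - d'‖ ≤ a) (hv : ‖v - v'‖ ≤ b)
    (hB : ‖v‖ ≤ B) (hD : ‖d'‖ ≤ D) : |⟪d, v⟫| ≤ a * B + D * b := by
  have e : ⟪d, v⟫ = ⟪d - d', v⟫ + ⟪d', v - v'⟫ := by
    rw [inner_sub_left, inner_sub_right, h]; ring
  rw [e]
  refine (abs_add_le _ _).trans (add_le_add ?_ ?_)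
  · exact (abs_real_inner_le_norm _ _).trans
      (mul_le_mul hd hB (norm_nonneg _) ((norm_nonneg _).trans hd))
  · exact (abs_real_inner_le_norm _ _).trans
      (mul_le_mul hD hv (norm_nonneg _) ((norm_nonneg _).trans hD))

/-- Lower semicontinuity of the minimal double critical distance in the `C¹` topology. -/
lemma exists_near_lt_double_critical {d : ℝ} (hd0 : 0 ≤ d) (hd : d < MDC k.f k.fd) :
    ∃ c > 0, ∀ η : Knot n,
    k.Near c (fun s => η.f (η.L * s)) (fun s => η.L • η.fd (η.L * s)) →
    ∀ x y : ℝ, η.f x ≠ η.f y → ⟪η.f x - η.f y, η.fd x⟫ = 0 → ⟪η.f x - η.f y, η.fd y⟫ = 0 →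
      d < ‖η.f x - η.f y‖ := by
  obtain ⟨C, hC0, hC⟩ := k.exists_norm_fd_sub_le
  have hL := k.Lpos
  set δ := 1 / (2 * C * k.L) with hδ
  have hδ0 : 0 < δ := by positivity
  have hCδ : C * (k.L * δ) = 1 / 2 := by rw [hδ]; field_simp
  set Φ : ℝ × ℝ → ℝ := fun p =>
    |⟪k.f (k.L * p.1) - k.f (k.L * (p.1 + p.2)), k.L • k.fd (k.L * p.1)⟫| +
    |⟪k.f (k.L * p.1) - k.f (k.L * (p.1 + p.2)), k.L • k.fd (k.L * (p.1 + p.2))⟫| +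
    max 0 (‖k.f (k.L * p.1) - k.f (k.L * (p.1 + p.2))‖ - d) with hΦ
  have hcont : Continuous Φ := by
    have := k.continuous_f; have := k.continuous_fd; fun_prop
  obtain ⟨m, hm, hmin⟩ : ∃ m > 0, ∀ x h, 0 ≤ x → x ≤ 1 → δ ≤ h → h ≤ 1 - δ → m ≤ Φ (x, h) := by
    have hcomp : IsCompact (Icc (0 : ℝ) 1 ×ˢ Icc δ (1 - δ)) := isCompact_Icc.prod isCompact_Icc
    have hpos : ∀ p ∈ Icc (0 : ℝ) 1 ×ˢ Icc δ (1 - δ), 0 < Φ p := by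
      rintro ⟨x, h⟩ ⟨-, hh⟩
      simp only at hh
      have hne : k.f (k.L * x) ≠ k.f (k.L * (x + h)) := by
        rw [mul_add]
        refine (k.f_add_ne _ (mul_pos hL (hδ0.trans_le hh.1)) ?_).symm
        nlinarith [hh.2]
      by_contra! hle
      have h1 := abs_nonneg ⟪k.f (k.L * x) - k.f (k.L * (x + h)), k.L • k.fd (k.L * x)⟫
      have h2 := abs_nonneg ⟪k.f (k.L * x) - k.f (k.L * (x + h)), k.L • k.fd (k.L * (x + h))⟫
      have h3 := le_max_left 0 (‖k.f (k.L * x) - k.f (k.L * (x + h))‖ - d)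
      have h4 := le_max_right 0 (‖k.f (k.L * x) - k.f (k.L * (x + h))‖ - d)
      simp only [hΦ] at hle
      have h5 := abs_eq_zero.1 (le_antisymm (by linarith) h1)
      have h6 := abs_eq_zero.1 (le_antisymm (by linarith) h2)
      rw [real_inner_smul_right, mul_eq_zero, or_iff_right hL.ne'] at h5 h6
      have := k.MDC_le hne h5 h6
      linarith
    obtain ⟨m, hm, hmin⟩ := hcomp.exists_forall_le' hcont.continuousOn hpos
    exact ⟨m, hm, fun x h h0 h1 h2 h3 => hmin (x, h) ⟨⟨h0, h1⟩, h2, h3⟩⟩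
  refine ⟨min (k.L / 8) (m / (2 * (4 * k.L + 2 * d + 2))), by positivity,
    fun η hg x y hne hx hy => ?_⟩
  set c := min (k.L / 8) (m / (2 * (4 * k.L + 2 * d + 2))) with hc
  have hηL := η.Lpos
  by_contra! hle
  obtain ⟨x', hx', hfx, hfdx⟩ := η.exists_mem_Ico x 0
  obtain ⟨y', hy', hfy, hfdy⟩ := η.exists_mem_Ico y x'
  rw [hfx, hfy] at hne hx hy hle
  rw [hfdx] at hx
  rw [hfdy] at hy
  obtain ⟨a, rfl⟩ : ∃ a, η.L * a = x' := ⟨x' / η.L, by field_simp⟩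
  obtain ⟨h, rfl⟩ : ∃ h, η.L * (a + h) = y' := ⟨y' / η.L - a, by field_simp; ring⟩
  have ha0 : 0 ≤ a := by
    have := hx'.1; exact nonneg_of_mul_nonneg_right this hηL
  have ha1 : a ≤ 1 := by
    have := hx'.2; rw [zero_add] at this; nlinarith
  have hh0 : 0 < h := by
    have := hy'.1
    have h1 : 0 ≤ h := by
      have : 0 ≤ η.L * h := by linarith
      exact nonneg_of_mul_nonneg_right this hηL
    refine lt_of_le_of_ne h1 ?_
    rintro rfl
    rw [add_zero] at hne
    exact hne rfl
  have hh1 : h < 1 := by have := hy'.2; nlinarith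
  rcases le_or_gt h δ with hh | hh
  · have := hg.inner_pos hC (min_le_left _ _) a hh0 hC0.le (by rw [← hCδ]; gcongr)
    rw [← neg_sub, inner_neg_left, real_inner_smul_right, hx] at this
    simp at this
  rcases le_or_gt h (1 - δ) with hh' | hh'
  · have h1 := hmin a h ha0 ha1 hh.le hh'
    have hdd : ‖k.f (k.L * a) - k.f (k.L * (a + h)) - (η.f (η.L * a) - η.f (η.L * (a + h)))‖ ≤
        2 * c := by
      rw [sub_sub_sub_comm]
      refine (norm_sub_le _ _).trans ?_
      have h2 := hg.close a
      have h3 := hg.close (a + h)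
      rw [norm_sub_rev] at h2 h3
      linarith
    have hn : ∀ z, ‖k.L • k.fd z‖ ≤ k.L := fun z => by
      rw [norm_smul, k.unit, Real.norm_of_nonneg hL.le, mul_one]
    have h2 := abs_inner_le_of_close (b := c) (v' := η.L • η.fd (η.L * a))
      (by rw [real_inner_smul_right, hx, mul_zero]) hdd
      (by rw [norm_sub_rev]; exact hg.closed a) (hn (k.L * a)) hle
    have h3 := abs_inner_le_of_close (b := c) (v' := η.L • η.fd (η.L * (a + h)))
      (by rw [real_inner_smul_right, hy, mul_zero]) hdd
      (by rw [norm_sub_rev]; exact hg.closed (a + h)) (hn (k.L * (a + h))) hle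
    have h4 : max 0 (‖k.f (k.L * a) - k.f (k.L * (a + h))‖ - d) ≤ 2 * c := by
      refine max_le (by linarith [hg.nonneg]) ?_
      have := norm_le_norm_add_norm_sub' (k.f (k.L * a) - k.f (k.L * (a + h)))
        (η.f (η.L * a) - η.f (η.L * (a + h)))
      linarith
    have h5 : c ≤ m / (2 * (4 * k.L + 2 * d + 2)) := min_le_right _ _
    rw [le_div_iff₀ (by positivity)] at h5
    simp only [hΦ] at h1
    linarith
  · have := hg.inner_pos hC (min_le_left _ _) (a + h - 1) (h := 1 - h) (by linarith) hC0.le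
      (by rw [← hCδ]; gcongr; linarith)
    have e : η.L * (a + h) = η.L * (a + h - 1) + η.L := by ring
    rw [e, η.per, η.perd] at hy
    rw [show a + h - 1 + (1 - h) = a by ring, real_inner_smul_right, hy, mul_zero] at this
    exact lt_irrefl _ this

/-- If `2 * RO < MDC`, then any sufficiently `C¹`-close knot whose tangent is `Λ`-Lipschitz with
`Λ ≥ 1 / RO` has ball radius at least `1 / Λ`. -/
lemma exists_near_inv_le_RO (hR : 0 < RO k.f k.fd univ)
    (hMDC : 2 * RO k.f k.fd univ < MDC k.f k.fd) :
    ∃ c > 0, ∀ η : Knot n,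
    k.Near c (fun s => η.f (η.L * s)) (fun s => η.L • η.fd (η.L * s)) →
    ∀ Λ, (RO k.f k.fd univ)⁻¹ ≤ Λ → (∀ x y, ‖η.fd x - η.fd y‖ ≤ Λ * |x - y|) →
      Λ⁻¹ ≤ RO η.f η.fd univ := by
  obtain ⟨c, hc, h⟩ := k.exists_near_lt_double_critical (by linarith) hMDC
  refine ⟨c, hc, fun η hη Λ hΛ hlip => ?_⟩
  have hΛ0 : 0 < Λ := (inv_pos.2 hR).trans_le hΛ
  by_contra! hlt
  have hlt' := hlt
  rw [← one_div, lt_div_iff₀ hΛ0] at hlt'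
  obtain ⟨x, y, hne, hx, hy, he⟩ := η.exists_double_critical_of_RO_lt hΛ0 hlip hlt'
  have h1 := h η hη x y hne hx hy
  have h2 := inv_le_of_inv_le₀ hR hΛ
  linarith

end Knot

/-- The inverse of the primitive of a function bounded between two positive constants. -/
lemma exists_inverse_primitive {ρ : ℝ → ℝ} (hi : ∀ a b, IntervalIntegrable ρ volume a b)
    (h1 : ∀ s, 1 / 2 ≤ ρ s) :
    ∃ τ : ℝ → ℝ, (∀ x, ∫ r in (0 : ℝ)..τ x, ρ r = x) ∧ (∀ s, τ (∫ r in (0 : ℝ)..s, ρ r) = s) ∧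
      ∀ x y, |τ x - τ y| ≤ 2 * |x - y| := by
  set σ : ℝ → ℝ := fun s => ∫ r in (0 : ℝ)..s, ρ r with hσ
  have hσsub : ∀ a b, σ b - σ a = ∫ r in a..b, ρ r := fun a b =>
    intervalIntegral.integral_interval_sub_left (hi _ _) (hi _ _)
  have hlow : ∀ a b, a ≤ b → (b - a) / 2 ≤ σ b - σ a := fun a b hab => by
    rw [hσsub]
    have := intervalIntegral.integral_mono_on hab (by simp) (hi a b) fun x _ => h1 x
    rw [intervalIntegral.integral_const, smul_eq_mul] at this
    linarith
  have hcont : Continuous σ := intervalIntegral.continuous_primitive (fun a b => hi a b) 0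
  have h0 : σ 0 = 0 := intervalIntegral.integral_same
  have hinj : ∀ a b, |a - b| ≤ 2 * |σ a - σ b| := by
    intro a b
    wlog hab : b ≤ a generalizing a b
    · rw [abs_sub_comm, abs_sub_comm (σ a)]; exact this b a (le_of_not_ge hab)
    have := hlow b a hab
    rw [abs_of_nonneg (by linarith), abs_of_nonneg (by linarith)]
    linarith
  have hsurj : Function.Surjective σ := by
    refine hcont.surjective ?_ ?_
    · refine Filter.tendsto_atTop_mono' _ ?_ (Filter.tendsto_id.atTop_div_const (two_pos (α := ℝ)))
      filter_upwards [eventually_ge_atTop 0] with s hs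
      have := hlow 0 s hs
      rw [h0] at this
      simp only [id]; linarith
    · refine Filter.tendsto_atBot_mono' _ ?_ (Filter.tendsto_id.atBot_div_const (two_pos (α := ℝ)))
      filter_upwards [eventually_le_atBot 0] with s hs
      have := hlow s 0 hs
      rw [h0] at this
      simp only [id]; linarith
  choose τ hτ using hsurj
  refine ⟨τ, hτ, fun s => ?_, fun x y => ?_⟩
  · have := hinj (τ (σ s)) s
    rw [hτ, sub_self, abs_zero, mul_zero] at this
    exact sub_eq_zero.1 (abs_nonpos_iff.1 this)
  · have := hinj (τ x) (τ y)
    rwa [hτ, hτ] at this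

lemma hasDerivAt_of_norm_sub_le_sq {E : Type*} [NormedAddCommGroup E] [NormedSpace ℝ E]
    {g : ℝ → E} {v : E} {x M : ℝ} (h : ∀ y, ‖g y - g x - (y - x) • v‖ ≤ M * (y - x) ^ 2) :
    HasDerivAt g v x := by
  have h1 : HasFDerivAt (fun y => g y - g x - (y - x) • v) (0 : ℝ →L[ℝ] E) x := by
    refine Asymptotics.IsBigO.hasFDerivAt (n := 2) ?_ (by norm_num)
    refine Asymptotics.IsBigO.of_bound M (Filter.Eventually.of_forall fun y => ?_)
    simpa using h y
  have h2 := h1.hasDerivAt.add ((((hasDerivAt_id x).sub_const x).smul_const v).const_add (g x))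
  simp only [zero_apply, one_smul, zero_add] at h2
  refine h2.congr_of_eventuallyEq (Filter.Eventually.of_forall fun y => ?_)
  simp

/-- A curve with prescribed unit tangent `U` and speed `ρ`, reparametrized by arclength. -/
lemma hasDerivAt_arclength {E : Type*} [NormedAddCommGroup E] [NormedSpace ℝ E]
    [CompleteSpace E] {U : ℝ → E} {ρ τ : ℝ → ℝ} {Λ : ℝ} {q : E}
    (hi : ∀ a b, IntervalIntegrable ρ volume a b)
    (hiU : ∀ a b, IntervalIntegrable (fun s => ρ s • U s) volume a b)
    (h1 : ∀ s, 1 / 2 ≤ ρ s) (h2 : ∀ s, ρ s ≤ 2)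
    (hU : ∀ s t, s ≤ t → ‖U t - U s‖ ≤ Λ * ∫ r in s..t, ρ r) (hΛ : 0 ≤ Λ)
    (hστ : ∀ x, ∫ r in (0 : ℝ)..τ x, ρ r = x) (hτ : ∀ x y, |τ x - τ y| ≤ 2 * |x - y|) (x : ℝ) :
    HasDerivAt (fun x => q + ∫ r in (0 : ℝ)..τ x, ρ r • U r) (U (τ x)) x := by
  refine hasDerivAt_of_norm_sub_le_sq (M := 16 * Λ) fun y => ?_
  have e1 : q + (∫ r in (0 : ℝ)..τ y, ρ r • U r) - (q + ∫ r in (0 : ℝ)..τ x, ρ r • U r) =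
      ∫ r in τ x..τ y, ρ r • U r := by
    rw [add_sub_add_left_eq_sub, intervalIntegral.integral_interval_sub_left (hiU _ _) (hiU _ _)]
  have e2 : y - x = ∫ r in τ x..τ y, ρ r := by
    rw [← intervalIntegral.integral_interval_sub_left (hi 0 _) (hi 0 _), hστ, hστ]
  have e3 : (y - x) • U (τ x) = ∫ r in τ x..τ y, ρ r • U (τ x) := by
    rw [intervalIntegral.integral_smul_const, ← e2]
  rw [e1, e3, ← intervalIntegral.integral_sub (hiU _ _)
    ⟨(hi _ _).1.smul_const _, (hi _ _).2.smul_const _⟩]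
  have hUU : ∀ s t, ‖U t - U s‖ ≤ Λ * (2 * |t - s|) := by
    intro s t
    wlog hst : s ≤ t generalizing s t
    · rw [norm_sub_rev, abs_sub_comm]; exact this t s (le_of_not_ge hst)
    refine (hU s t hst).trans ?_
    have := intervalIntegral.integral_mono_on hst (hi s t) (by simp) fun x _ => h2 x
    rw [intervalIntegral.integral_const, smul_eq_mul] at this
    rw [abs_of_nonneg (by linarith)]
    gcongr; linarith
  have hyx := hτ y x
  have h3 : ∀ r ∈ uIoc (τ x) (τ y), ‖ρ r • U r - ρ r • U (τ x)‖ ≤ 2 * (Λ * (2 * (2 * |y - x|))) := by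
    intro r hr
    have hr' : |r - τ x| ≤ |τ y - τ x| := Set.abs_sub_left_of_mem_uIcc (uIoc_subset_uIcc hr)
    rw [← smul_sub, norm_smul, Real.norm_of_nonneg (by linarith [h1 r])]
    refine mul_le_mul (h2 r) ((hUU _ _).trans ?_) (norm_nonneg _) zero_le_two
    gcongr; exact hr'.trans hyx
  refine (intervalIntegral.norm_integral_le_of_norm_le_const h3).trans ?_
  have h4 : 0 ≤ |y - x| := abs_nonneg _
  calc 2 * (Λ * (2 * (2 * |y - x|))) * |τ y - τ x|
      ≤ 2 * (Λ * (2 * (2 * |y - x|))) * (2 * |y - x|) := by gcongr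
    _ = 16 * Λ * |y - x| ^ 2 := by ring
    _ = _ := by rw [sq_abs]

namespace Knot

variable {n : ℕ} (k : Knot n)

/-- Knots `C¹`-close to `k` can be constructed from a unit tangent field and a speed. -/
lemma exists_knot_of_tangent {c : ℝ} (hc : 0 < c) : ∃ κ₀ > 0, ∀ (U : ℝ → Euc n) (ρ : ℝ → ℝ)
    (Λ : ℝ), (∀ s, U (s + k.L) = U s) → (∀ s, ρ (s + k.L) = ρ s) → Continuous U → Measurable ρ →
    (∀ s, ‖U s‖ = 1) → (∀ s, |ρ s - 1| ≤ κ₀) → (∀ s, ‖U s - k.fd s‖ ≤ κ₀) →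
    ∫ s in (0 : ℝ)..k.L, ρ s • U s = 0 → 0 ≤ Λ →
    (∀ s t, s ≤ t → ‖U t - U s‖ ≤ Λ * ∫ r in s..t, ρ r) →
    ∃ η : Knot n, η.L = ∫ s in (0 : ℝ)..k.L, ρ s ∧
      (∀ x y, ‖η.fd x - η.fd y‖ ≤ Λ * |x - y|) ∧
      k.Near c (fun s => η.f (η.L * s)) (fun s => η.L • η.fd (η.L * s)) := by
  obtain ⟨C, hC0, hC⟩ := k.exists_norm_fd_sub_le
  obtain ⟨c', hc', hinj⟩ := k.exists_near_injOn
  have hL := k.Lpos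
  set c₁ := min c c' with hc₁
  have hc₁0 : 0 < c₁ := lt_min hc hc'
  set κ := min (1 / 2) (c₁ / (4 * k.L + 2 * C * k.L ^ 2)) with hκ
  have hκ0 : 0 < κ := by positivity
  have hκ1 : κ ≤ 1 / 2 := min_le_left _ _
  have hκ2 : κ * (4 * k.L + 2 * C * k.L ^ 2) ≤ c₁ := by
    rw [← le_div_iff₀ (by positivity)]; exact min_le_right _ _
  refine ⟨κ, hκ0, fun U ρ Λ hUp hρp hUc hρm hU1 hρ1 hUT hclosed hΛ hULip => ?_⟩
  have hρ1' : ∀ s, 1 - κ ≤ ρ s ∧ ρ s ≤ 1 + κ := fun s => by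
    have := abs_le.1 (hρ1 s); constructor <;> linarith [this.1, this.2]
  have hlow : ∀ s, 1 / 2 ≤ ρ s := fun s => by linarith [(hρ1' s).1]
  have hupp : ∀ s, ρ s ≤ 2 := fun s => by linarith [(hρ1' s).2]
  have hi : ∀ a b, IntervalIntegrable ρ volume a b :=
    intervalIntegrable_of_bounded hρm.aestronglyMeasurable (B := 2) fun s => by
      rw [Real.norm_of_nonneg (by linarith [hlow s])]; exact hupp s
  have hiU : ∀ a b, IntervalIntegrable (fun s => ρ s • U s) volume a b :=
    intervalIntegrable_of_bounded (hρm.aestronglyMeasurable.smul hUc.aestronglyMeasurable)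
      (B := 2) fun s => by
      rw [norm_smul, hU1, mul_one, Real.norm_of_nonneg (by linarith [hlow s])]; exact hupp s
  obtain ⟨τ, hστ, hτσ, hτlip⟩ := exists_inverse_primitive hi hlow
  set σ : ℝ → ℝ := fun s => ∫ r in (0 : ℝ)..s, ρ r with hσ
  set L' := σ k.L with hL'
  have hσadd : ∀ s, σ (s + k.L) = σ s + L' := fun s => by
    have hp : Function.Periodic ρ k.L := hρp
    have h1 := hp.intervalIntegral_add_eq 0 s
    rw [zero_add] at h1
    rw [hL', hσ]
    simp only
    rw [h1, intervalIntegral.integral_add_adjacent_intervals (hi _ _) (hi _ _)]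
  have hτadd : ∀ x, τ (x + L') = τ x + k.L := fun x => by
    have h1 := hσadd (τ x)
    rw [show σ (τ x) = x from hστ x] at h1
    rw [← h1]; exact hτσ _
  have hσT : ∀ s, 0 ≤ s → |σ s - s| ≤ κ * s := fun s hs => by
    have e : σ s - s = ∫ r in (0 : ℝ)..s, (ρ r - 1) := by
      rw [intervalIntegral.integral_sub (hi _ _) (by simp)]; simp [hσ]
    rw [e, ← Real.norm_eq_abs]
    have := intervalIntegral.norm_integral_le_of_norm_le_const (a := 0) (b := s) (C := κ)
      (f := fun r => ρ r - 1) fun r _ => hρ1 r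
    rwa [sub_zero, abs_of_nonneg hs] at this
  have hL'0 : 0 < L' := by
    have := abs_le.1 (hσT k.L hL.le)
    nlinarith [this.1]
  set G : ℝ → Euc n := fun s => k.f 0 + ∫ r in (0 : ℝ)..s, ρ r • U r with hG
  have hGadd : ∀ s, G (s + k.L) = G s := fun s => by
    have hp : Function.Periodic (fun r => ρ r • U r) k.L := fun r => by simp only [hρp, hUp]
    have h1 := hp.intervalIntegral_add_eq 0 s
    rw [zero_add, hclosed] at h1
    rw [hG]
    simp only
    rw [← intervalIntegral.integral_add_adjacent_intervals (hiU 0 s) (hiU s _), ← h1, add_zero]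
  have hlip : ∀ x y, ‖U (τ x) - U (τ y)‖ ≤ Λ * |x - y| := by
    intro x y
    wlog hxy : τ y ≤ τ x generalizing x y
    · rw [norm_sub_rev, abs_sub_comm]; exact this y x (le_of_not_ge hxy)
    refine (hULip _ _ hxy).trans ?_
    rw [← intervalIntegral.integral_interval_sub_left (hi 0 _) (hi 0 _), hστ, hστ]
    gcongr; exact le_abs_self _
  have hderiv : ∀ x, HasDerivAt (fun x => G (τ x)) (U (τ x)) x :=
    hasDerivAt_arclength hi hiU hlow hupp hULip hΛ hστ hτlip
  have hGf : ∀ s, 0 ≤ s → ‖G s - k.f s‖ ≤ 2 * κ * s := fun s hs => by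
    have e : G s - k.f s = ∫ r in (0 : ℝ)..s, (ρ r • U r - k.fd r) := by
      have h1 := intervalIntegral.integral_eq_sub_of_hasDerivAt (a := 0) (b := s)
        (fun x _ => k.deriv x) (k.continuous_fd.intervalIntegrable _ _)
      rw [intervalIntegral.integral_sub (hiU _ _) (k.continuous_fd.intervalIntegrable _ _), h1]
      simp only [hG]; abel
    rw [e]
    have := intervalIntegral.norm_integral_le_of_norm_le_const (a := 0) (b := s) (C := 2 * κ)
      (f := fun r => ρ r • U r - k.fd r) fun r _ => by
        have e2 : ρ r • U r - k.fd r = (ρ r - 1) • U r + (U r - k.fd r) := by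
          rw [sub_smul, one_smul]; abel
        rw [e2]
        refine (norm_add_le _ _).trans ?_
        rw [norm_smul, hU1, mul_one, Real.norm_eq_abs]
        linarith [hρ1 r, hUT r]
    rwa [sub_zero, abs_of_nonneg hs] at this
  have hper : ∀ s, G (τ (L' * (s + 1))) = G (τ (L' * s)) := fun s => by
    rw [mul_add, mul_one, hτadd, hGadd]
  have hperU : ∀ s, U (τ (L' * (s + 1))) = U (τ (L' * s)) := fun s => by
    rw [mul_add, mul_one, hτadd, hUp]
  have hnear₀ : ∀ s ∈ Ico (0 : ℝ) 1, ‖G (τ (L' * s)) - k.f (k.L * s)‖ ≤ c₁ ∧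
      ‖L' • U (τ (L' * s)) - k.L • k.fd (k.L * s)‖ ≤ c₁ := by
    rintro s ⟨hs0, hs1⟩
    set a := τ (L' * s) with ha
    have hσa : σ a = L' * s := hστ _
    have hmono : ∀ x y, σ x ≤ σ y → x ≤ y := fun x y hxy => by
      by_contra! hlt
      have h1 := intervalIntegral.integral_mono_on hlt.le (by simp) (hi y x) fun x _ => hlow x
      rw [intervalIntegral.integral_const, smul_eq_mul,
        ← intervalIntegral.integral_interval_sub_left (hi 0 x) (hi 0 y)] at h1
      simp only [hσ] at hxy
      linarith
    have ha0 : 0 ≤ a := hmono 0 a (by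
      rw [hσa, show σ 0 = 0 from intervalIntegral.integral_same]; positivity)
    have haL : a ≤ k.L := hmono a k.L (by rw [hσa]; nlinarith)
    have h1 := hσT a ha0
    have h2 := hσT k.L hL.le
    have h3 : |a - k.L * s| ≤ 2 * κ * k.L := by
      have e : a - k.L * s = -(σ a - a) + s * (L' - k.L) := by rw [hσa]; ring
      rw [e]
      refine (abs_add_le _ _).trans ?_
      rw [abs_neg, abs_mul, abs_of_nonneg hs0]
      have h4 : s * |L' - k.L| ≤ 1 * (κ * k.L) := by gcongr
      have h5 : κ * a ≤ κ * k.L := by gcongr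
      linarith
    constructor
    · have h4 := hGf a ha0
      have h5 := norm_sub_le_of_unit_speed k.deriv k.unit (k.L * s) a
      have h6 := norm_sub_le_norm_sub_add_norm_sub (G a) (k.f a) (k.f (k.L * s))
      have h7 : 2 * κ * a ≤ 2 * κ * k.L := by gcongr
      have h8 : 0 < κ * (2 * C * k.L ^ 2) := by positivity
      linarith
    · have e : L' • U a - k.L • k.fd (k.L * s) = (L' - k.L) • U a +
          (k.L • (U a - k.fd a) + k.L • (k.fd a - k.fd (k.L * s))) := by
        simp only [smul_sub, sub_smul]; abel
      rw [e]
      refine (norm_add_le _ _).trans ((add_le_add_right (norm_add_le _ _) _).trans ?_)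
      rw [norm_smul, norm_smul, norm_smul, hU1, mul_one, Real.norm_of_nonneg hL.le,
        Real.norm_eq_abs]
      have h4 : k.L * ‖U a - k.fd a‖ ≤ k.L * κ := by gcongr; exact hUT a
      have h5 : k.L * ‖k.fd a - k.fd (k.L * s)‖ ≤ k.L * (C * (2 * κ * k.L)) := by
        gcongr; exact (hC _ _).trans (by gcongr)
      have h6 : 0 < κ * k.L := by positivity
      nlinarith
  have hnear : k.Near c₁ (fun s => G (τ (L' * s))) (fun s => L' • U (τ (L' * s))) := by
    have hall : ∀ s, ‖G (τ (L' * s)) - k.f (k.L * s)‖ ≤ c₁ ∧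
        ‖L' • U (τ (L' * s)) - k.L • k.fd (k.L * s)‖ ≤ c₁ := fun s => by
      have hp : Function.Periodic (fun s => (G (τ (L' * s)) - k.f (k.L * s),
          L' • U (τ (L' * s)) - k.L • k.fd (k.L * s))) 1 := fun s => by
        simp only [hper, hperU]
        rw [mul_add, mul_one, k.per, k.perd]
      obtain ⟨y, hy, he⟩ := hp.exists_mem_Ico₀ one_pos s
      obtain ⟨he1, he2⟩ := Prod.ext_iff.1 he
      simp only at he1 he2
      rw [he1, he2]
      exact hnear₀ y hy
    refine ⟨hper, fun s => ?_, fun s => (hall s).1, fun s => (hall s).2⟩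
    have h := ((hasDerivAt_id s).const_mul L')
    rw [mul_one] at h
    exact (hderiv (L' * s)).scomp s h
  have hperG : ∀ s, G (τ (s + L')) = G (τ s) := fun s => by rw [hτadd, hGadd]
  have hperdG : ∀ s, U (τ (s + L')) = U (τ s) := fun s => by rw [hτadd, hUp]
  have hinjG : InjOn (fun x => G (τ x)) (Ico 0 L') := by
    have h1 := hinj _ _ ⟨hnear.per, hnear.hasDeriv, fun s => (hnear.close s).trans (min_le_right _ _),
      fun s => (hnear.closed s).trans (min_le_right _ _)⟩
    intro x hx y hy hxy
    have hmem : ∀ z ∈ Ico 0 L', z / L' ∈ Ico (0 : ℝ) 1 := fun z hz =>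
      ⟨div_nonneg hz.1 hL'0.le, (div_lt_one hL'0).2 hz.2⟩
    have h2 := h1 (hmem x hx) (hmem y hy) (by
      simp only [mul_div_cancel₀ _ hL'0.ne']; exact hxy)
    exact (div_left_inj' hL'0.ne').1 h2
  refine ⟨⟨L', hL'0, fun x => G (τ x), fun x => U (τ x), hperG, hperdG, hderiv, fun s => hU1 _,
    ⟨Λ.toNNReal, ?_⟩, hinjG⟩, rfl, hlip, ?_⟩
  · refine LipschitzWith.of_dist_le_mul fun x y => ?_
    rw [dist_eq_norm, Real.dist_eq, Real.coe_toNNReal _ hΛ]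
    exact hlip x y
  · exact ⟨hnear.per, hnear.hasDeriv, fun s => (hnear.close s).trans (min_le_left _ _),
      fun s => (hnear.closed s).trans (min_le_left _ _)⟩

end Knot

section

variable {E : Type*} [NormedAddCommGroup E] [InnerProductSpace ℝ E]

lemma inner_intervalIntegral [CompleteSpace E] {f : ℝ → E} {a b : ℝ}
    (hf : IntervalIntegrable f volume a b) (c : E) :
    ⟪c, ∫ s in a..b, f s⟫ = ∫ s in a..b, ⟪c, f s⟫ :=
  ((innerSL ℝ c).intervalIntegral_comp_comm hf).symm

/-- The component of `c` orthogonal to the unit vector `u`. -/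
def perpPart (u c : E) : E := c - ⟪c, u⟫ • u

lemma inner_perpPart {u : E} (hu : ‖u‖ = 1) (c : E) : ⟪perpPart u c, u⟫ = 0 := by
  rw [perpPart, inner_sub_left, real_inner_smul_left, real_inner_self_eq_norm_sq, hu]; ring

lemma norm_perpPart_sq {u : E} (hu : ‖u‖ = 1) (c : E) :
    ‖perpPart u c‖ ^ 2 = ‖c‖ ^ 2 - ⟪c, u⟫ ^ 2 := by
  rw [perpPart, norm_sub_sq_real, real_inner_smul_right, norm_smul, hu, mul_one,
    Real.norm_eq_abs, sq_abs]; ring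

lemma inner_perpPart_self {u : E} (hu : ‖u‖ = 1) (c : E) :
    ⟪perpPart u c, c⟫ = ‖perpPart u c‖ ^ 2 := by
  rw [norm_perpPart_sq hu, perpPart, inner_sub_left, real_inner_smul_left,
    real_inner_self_eq_norm_sq, real_inner_comm c u]; ring

lemma norm_perpPart_le {u : E} (hu : ‖u‖ = 1) (c : E) : ‖perpPart u c‖ ≤ ‖c‖ := by
  refine le_of_sq_le_sq ?_ (norm_nonneg _)
  rw [norm_perpPart_sq hu]; linarith [sq_nonneg ⟪c, u⟫]

lemma perpPart_add (u c c' : E) : perpPart u (c + c') = perpPart u c + perpPart u c' := by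
  simp only [perpPart, inner_add_left, add_smul]; abel

lemma perpPart_smul (u : E) (a : ℝ) (c : E) : perpPart u (a • c) = a • perpPart u c := by
  simp only [perpPart, real_inner_smul_left, smul_sub, smul_smul]

lemma Continuous.perpPart {α : Type*} [TopologicalSpace α] {u c : α → E} (hu : Continuous u)
    (hc : Continuous c) : Continuous fun a => perpPart (u a) (c a) := by
  unfold _root_.perpPart; fun_prop

lemma norm_add_smul_le_of_inner {D Y : E} {Λ B ε f : ℝ} (hΛ : 0 < Λ) (hD : ‖D‖ ≤ Λ)
    (hY : ‖Y‖ ≤ B) (hε : 0 ≤ ε) (hf : 1 / 2 ≤ 1 + ε * f) (h : Λ ^ 2 * f = ⟪D, Y⟫) :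
    ‖D + ε • Y‖ ≤ Λ * (1 + ε * f) + ε ^ 2 * (B ^ 2 / Λ) := by
  have hB : 0 ≤ B := (norm_nonneg _).trans hY
  refine le_of_sq_le_sq ?_ (by positivity)
  have h1 : ‖D + ε • Y‖ ^ 2 ≤ Λ ^ 2 + 2 * ε * (Λ ^ 2 * f) + ε ^ 2 * B ^ 2 := by
    rw [norm_add_sq_real, norm_smul, real_inner_smul_right, ← h, Real.norm_of_nonneg hε, mul_pow]
    have h2 : ‖D‖ ^ 2 ≤ Λ ^ 2 := by gcongr
    have h3 : ε ^ 2 * ‖Y‖ ^ 2 ≤ ε ^ 2 * B ^ 2 := by gcongr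
    linarith
  refine h1.trans ?_
  have h4 : ε ^ 2 * B ^ 2 ≤ 2 * (Λ * (1 + ε * f)) * (ε ^ 2 * (B ^ 2 / Λ)) := by
    have e : 2 * (Λ * (1 + ε * f)) * (ε ^ 2 * (B ^ 2 / Λ)) = 2 * (1 + ε * f) * (ε ^ 2 * B ^ 2) := by
      field_simp
    rw [e]
    exact le_mul_of_one_le_left (by positivity) (by linarith)
  nlinarith [sq_nonneg (Λ * (ε * f)), sq_nonneg (ε ^ 2 * (B ^ 2 / Λ))]

end

namespace Knot

variable {n : ℕ} (k : Knot n)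

lemma integral_fd : ∫ s in (0 : ℝ)..k.L, k.fd s = 0 := by
  rw [intervalIntegral.integral_eq_sub_of_hasDerivAt (fun x _ => k.deriv x)
    (k.continuous_fd.intervalIntegrable _ _)]
  have := k.per 0
  rw [zero_add] at this
  rw [this, sub_self]

lemma exists_coercive : ∃ m > 0, ∀ c : Euc n,
    m * ‖c‖ ^ 2 ≤ ∫ s in (0 : ℝ)..k.L, ‖perpPart (k.fd s) c‖ ^ 2 := by
  have hL := k.Lpos
  have hfd := k.continuous_fd
  have hcont : Continuous fun c : Euc n => ∫ s in (0 : ℝ)..k.L, ‖perpPart (k.fd s) c‖ ^ 2 := by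
    refine intervalIntegral.continuous_parametric_intervalIntegral_of_continuous' ?_ _ _
    exact ((hfd.comp continuous_snd).perpPart continuous_fst).norm.pow 2
  have hpos : ∀ c ∈ Metric.sphere (0 : Euc n) 1,
      0 < ∫ s in (0 : ℝ)..k.L, ‖perpPart (k.fd s) c‖ ^ 2 := by
    intro c hc
    rw [mem_sphere_zero_iff_norm] at hc
    have hd : ∀ z, HasDerivAt (fun z => ⟪k.f z, c⟫) ⟪k.fd z, c⟫ z := fun z => by
      simpa using (k.deriv z).inner ℝ (hasDerivAt_const z c)
    obtain ⟨s, hs, h0⟩ := exists_hasDerivAt_eq_zero hL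
      (fun z _ => (hd z).continuousAt.continuousWithinAt)
      (by simpa using congrArg (fun v => ⟪v, c⟫) (k.per 0).symm) fun z _ => hd z
    refine intervalIntegral.integral_pos hL
      ((hfd.perpPart continuous_const).norm.pow 2).continuousOn (fun _ _ => by positivity)
      ⟨s, ⟨hs.1.le, hs.2.le⟩, ?_⟩
    rw [norm_perpPart_sq (k.unit s), hc, real_inner_comm, h0]; norm_num
  obtain ⟨m, hm, hmin⟩ := (isCompact_sphere (0 : Euc n) 1).exists_forall_le' hcont.continuousOn hpos
  refine ⟨m, hm, fun c => ?_⟩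
  rcases eq_or_ne c 0 with rfl | hc
  · simp [perpPart]
  have hc0 : 0 < ‖c‖ := norm_pos_iff.2 hc
  have h := hmin (‖c‖⁻¹ • c) (by
    rw [mem_sphere_zero_iff_norm, norm_smul, norm_inv, norm_norm, inv_mul_cancel₀ hc0.ne'])
  simp only [perpPart_smul, norm_smul, norm_inv, norm_norm, mul_pow,
    intervalIntegral.integral_const_mul] at h
  rw [inv_pow, inv_mul_eq_div, le_div_iff₀ (by positivity)] at h
  exact h

lemma intervalIntegrable_smul {ω : ℝ → ℝ} {B : ℝ} (hω : Measurable ω) (hB : ∀ s, |ω s| ≤ B)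
    {X : ℝ → Euc n} (hX : Continuous X) (a b : ℝ) :
    IntervalIntegrable (fun s => ω s • X s) volume a b := by
  have h : IntervalIntegrable ω volume a b :=
    intervalIntegrable_of_bounded hω.aestronglyMeasurable (by simpa using hB) a b
  exact h.smul_continuousOn hX.continuousOn

lemma exists_integral_smul_perpPart_eq {m : ℝ} (hm : 0 < m)
    (hmin : ∀ c : Euc n, m * ‖c‖ ^ 2 ≤ ∫ s in (0 : ℝ)..k.L, ‖perpPart (k.fd s) c‖ ^ 2)
    {ω : ℝ → ℝ} {B : ℝ} (hω : Measurable ω) (hω1 : ∀ s, 1 / 2 ≤ ω s) (hω2 : ∀ s, |ω s| ≤ B)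
    (b : Euc n) :
    ∃ c : Euc n, ∫ s in (0 : ℝ)..k.L, ω s • perpPart (k.fd s) c = b ∧ ‖c‖ ≤ 2 / m * ‖b‖ := by
  have hL := k.Lpos
  have hfd := k.continuous_fd
  have hint : ∀ c : Euc n, IntervalIntegrable (fun s => ω s • perpPart (k.fd s) c) volume 0 k.L :=
    fun c => intervalIntegrable_smul hω hω2 (hfd.perpPart continuous_const) _ _
  let M : Euc n →ₗ[ℝ] Euc n :=
    { toFun := fun c => ∫ s in (0 : ℝ)..k.L, ω s • perpPart (k.fd s) c
      map_add' := fun c c' => by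
        simp only [perpPart_add, smul_add]
        exact intervalIntegral.integral_add (hint c) (hint c')
      map_smul' := fun a c => by
        simp only [perpPart_smul, smul_comm _ a, intervalIntegral.integral_smul, RingHom.id_apply] }
  have hcoer : ∀ c, m / 2 * ‖c‖ ≤ ‖M c‖ := by
    intro c
    rcases eq_or_ne c 0 with rfl | hc
    · simp
    have hc0 : 0 < ‖c‖ := norm_pos_iff.2 hc
    have h1 : ⟪M c, c⟫ = ∫ s in (0 : ℝ)..k.L, ω s * ‖perpPart (k.fd s) c‖ ^ 2 := by
      rw [real_inner_comm]
      refine (inner_intervalIntegral (hint c) c).trans (intervalIntegral.integral_congr fun s _ => ?_)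
      rw [real_inner_smul_right, real_inner_comm, inner_perpPart_self (k.unit s)]
    have hi : IntervalIntegrable (fun s => ‖perpPart (k.fd s) c‖ ^ 2) volume 0 k.L :=
      ((hfd.perpPart continuous_const).norm.pow 2).intervalIntegrable _ _
    have h3 : 1 / 2 * (m * ‖c‖ ^ 2) ≤ ⟪M c, c⟫ := by
      rw [h1]
      refine (mul_le_mul_of_nonneg_left (hmin c) (by norm_num)).trans ?_
      rw [← intervalIntegral.integral_const_mul]
      refine intervalIntegral.integral_mono_on hL.le (hi.const_mul _) ?_ fun s _ => ?_
      · have h : IntervalIntegrable ω volume 0 k.L :=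
          intervalIntegrable_of_bounded hω.aestronglyMeasurable (by simpa using hω2) _ _
        exact h.mul_continuousOn ((hfd.perpPart continuous_const).norm.pow 2).continuousOn
      · have := hω1 s; gcongr
    have h4 := h3.trans (real_inner_le_norm _ _)
    refine le_of_mul_le_mul_right ?_ hc0
    nlinarith
  have hinj : Function.Injective M := by
    rw [← LinearMap.ker_eq_bot, LinearMap.ker_eq_bot']
    intro c hc
    have := hcoer c
    rw [hc, norm_zero] at this
    by_contra h0
    have : 0 < m / 2 * ‖c‖ := by have := norm_pos_iff.2 h0; positivity
    linarith
  obtain ⟨c, hc⟩ := LinearMap.injective_iff_surjective.1 hinj b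
  refine ⟨c, hc, ?_⟩
  have := hcoer c
  rw [hc] at this
  rw [div_mul_eq_mul_div, le_div_iff₀ hm]
  linarith

end Knot

lemma Function.Periodic.exists_norm_le {E : Type*} [NormedAddCommGroup E] {X : ℝ → E} {L : ℝ}
    (h : ∀ s, X (s + L) = X s) (hL : 0 < L) (hX : Continuous X) : ∃ B, ∀ s, ‖X s‖ ≤ B := by
  obtain ⟨B, hB⟩ := (isCompact_Icc (a := (0 : ℝ)) (b := L)).exists_bound_of_continuousOn
    hX.continuousOn
  refine ⟨B, fun s => ?_⟩
  obtain ⟨y, hy, he⟩ := Function.Periodic.exists_mem_Ico₀ h hL s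
  rw [he]
  exact hB y ⟨hy.1, hy.2.le⟩

namespace Knot

variable {n : ℕ} (k : Knot n)

/-- An infinitesimal variation of the tangent field (in direction `X`) and of the speed (in
direction `f`) of a knot, which to first order keeps the curvature at most `Λ`. -/
structure Variation (Λ : ℝ) (X : ℝ → Euc n) (f : ℝ → ℝ) : Prop where
  perX : ∀ s, X (s + k.L) = X s
  perf : ∀ s, f (s + k.L) = f s
  perp : ∀ s, ⟪X s, k.fd s⟫ = 0
  lip : ∃ C, LipschitzWith C X
  meas : Measurable f
  bdd : ∃ B, ∀ s, |f s| ≤ B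
  curv : ∃ δ > 0, ∀ᵐ s, Λ - δ < ‖_root_.deriv k.fd s‖ → Λ ^ 2 * f s = ⟪_root_.deriv k.fd s, _root_.deriv X s⟫

variable {k} {Λ : ℝ} {X : ℝ → Euc n} {f : ℝ → ℝ}

lemma Variation.continuous (h : k.Variation Λ X f) : Continuous X := h.lip.choose_spec.continuous

lemma Variation.exists_bound (h : k.Variation Λ X f) : ∃ B > 0, (∀ s, ‖X s‖ ≤ B) ∧
    (∀ s, ‖_root_.deriv X s‖ ≤ B) ∧ ∀ s, |f s| ≤ B := by
  obtain ⟨C, hC⟩ := h.lip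
  obtain ⟨B, hB⟩ := h.bdd
  obtain ⟨M, hM'⟩ := Function.Periodic.exists_norm_le h.perX k.Lpos h.continuous
  have hM0 : 0 ≤ M := (norm_nonneg _).trans (hM' 0)
  have hB0 : 0 ≤ B := (abs_nonneg _).trans (hB 0)
  have hC0 : (0 : ℝ) ≤ C := C.2
  exact ⟨M + C + B + 1, by linarith, fun s => by linarith [hM' s],
    fun s => by linarith [norm_deriv_le_of_lipschitz hC (x₀ := s)], fun s => by linarith [hB s]⟩

lemma norm_deriv_fd_le (hΛ : ∀ x y, ‖k.fd x - k.fd y‖ ≤ Λ * |x - y|) (s : ℝ) :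
    ‖_root_.deriv k.fd s‖ ≤ Λ := by
  have hΛ0 : 0 ≤ Λ := by simpa using (norm_nonneg _).trans (hΛ 1 0)
  exact norm_deriv_le_of_lip' hΛ0 (Filter.Eventually.of_forall fun x => hΛ x s)

lemma ae_differentiableAt_fd (k : Knot n) : ∀ᵐ s, DifferentiableAt ℝ k.fd s :=
  k.lipd.choose_spec.ae_differentiableAt_real

lemma norm_deriv_perturb_le {Λ B K ε δ f : ℝ} {D Y Z : Euc n} (hΛ0 : 0 < Λ) (hD : ‖D‖ ≤ Λ)
    (hY : ‖Y‖ ≤ B) (hf : |f| ≤ B) (hZ : ‖Z‖ ≤ K * ε) (hε : 0 < ε) (hε1 : ε ≤ 1)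
    (hεB : ε * B ≤ 1 / 2) (hεδ : ε * (B + K + Λ * B) ≤ δ)
    (h : Λ - δ < ‖D‖ → Λ ^ 2 * f = ⟪D, Y⟫) :
    ‖D + ε • (Y + Z)‖ ≤ Λ * (1 + 2 * (B ^ 2 / Λ + K) / Λ * ε ^ 2) * (1 + ε * f) := by
  have hf' := abs_le.1 hf
  have hf1 : 1 / 2 ≤ 1 + ε * f := by nlinarith [hf'.1]
  have hK : 0 ≤ K := by
    have := (norm_nonneg _).trans hZ
    exact nonneg_of_mul_nonneg_left this hε
  have e : Λ * (1 + 2 * (B ^ 2 / Λ + K) / Λ * ε ^ 2) * (1 + ε * f) =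
      Λ * (1 + ε * f) + ε ^ 2 * (B ^ 2 / Λ + K) * (2 * (1 + ε * f)) := by
    field_simp
  have h1 : ε ^ 2 * (B ^ 2 / Λ + K) ≤ ε ^ 2 * (B ^ 2 / Λ + K) * (2 * (1 + ε * f)) :=
    le_mul_of_one_le_right (by positivity) (by linarith)
  have h2 : ‖ε • Z‖ ≤ ε ^ 2 * K := by
    rw [norm_smul, Real.norm_of_nonneg hε.le]
    nlinarith
  rw [e, smul_add, ← add_assoc]
  refine (norm_add_le _ _).trans ?_
  rcases le_or_gt ‖D‖ (Λ - δ) with hd | hd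
  · have h3 : ‖D + ε • Y‖ ≤ Λ - δ + ε * B := by
      refine (norm_add_le _ _).trans ?_
      rw [norm_smul, Real.norm_of_nonneg hε.le]
      gcongr
    have h4 : 0 ≤ ε ^ 2 * (B ^ 2 / Λ + K) * (2 * (1 + ε * f)) := le_trans (by positivity) h1
    have h5 : ε ^ 2 * K ≤ ε * K := by
      have : ε ^ 2 ≤ ε := by nlinarith
      gcongr
    have h6 : ε * (Λ * -B) ≤ ε * (Λ * f) := by gcongr; exact hf'.1
    linarith
  · have h3 := norm_add_smul_le_of_inner hΛ0 hD hY hε.le hf1 (h hd)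
    linarith

set_option maxHeartbeats 1600000 in
/-- A variation which to first order preserves closedness and decreases length produces arbitrarily
close tangent fields and speeds with smaller product of length and curvature. -/
lemma Variation.exists_improvement (h : k.Variation Λ X f) (hΛ0 : 0 < Λ)
    (hΛ : ∀ x y, ‖k.fd x - k.fd y‖ ≤ Λ * |x - y|)
    (hclosed : ∫ s in (0 : ℝ)..k.L, (X s + f s • k.fd s) = 0)
    (hneg : ∫ s in (0 : ℝ)..k.L, f s < 0) {κ : ℝ} (hκ : 0 < κ) :
    ∃ (U : ℝ → Euc n) (ρ : ℝ → ℝ) (Λ₁ : ℝ),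
    (∀ s, U (s + k.L) = U s) ∧ (∀ s, ρ (s + k.L) = ρ s) ∧ Continuous U ∧ Measurable ρ ∧
    (∀ s, ‖U s‖ = 1) ∧ (∀ s, |ρ s - 1| ≤ κ) ∧ (∀ s, ‖U s - k.fd s‖ ≤ κ) ∧
    ∫ s in (0 : ℝ)..k.L, ρ s • U s = 0 ∧ Λ ≤ Λ₁ ∧
    (∀ s t, s ≤ t → ‖U t - U s‖ ≤ Λ₁ * ∫ r in s..t, ρ r) ∧
    (∫ s in (0 : ℝ)..k.L, ρ s) * Λ₁ < k.L * Λ := by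
  have hL := k.Lpos
  have hfd := k.continuous_fd
  have hX := h.continuous
  obtain ⟨B, hB0, hBX, hBd, hBf⟩ := h.exists_bound
  obtain ⟨m, hm, hmin⟩ := k.exists_coercive
  obtain ⟨δ, hδ, hcurv⟩ := h.curv
  set μ := -∫ s in (0 : ℝ)..k.L, f s with hμ
  have hμ0 : 0 < μ := by linarith
  have hintf : IntervalIntegrable f volume 0 k.L :=
    intervalIntegrable_of_bounded h.meas.aestronglyMeasurable (by simpa using hBf) _ _
  set b := ∫ s in (0 : ℝ)..k.L, f s • X s with hb
  set K := 2 / m * ‖b‖ with hK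
  have hK0 : 0 ≤ K := by positivity
  set N := B + K with hN
  set K₁ := 2 * (B ^ 2 / Λ + 2 * K * Λ) / Λ with hK₁
  have hK₁0 : 0 ≤ K₁ := by positivity
  set A := N ^ 2 + K₁ + N ^ 2 * K₁ with hA
  have hA0 : 0 ≤ A := by positivity
  have hN0 : 0 < N := by positivity
  obtain ⟨ε, hε, hε1, hεB, hεN, hεκ, hεδ, hεA⟩ : ∃ ε > 0, ε ≤ 1 ∧ ε * B ≤ 1 / 2 ∧ ε * N ≤ 1 ∧
      ε * (2 * B + N) ≤ κ ∧ ε * (B + 2 * K * Λ + Λ * B) ≤ δ ∧ ε * (A * k.L) < μ := by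
    have hev : ∀ a b : ℝ, 0 < b → ∀ᶠ ε in 𝓝[>] (0 : ℝ), ε * a < b := fun a b hb => by
      have : Tendsto (fun ε : ℝ => ε * a) (𝓝[>] 0) (𝓝 0) := by
        have h : Continuous fun ε : ℝ => ε * a := by fun_prop
        simpa using (h.tendsto 0).mono_left nhdsWithin_le_nhds
      exact this.eventually_lt_const hb
    obtain ⟨ε, h0, h1, h2, h3, h4, h5, h6⟩ := (eventually_mem_nhdsWithin.and
      ((hev 1 1 one_pos).and ((hev B (1 / 2) (by norm_num)).and ((hev N 1 one_pos).and
      ((hev (2 * B + N) κ hκ).and ((hev (B + 2 * K * Λ + Λ * B) δ hδ).and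
      (hev (A * k.L) μ hμ0))))))).exists
    exact ⟨ε, h0, by linarith, h2.le, h3.le, h4.le, h5.le, h6⟩
  have hω1 : ∀ s, 1 / 2 ≤ 1 + ε * f s := fun s => by
    have := mul_le_mul_of_nonneg_left (abs_le.1 (hBf s)).1 hε.le
    linarith
  have hω2 : ∀ s, |1 + ε * f s| ≤ 2 := fun s => by
    have := mul_le_mul_of_nonneg_left (abs_le.1 (hBf s)).2 hε.le
    rw [abs_of_nonneg (by linarith [hω1 s])]
    linarith
  have hωm : Measurable fun s => 1 + ε * f s := (h.meas.const_mul ε).const_add 1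
  obtain ⟨c, hc, hcn⟩ := k.exists_integral_smul_perpPart_eq hm hmin hωm hω1 hω2 (-(ε • b))
  rw [norm_neg, norm_smul, Real.norm_of_nonneg hε.le] at hcn
  have hcK : ‖c‖ ≤ K * ε := by rw [hK]; linarith
  have hcK' : ‖c‖ ≤ K := hcK.trans (mul_le_of_le_one_right hK0 hε1)
  set X₁ : ℝ → Euc n := fun s => X s + perpPart (k.fd s) c with hX₁
  have hX₁c : Continuous X₁ := hX.add (hfd.perpPart continuous_const)
  have hX₁N : ∀ s, ‖X₁ s‖ ≤ N := fun s =>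
    (norm_add_le _ _).trans (add_le_add (hBX s) ((norm_perpPart_le (k.unit s) c).trans hcK'))
  have hX₁p : ∀ s, ⟪X₁ s, k.fd s⟫ = 0 := fun s => by
    simp only [hX₁]
    rw [inner_add_left, h.perp, inner_perpPart (k.unit s), add_zero]
  set U₀ : ℝ → Euc n := fun s => k.fd s + ε • X₁ s with hU₀
  have hU₀c : Continuous U₀ := hfd.add (hX₁c.const_smul ε)
  have hU₀sq : ∀ s, ‖U₀ s‖ ^ 2 = 1 + ε ^ 2 * ‖X₁ s‖ ^ 2 := fun s => by
    simp only [hU₀]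
    rw [norm_add_sq_real, k.unit, real_inner_smul_right, real_inner_comm, hX₁p, norm_smul,
      Real.norm_of_nonneg hε.le]; ring
  have hU₀1 : ∀ s, 1 ≤ ‖U₀ s‖ := fun s => by
    refine le_of_sq_le_sq ?_ (norm_nonneg _)
    rw [hU₀sq, one_pow]; exact le_add_of_nonneg_right (by positivity)
  have hU₀N : ∀ s, ‖U₀ s‖ ≤ 1 + ε ^ 2 * N ^ 2 := fun s => by
    refine le_of_sq_le_sq ?_ (by positivity)
    rw [hU₀sq]
    have : ε ^ 2 * ‖X₁ s‖ ^ 2 ≤ ε ^ 2 * N ^ 2 := by gcongr; exact hX₁N s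
    have h2 : 0 ≤ ε ^ 2 * N ^ 2 := by positivity
    calc 1 + ε ^ 2 * ‖X₁ s‖ ^ 2 ≤ 1 + ε ^ 2 * N ^ 2 := by linarith
      _ ≤ (1 + ε ^ 2 * N ^ 2) ^ 2 := le_self_pow₀ (by linarith) two_ne_zero
  have hU₀T : ∀ s, ‖U₀ s - k.fd s‖ ≤ ε * N := fun s => by
    simp only [hU₀]
    rw [add_sub_cancel_left, norm_smul, Real.norm_of_nonneg hε.le]
    have := hX₁N s; gcongr
  set ρ : ℝ → ℝ := fun s => (1 + ε * f s) * ‖U₀ s‖ with hρ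
  have hρm : Measurable ρ := hωm.mul hU₀c.norm.measurable
  have hρi : ∀ a b, IntervalIntegrable ρ volume a b := fun a b =>
    (intervalIntegrable_of_bounded hωm.aestronglyMeasurable (by simpa using hω2) a b
      ).mul_continuousOn hU₀c.norm.continuousOn
  set Λ₁ := Λ * (1 + K₁ * ε ^ 2) with hΛ₁
  have hΛ₁0 : Λ ≤ Λ₁ := le_mul_of_one_le_right hΛ0.le (le_add_of_nonneg_right (by positivity))
  have hUper : ∀ s, U₀ (s + k.L) = U₀ s := fun s => by
    simp only [hU₀, hX₁, h.perX, k.perd]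
  refine ⟨fun s => ‖U₀ s‖⁻¹ • U₀ s, ρ, Λ₁, fun s => by simp only [hUper], fun s => by
    simp only [hρ, hUper, h.perf], ?_, hρm, ?_, ?_, ?_, ?_, hΛ₁0, ?_, ?_⟩
  · exact (hU₀c.norm.inv₀ fun s => by linarith [hU₀1 s]).smul hU₀c
  · intro s
    rw [norm_smul, norm_inv, norm_norm, inv_mul_cancel₀]
    linarith [hU₀1 s]
  · intro s
    have h1 := hU₀1 s
    have h2 : ‖U₀ s‖ - 1 ≤ ε * N := by
      have h3 := norm_le_norm_add_norm_sub' (U₀ s) (k.fd s)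
      rw [k.unit] at h3
      linarith [hU₀T s]
    have e : ρ s - 1 = (‖U₀ s‖ - 1) + ε * f s * ‖U₀ s‖ := by simp only [hρ]; ring
    rw [e]
    refine (abs_add_le _ _).trans ?_
    rw [abs_of_nonneg (sub_nonneg.2 h1), abs_mul, abs_mul, abs_of_pos hε,
      abs_of_nonneg (norm_nonneg _)]
    have h4 : ε * |f s| * ‖U₀ s‖ ≤ ε * B * 2 := by
      gcongr
      · exact hBf s
      · linarith
    linarith
  · intro s
    have h1 := norm_normalize_sub_le (hU₀1 s) (k.unit s).ge
    rw [k.unit, inv_one, one_smul] at h1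
    refine h1.trans ((hU₀T s).trans (le_trans ?_ hεκ))
    gcongr
    linarith
  · have e : ∀ s, ρ s • (‖U₀ s‖⁻¹ • U₀ s) = k.fd s + (ε • (X s + f s • k.fd s) +
        (ε • ((1 + ε * f s) • perpPart (k.fd s) c) + ε ^ 2 • (f s • X s))) := fun s => by
      have h0 : ‖U₀ s‖ ≠ 0 := by linarith [hU₀1 s]
      simp only [hρ]
      rw [smul_smul, mul_assoc, mul_inv_cancel₀ h0, mul_one]
      simp only [hU₀, hX₁]
      module
    have i1 : IntervalIntegrable (fun s => ε • (X s + f s • k.fd s)) volume 0 k.L :=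
      ((hX.intervalIntegrable _ _).add (intervalIntegrable_smul h.meas hBf hfd _ _)).smul ε
    have i2 : IntervalIntegrable (fun s => ε • ((1 + ε * f s) • perpPart (k.fd s) c))
        volume 0 k.L :=
      (intervalIntegrable_smul hωm hω2 (hfd.perpPart continuous_const) _ _).smul ε
    have i3 : IntervalIntegrable (fun s => ε ^ 2 • (f s • X s)) volume 0 k.L :=
      (intervalIntegrable_smul h.meas hBf hX 0 k.L).smul (ε ^ 2)
    simp only [e]
    rw [intervalIntegral.integral_add (hfd.intervalIntegrable _ _) (i1.add (i2.add i3)),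
      intervalIntegral.integral_add i1 (i2.add i3), intervalIntegral.integral_add i2 i3,
      k.integral_fd,
      intervalIntegral.integral_smul, intervalIntegral.integral_smul,
      intervalIntegral.integral_smul, hclosed, hc, ← hb]
    module
  · intro s t hst
    refine (norm_normalize_sub_le (hU₀1 t) (hU₀1 s)).trans ?_
    obtain ⟨CX, hCX⟩ := h.lip
    obtain ⟨CT, hCT⟩ := k.lipd
    have hdperp : ∀ s, DifferentiableAt ℝ k.fd s → HasDerivAt (fun s => perpPart (k.fd s) c)
        (-(⟪c, k.fd s⟫ • _root_.deriv k.fd s + ⟪c, _root_.deriv k.fd s⟫ • k.fd s)) s := fun s hs => by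
      have h1 : HasDerivAt (fun s => ⟪c, k.fd s⟫) ⟪c, _root_.deriv k.fd s⟫ s := by
        simpa using (hasDerivAt_const s c).inner ℝ hs.hasDerivAt
      exact (h1.smul hs.hasDerivAt).const_sub c
    have hLip : ∃ C, LipschitzWith C U₀ := by
      have hp : ∃ C, LipschitzWith C fun s => perpPart (k.fd s) c := by
        refine ⟨Real.toNNReal (2 * ‖c‖ * CT), LipschitzWith.of_dist_le_mul fun x y => ?_⟩
        rw [dist_eq_norm, Real.coe_toNNReal _ (by positivity)]
        have e : perpPart (k.fd x) c - perpPart (k.fd y) c =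
            -(⟪c, k.fd x - k.fd y⟫ • k.fd x + ⟪c, k.fd y⟫ • (k.fd x - k.fd y)) := by
          simp only [perpPart, inner_sub_right]; module
        rw [e, norm_neg]
        refine (norm_add_le _ _).trans ?_
        rw [norm_smul, norm_smul, k.unit, mul_one]
        have h1 := norm_inner_le_norm (𝕜 := ℝ) c (k.fd x - k.fd y)
        have h2 := norm_inner_le_norm (𝕜 := ℝ) c (k.fd y)
        rw [k.unit, mul_one] at h2
        have h3 := hCT.dist_le_mul x y
        rw [dist_eq_norm] at h3
        calc _ ≤ ‖c‖ * ‖k.fd x - k.fd y‖ + ‖c‖ * ‖k.fd x - k.fd y‖ := by gcongr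
          _ = 2 * ‖c‖ * ‖k.fd x - k.fd y‖ := by ring
          _ ≤ 2 * ‖c‖ * (CT * dist x y) := by gcongr
          _ = _ := by ring
      obtain ⟨Cp, hp⟩ := hp
      exact ⟨_, hCT.add ((lipschitzWith_smul ε).comp (hCX.add hp))⟩
    obtain ⟨C, hC⟩ := hLip
    rw [← intervalIntegral.integral_const_mul]
    refine hC.norm_sub_le_integral hst ((hρi _ _).const_mul _) ?_
    filter_upwards [hcurv, k.ae_differentiableAt_fd, hCX.ae_differentiableAt_real] with r hr hT hXr
    have hd : HasDerivAt U₀ (_root_.deriv k.fd r + ε • (_root_.deriv X r +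
        -(⟪c, k.fd r⟫ • _root_.deriv k.fd r + ⟪c, _root_.deriv k.fd r⟫ • k.fd r))) r :=
      hT.hasDerivAt.add ((hXr.hasDerivAt.add (hdperp r hT)).const_smul ε)
    rw [hd.deriv]
    have hDn := norm_deriv_fd_le hΛ r
    have hZ : ‖-(⟪c, k.fd r⟫ • _root_.deriv k.fd r + ⟪c, _root_.deriv k.fd r⟫ • k.fd r)‖ ≤ 2 * K * Λ * ε := by
      rw [norm_neg]
      refine (norm_add_le _ _).trans ?_
      rw [norm_smul, norm_smul, k.unit, mul_one]
      have h1 := norm_inner_le_norm (𝕜 := ℝ) c (_root_.deriv k.fd r)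
      have h2 := norm_inner_le_norm (𝕜 := ℝ) c (k.fd r)
      rw [k.unit, mul_one] at h2
      calc _ ≤ ‖c‖ * Λ + ‖c‖ * Λ := by gcongr; exact h1.trans (by gcongr)
        _ = 2 * ‖c‖ * Λ := by ring
        _ ≤ 2 * (K * ε) * Λ := by gcongr
        _ = _ := by ring
    refine (norm_deriv_perturb_le hΛ0 hDn (hBd r) (hBf r) hZ hε hε1 hεB hεδ hr).trans ?_
    have h5 : 0 ≤ Λ₁ * (1 + ε * f r) :=
      mul_nonneg (hΛ0.le.trans hΛ₁0) (by linarith [hω1 r])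
    calc Λ₁ * (1 + ε * f r) ≤ Λ₁ * (1 + ε * f r) * ‖U₀ r‖ := le_mul_of_one_le_right h5 (hU₀1 r)
      _ = Λ₁ * ρ r := by simp only [hρ]; ring
  · have h1 : ∫ s in (0 : ℝ)..k.L, ρ s ≤ (1 + ε ^ 2 * N ^ 2) * (k.L - ε * μ) := by
      have e : (1 + ε ^ 2 * N ^ 2) * (k.L - ε * μ) =
          ∫ s in (0 : ℝ)..k.L, (1 + ε ^ 2 * N ^ 2) * (1 + ε * f s) := by
        rw [intervalIntegral.integral_const_mul, intervalIntegral.integral_add (by simp)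
          (hintf.const_mul ε), intervalIntegral.integral_const_mul, hμ]
        simp
      rw [e]
      refine intervalIntegral.integral_mono_on hL.le (hρi _ _)
        (((intervalIntegrable_const).add (hintf.const_mul ε)).const_mul _) fun s _ => ?_
      simp only [hρ]
      rw [mul_comm]
      exact mul_le_mul_of_nonneg_right (hU₀N s) (by linarith [hω1 s])
    have h2 : (1 + ε ^ 2 * N ^ 2) * (1 + K₁ * ε ^ 2) ≤ 1 + ε ^ 2 * A := by
      have h3 : ε ^ 2 * ε ^ 2 ≤ ε ^ 2 := mul_le_of_le_one_left (sq_nonneg _) (pow_le_one₀ hε.le hε1)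
      have h4 : N ^ 2 * K₁ * (ε ^ 2 * ε ^ 2) ≤ N ^ 2 * K₁ * ε ^ 2 := by gcongr
      rw [hA]; linarith
    have hpos : 0 ≤ ∫ s in (0 : ℝ)..k.L, ρ s :=
      intervalIntegral.integral_nonneg hL.le fun s _ =>
        mul_nonneg (by linarith [hω1 s]) (norm_nonneg _)
    have h5 : 0 ≤ k.L - ε * μ := by
      have := hpos.trans h1
      exact nonneg_of_mul_nonneg_right this (by positivity)
    have h6 : (∫ s in (0 : ℝ)..k.L, ρ s) * (1 + K₁ * ε ^ 2) < k.L := by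
      calc (∫ s in (0 : ℝ)..k.L, ρ s) * (1 + K₁ * ε ^ 2)
          ≤ (1 + ε ^ 2 * N ^ 2) * (k.L - ε * μ) * (1 + K₁ * ε ^ 2) := by gcongr
        _ = (1 + ε ^ 2 * N ^ 2) * (1 + K₁ * ε ^ 2) * (k.L - ε * μ) := by ring
        _ ≤ (1 + ε ^ 2 * A) * (k.L - ε * μ) := by gcongr
        _ < k.L := by
          have h7 := mul_lt_mul_of_pos_left hεA hε
          have h8 : 0 ≤ ε ^ 2 * A * (ε * μ) := by positivity
          linarith
    calc _ = (∫ s in (0 : ℝ)..k.L, ρ s) * (1 + K₁ * ε ^ 2) * Λ := by rw [hΛ₁]; ring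
      _ < k.L * Λ := by gcongr

end Knot

namespace Knot

variable {n : ℕ} {k : Knot n} {Λ : ℝ} {X Y : ℝ → Euc n} {f g : ℝ → ℝ}

lemma Variation.add (h : k.Variation Λ X f) (h' : k.Variation Λ Y g) :
    k.Variation Λ (fun s => X s + Y s) (fun s => f s + g s) where
  perX s := by rw [h.perX, h'.perX]
  perf s := by rw [h.perf, h'.perf]
  perp s := by rw [inner_add_left, h.perp, h'.perp, add_zero]
  lip := by
    obtain ⟨C, hC⟩ := h.lip
    obtain ⟨C', hC'⟩ := h'.lip
    exact ⟨_, hC.add hC'⟩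
  meas := h.meas.add h'.meas
  bdd := by
    obtain ⟨B, hB⟩ := h.bdd
    obtain ⟨B', hB'⟩ := h'.bdd
    exact ⟨B + B', fun s => (abs_add_le _ _).trans (add_le_add (hB s) (hB' s))⟩
  curv := by
    obtain ⟨C, hC⟩ := h.lip
    obtain ⟨C', hC'⟩ := h'.lip
    obtain ⟨δ, hδ, hc⟩ := h.curv
    obtain ⟨δ', hδ', hc'⟩ := h'.curv
    refine ⟨min δ δ', lt_min hδ hδ', ?_⟩
    filter_upwards [hc, hc', hC.ae_differentiableAt_real, hC'.ae_differentiableAt_real]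
      with s h1 h2 h3 h4 hs
    rw [deriv_fun_add h3 h4, inner_add_right,
      ← h1 (lt_of_le_of_lt (by linarith [min_le_left δ δ']) hs),
      ← h2 (lt_of_le_of_lt (by linarith [min_le_right δ δ']) hs), mul_add]

lemma Variation.smul (h : k.Variation Λ X f) (c : ℝ) :
    k.Variation Λ (fun s => c • X s) (fun s => c * f s) where
  perX s := by rw [h.perX]
  perf s := by rw [h.perf]
  perp s := by rw [real_inner_smul_left, h.perp, mul_zero]
  lip := by
    obtain ⟨C, hC⟩ := h.lip
    exact ⟨_, (lipschitzWith_smul c).comp hC⟩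
  meas := h.meas.const_mul c
  bdd := by
    obtain ⟨B, hB⟩ := h.bdd
    refine ⟨|c| * B, fun s => ?_⟩
    rw [abs_mul]
    exact mul_le_mul_of_nonneg_left (hB s) (abs_nonneg c)
  curv := by
    obtain ⟨C, hC⟩ := h.lip
    obtain ⟨δ, hδ, hc⟩ := h.curv
    refine ⟨δ, hδ, ?_⟩
    filter_upwards [hc, hC.ae_differentiableAt_real] with s h1 h3 hs
    rw [deriv_fun_const_smul c h3, real_inner_smul_right, ← h1 hs]
    ring

lemma variation_zero : k.Variation Λ (fun _ => 0) (fun _ => 0) where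
  perX _ := rfl
  perf _ := rfl
  perp s := inner_zero_left _
  lip := ⟨0, LipschitzWith.const 0⟩
  meas := measurable_const
  bdd := ⟨0, fun s => by simp⟩
  curv := ⟨1, one_pos, Filter.Eventually.of_forall fun s _ => by simp⟩

lemma Variation.intervalIntegrable (h : k.Variation Λ X f) (a b : ℝ) :
    IntervalIntegrable f volume a b :=
  intervalIntegrable_of_bounded h.meas.aestronglyMeasurable (by simpa using h.bdd.choose_spec) _ _

lemma Variation.intervalIntegrable_smul_fd (h : k.Variation Λ X f) (a b : ℝ) :
    IntervalIntegrable (fun s => f s • k.fd s) volume a b :=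
  intervalIntegrable_smul h.meas h.bdd.choose_spec k.continuous_fd a b

lemma Variation.intervalIntegrable_add (h : k.Variation Λ X f) (a b : ℝ) :
    IntervalIntegrable (fun s => X s + f s • k.fd s) volume a b :=
  (h.continuous.intervalIntegrable _ _).add (h.intervalIntegrable_smul_fd _ _)

/-- A Lagrange multiplier for the closedness constraint. -/
lemma exists_multiplier (hno : ∀ X f, k.Variation Λ X f →
      ∫ s in (0 : ℝ)..k.L, (X s + f s • k.fd s) = 0 → 0 ≤ ∫ s in (0 : ℝ)..k.L, f s) :
    ∃ p : Euc n, ∀ X f, k.Variation Λ X f →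
      ∫ s in (0 : ℝ)..k.L, (1 - ⟪p, k.fd s⟫) * f s = ∫ s in (0 : ℝ)..k.L, ⟪p, X s⟫ := by
  let W : Submodule ℝ (ℝ × Euc n) :=
    { carrier := {z | ∃ X f, k.Variation Λ X f ∧ ∫ s in (0 : ℝ)..k.L, f s = z.1 ∧
        ∫ s in (0 : ℝ)..k.L, (X s + f s • k.fd s) = z.2}
      zero_mem' := ⟨_, _, variation_zero, by simp, by simp⟩
      add_mem' := by
        rintro z z' ⟨X, f, h, h1, h2⟩ ⟨X', f', h', h1', h2'⟩
        refine ⟨_, _, h.add h', ?_, ?_⟩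
        · rw [intervalIntegral.integral_add (h.intervalIntegrable _ _) (h'.intervalIntegrable _ _),
            h1, h1', Prod.fst_add]
        · rw [Prod.snd_add, ← h2, ← h2', ← intervalIntegral.integral_add
            (h.intervalIntegrable_add _ _) (h'.intervalIntegrable_add _ _)]
          congr 1 with s : 1
          module
      smul_mem' := by
        rintro c z ⟨X, f, h, h1, h2⟩
        refine ⟨_, _, h.smul c, ?_, ?_⟩
        · rw [intervalIntegral.integral_const_mul, h1, Prod.smul_fst, smul_eq_mul]
        · rw [Prod.smul_snd, ← h2, ← intervalIntegral.integral_smul]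
          congr 1 with s : 1
          module }
  have hW : ((-1 : ℝ), (0 : Euc n)) ∉ W := by
    rintro ⟨X, f, h, h1, h2⟩
    have := hno X f h h2
    rw [h1] at this
    norm_num at this
  obtain ⟨l, hl, hle⟩ := Submodule.exists_le_ker_of_notMem hW
  have hsplit : ∀ (a : ℝ) (v : Euc n), l (a, v) = a * l (1, 0) + l (0, v) := fun a v => by
    rw [← smul_eq_mul, ← map_smul, ← map_add]; simp
  have hc : l (1, 0) ≠ 0 := by
    intro h0
    apply hl
    rw [hsplit, h0, mul_zero, zero_add]
    exact map_zero l
  set q : Euc n := (InnerProductSpace.toDual ℝ (Euc n)).symm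
    (LinearMap.toContinuousLinearMap (l ∘ₗ LinearMap.inr ℝ ℝ (Euc n))) with hq
  have hqv : ∀ v, ⟪q, v⟫ = l (0, v) := fun v => by
    rw [hq, InnerProductSpace.toDual_symm_apply]; rfl
  refine ⟨-(l (1, 0))⁻¹ • q, fun X f h => ?_⟩
  have hmem : ((∫ s in (0 : ℝ)..k.L, f s), ∫ s in (0 : ℝ)..k.L, (X s + f s • k.fd s)) ∈ W :=
    ⟨X, f, h, rfl, rfl⟩
  have h0 := hle hmem
  rw [LinearMap.mem_ker, hsplit, ← hqv] at h0
  set p := -(l (1, 0))⁻¹ • q with hp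
  have h1 : ∫ s in (0 : ℝ)..k.L, f s = ⟪p, ∫ s in (0 : ℝ)..k.L, (X s + f s • k.fd s)⟫ := by
    rw [hp, real_inner_smul_left]
    field_simp
    linarith
  have i2 : IntervalIntegrable (fun s => ⟪p, k.fd s⟫ * f s) volume 0 k.L :=
    (h.intervalIntegrable _ _).continuousOn_mul (by have := k.continuous_fd; fun_prop)
  have i3 : IntervalIntegrable (fun s => ⟪p, X s⟫) volume 0 k.L :=
    Continuous.intervalIntegrable (by have := h.continuous; fun_prop) _ _
  rw [inner_intervalIntegral (h.intervalIntegrable_add _ _)] at h1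
  simp only [inner_add_right, real_inner_smul_right, mul_comm (f _)] at h1
  rw [intervalIntegral.integral_add i3 i2] at h1
  simp only [sub_mul, one_mul]
  rw [intervalIntegral.integral_sub (h.intervalIntegrable _ _) i2, h1]
  ring

end Knot

lemma ae_eq_zero_of_intervalIntegral_eq_zero {g : ℝ → ℝ} {a b : ℝ} (hab : a ≤ b)
    (hg : IntervalIntegrable g volume a b) (h0 : ∀ s, 0 ≤ g s) (h : ∫ s in a..b, g s = 0) :
    ∀ᵐ s ∂volume.restrict (Ioc a b), g s = 0 :=
  (intervalIntegral.integral_eq_zero_iff_of_le_of_nonneg_ae hab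
    (Filter.Eventually.of_forall h0) hg).1 h

lemma Function.Periodic.deriv_eq {E : Type*} [NormedAddCommGroup E] [NormedSpace ℝ E]
    {X : ℝ → E} {L : ℝ} (h : ∀ s, X (s + L) = X s) (s : ℝ) :
    _root_.deriv X (s + L) = _root_.deriv X s := by
  rw [← deriv_comp_add_const]
  simp only [h]

namespace Knot

variable {n : ℕ} {k : Knot n} {Λ : ℝ} {p : Euc n}

/-- The first order condition satisfied by a Lagrange multiplier `p`. -/
def IsMultiplier (k : Knot n) (Λ : ℝ) (p : Euc n) : Prop := ∀ X f, k.Variation Λ X f →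
  ∫ s in (0 : ℝ)..k.L, (1 - ⟪p, k.fd s⟫) * f s = ∫ s in (0 : ℝ)..k.L, ⟪p, X s⟫

lemma measurable_deriv_fd : Measurable (_root_.deriv k.fd) := measurable_deriv _

lemma continuous_inner_fd (p : Euc n) : Continuous fun s => ⟪p, k.fd s⟫ :=
  continuous_const.inner k.continuous_fd

lemma integral_inner_fd (p : Euc n) : ∫ s in (0 : ℝ)..k.L, ⟪p, k.fd s⟫ = 0 := by
  rw [← inner_intervalIntegral (k.continuous_fd.intervalIntegrable _ _), k.integral_fd,
    inner_zero_right]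

lemma abs_inner_fd_le (p : Euc n) (s : ℝ) : |⟪p, k.fd s⟫| ≤ ‖p‖ := by
  simpa [k.unit] using abs_real_inner_le_norm p (k.fd s)

lemma IsMultiplier.ae_le_or (hp : k.IsMultiplier Λ p) :
    ∀ᵐ s ∂volume.restrict (Ioc 0 k.L), Λ ≤ ‖_root_.deriv k.fd s‖ ∨ ⟪p, k.fd s⟫ = 1 := by
  have key : ∀ j : ℕ, ∀ᵐ s ∂volume.restrict (Ioc 0 k.L),
      ‖_root_.deriv k.fd s‖ ≤ Λ - 1 / ((j : ℝ) + 1) → ⟪p, k.fd s⟫ = 1 := by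
    intro j
    set S : Set ℝ := {s | ‖_root_.deriv k.fd s‖ ≤ Λ - 1 / ((j : ℝ) + 1)} with hS
    have hSm : MeasurableSet S := measurableSet_le measurable_deriv_fd.norm measurable_const
    set f : ℝ → ℝ := S.indicator fun s => 1 - ⟪p, k.fd s⟫ with hf
    have hin : ∀ s, s ∈ S → f s = 1 - ⟪p, k.fd s⟫ := fun s hs => indicator_of_mem hs _
    have hout : ∀ s, s ∉ S → f s = 0 := fun s hs => indicator_of_notMem hs _
    have hv : k.Variation Λ (fun _ => 0) f :=
      { perX := fun _ => rfl
        perf := fun s => by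
          have : s + k.L ∈ S ↔ s ∈ S := by
            simp only [hS, mem_ofPred_eq, Function.Periodic.deriv_eq k.perd]
          by_cases hs : s ∈ S
          · rw [hin _ hs, hin _ (this.2 hs), k.perd]
          · rw [hout _ hs, hout _ (fun h => hs (this.1 h))]
        perp := fun s => inner_zero_left _
        lip := ⟨0, LipschitzWith.const 0⟩
        meas := ((continuous_inner_fd p).measurable.const_sub 1).indicator hSm
        bdd := by
          refine ⟨1 + ‖p‖, fun s => ?_⟩
          by_cases hs : s ∈ S
          · rw [hin _ hs]
            refine (abs_sub _ _).trans ?_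
            rw [abs_one]
            linarith [k.abs_inner_fd_le p s]
          · rw [hout _ hs, abs_zero]; positivity
        curv := by
          refine ⟨1 / ((j : ℝ) + 1), by positivity, Filter.Eventually.of_forall fun s hs => ?_⟩
          rw [hout s (by simpa [hS] using hs)]
          simp }
    have h0 := hp _ _ hv
    have e : ∀ s, (1 - ⟪p, k.fd s⟫) * f s = f s * f s := fun s => by
      by_cases hs : s ∈ S
      · rw [hin _ hs]
      · rw [hout _ hs]; ring
    simp only [e, inner_zero_right, intervalIntegral.integral_zero] at h0
    have hi : IntervalIntegrable (fun s => f s * f s) volume 0 k.L := by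
      simp only [← e]
      exact (hv.intervalIntegrable _ _).continuousOn_mul
        (continuous_const.sub (continuous_inner_fd p)).continuousOn
    filter_upwards [ae_eq_zero_of_intervalIntegral_eq_zero k.Lpos.le hi
      (fun s => mul_self_nonneg _) h0] with s h1 hs
    have h2 := mul_self_eq_zero.1 h1
    rw [hin s hs] at h2
    linarith
  filter_upwards [ae_all_iff.2 key] with s hs
  rcases le_or_gt Λ ‖_root_.deriv k.fd s‖ with h | h
  · exact Or.inl h
  · obtain ⟨j, hj⟩ := exists_nat_one_div_lt (sub_pos.2 h)
    exact Or.inr (hs j (by linarith))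

lemma IsMultiplier.integral_eq (hp : k.IsMultiplier Λ p) (hΛ : 0 < Λ) {X : ℝ → Euc n}
    (perX : ∀ s, X (s + k.L) = X s) (perp : ∀ s, ⟪X s, k.fd s⟫ = 0)
    (lip : ∃ C, LipschitzWith C X) :
    ∫ s in (0 : ℝ)..k.L, (1 - ⟪p, k.fd s⟫) * ⟪_root_.deriv k.fd s, _root_.deriv X s⟫ =
      Λ ^ 2 * ∫ s in (0 : ℝ)..k.L, ⟪p, X s⟫ := by
  have hv : k.Variation Λ X fun s => (Λ ^ 2)⁻¹ * ⟪_root_.deriv k.fd s, _root_.deriv X s⟫ :=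
    { perX := perX
      perf := fun s => by rw [Function.Periodic.deriv_eq perX, Function.Periodic.deriv_eq k.perd]
      perp := perp
      lip := lip
      meas := (measurable_deriv_fd.inner (measurable_deriv _)).const_mul _
      bdd := by
        obtain ⟨C, hC⟩ := lip
        obtain ⟨C', hC'⟩ := k.lipd
        refine ⟨(Λ ^ 2)⁻¹ * (C' * C), fun s => ?_⟩
        rw [abs_mul, abs_of_nonneg (by positivity)]
        have h1 := norm_deriv_le_of_lipschitz hC (x₀ := s)
        have h2 := norm_deriv_le_of_lipschitz hC' (x₀ := s)
        have h3 := abs_real_inner_le_norm (_root_.deriv k.fd s) (_root_.deriv X s)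
        have h4 : ‖_root_.deriv k.fd s‖ * ‖_root_.deriv X s‖ ≤ C' * C := by gcongr
        have h5 := h3.trans h4
        gcongr
      curv := ⟨1, one_pos, Filter.Eventually.of_forall fun s _ => by field_simp⟩ }
  rw [← hp _ _ hv, ← intervalIntegral.integral_const_mul]
  congr 1 with s : 1
  field_simp

end Knot

section

variable {E : Type*} [NormedAddCommGroup E] [InnerProductSpace ℝ E]

lemma exists_lipschitzWith_smul {φ : ℝ → ℝ} {Y : ℝ → E} (hφ : ∃ C, LipschitzWith C φ)
    (bφ : ∃ B, ∀ s, |φ s| ≤ B) (hY : ∃ C, LipschitzWith C Y) (bY : ∃ B, ∀ s, ‖Y s‖ ≤ B) :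
    ∃ C, LipschitzWith C fun s => φ s • Y s := by
  obtain ⟨C, hC⟩ := hφ
  obtain ⟨B, hB⟩ := bφ
  obtain ⟨C', hC'⟩ := hY
  obtain ⟨B', hB'⟩ := bY
  have hB0 : 0 ≤ B := (abs_nonneg _).trans (hB 0)
  have hB0' : 0 ≤ B' := (norm_nonneg _).trans (hB' 0)
  refine ⟨Real.toNNReal (B * C' + C * B'), LipschitzWith.of_dist_le_mul fun x y => ?_⟩
  rw [Real.coe_toNNReal _ (by positivity), dist_eq_norm]
  have e : φ x • Y x - φ y • Y y = φ x • (Y x - Y y) + (φ x - φ y) • Y y := by module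
  have h1 := hC.dist_le_mul x y
  have h2 := hC'.dist_le_mul x y
  rw [Real.dist_eq] at h1
  rw [dist_eq_norm] at h2
  rw [e]
  refine (norm_add_le _ _).trans ?_
  rw [norm_smul, norm_smul, Real.norm_eq_abs, Real.norm_eq_abs]
  calc _ ≤ B * (C' * dist x y) + C * dist x y * B' := by
        gcongr
        exacts [hB x, hB' y]
    _ = _ := by ring

lemma exists_lipschitzWith_inner (c : E) {Y : ℝ → E} (hY : ∃ C, LipschitzWith C Y) :
    ∃ C, LipschitzWith C fun s => ⟪c, Y s⟫ := by
  obtain ⟨C, hC⟩ := hY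
  exact ⟨_, (innerSL ℝ c).lipschitz.comp hC⟩

lemma exists_lipschitzWith_perpPart (c : E) {Y : ℝ → E} (hY : ∃ C, LipschitzWith C Y)
    (h1 : ∀ s, ‖Y s‖ = 1) : ∃ C, LipschitzWith C fun s => perpPart (Y s) c := by
  obtain ⟨C, hC⟩ := exists_lipschitzWith_smul (exists_lipschitzWith_inner c hY)
    ⟨‖c‖, fun s => by simpa [h1] using abs_real_inner_le_norm c (Y s)⟩ hY ⟨1, fun s => (h1 s).le⟩
  exact ⟨_, (LipschitzWith.const c).sub hC⟩

end

lemma Metric.infDist_add_compl {L : ℝ} {U : Set ℝ} (hU : ∀ s, s + L ∈ U ↔ s ∈ U) (s : ℝ) :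
    Metric.infDist (s + L) Uᶜ = Metric.infDist s Uᶜ := by
  have e : (fun s => s + L) '' Uᶜ = Uᶜ := by
    ext x
    constructor
    · rintro ⟨y, hy, rfl⟩ h
      exact hy ((hU y).1 h)
    · intro hx
      refine ⟨x - L, fun h => hx ?_, sub_add_cancel x L⟩
      have := (hU (x - L)).2 h
      rwa [sub_add_cancel] at this
  have := Metric.infDist_image (Φ := fun s => s + L) (isometry_add_right L) (x := s) (t := Uᶜ)
  rwa [e] at this

namespace Knot

variable {n : ℕ} {k : Knot n} {Λ : ℝ} {p : Euc n}

lemma IsMultiplier.norm_eq_one (hp : k.IsMultiplier Λ p) {s₀ Λ' δ : ℝ} (hΛ' : Λ' < Λ)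
    (hΛ0 : 0 ≤ Λ') (hδ : 0 < δ)
    (hnear : ∀ x y, |x - s₀| < δ → |y - s₀| < δ → ‖k.fd x - k.fd y‖ ≤ Λ' * |x - y|) :
    ‖p‖ = 1 ∧ ∃ᵐ s ∂volume.restrict (Ioc 0 k.L), ⟪p, k.fd s⟫ = 1 := by
  have hL := k.Lpos
  set U : Set ℝ := {s | ∃ δ > 0, ∀ x y, |x - s| < δ → |y - s| < δ →
    ‖k.fd x - k.fd y‖ ≤ Λ' * |x - y|} with hU
  have hUo : IsOpen U := by
    rw [Metric.isOpen_iff]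
    rintro s ⟨d, hd, h⟩
    refine ⟨d / 2, by positivity, fun t ht => ⟨d / 2, by positivity, fun x y hx hy => h x y ?_ ?_⟩⟩
    · rw [Metric.mem_ball, Real.dist_eq] at ht
      linarith [abs_sub_le x t s]
    · rw [Metric.mem_ball, Real.dist_eq] at ht
      linarith [abs_sub_le y t s]
  have hUper : ∀ s, s + k.L ∈ U ↔ s ∈ U := by
    intro s
    constructor
    · rintro ⟨d, hd, h⟩
      refine ⟨d, hd, fun x y hx hy => ?_⟩
      have := h (x + k.L) (y + k.L) (by simpa using hx) (by simpa using hy)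
      simpa [k.perd] using this
    · rintro ⟨d, hd, h⟩
      refine ⟨d, hd, fun x y hx hy => ?_⟩
      have := h (x - k.L) (y - k.L) (by convert hx using 2; ring) (by convert hy using 2; ring)
      rw [← k.perd (x - k.L), ← k.perd (y - k.L)] at this
      simpa using this
  have hUD : ∀ s ∈ U, ‖_root_.deriv k.fd s‖ ≤ Λ' := by
    rintro s ⟨d, hd, h⟩
    refine norm_deriv_le_of_lip' hΛ0 ?_
    filter_upwards [Metric.ball_mem_nhds s hd] with x hx
    exact h x s (by simpa [Real.dist_eq] using hx) (by simpa using hd)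
  have hU1 : ∀ᵐ s ∂volume.restrict (Ioc 0 k.L), s ∈ U → ⟪p, k.fd s⟫ = 1 := by
    filter_upwards [hp.ae_le_or] with s hs hsU
    exact hs.resolve_left (by linarith [hUD s hsU])
  have hUc : Uᶜ.Nonempty := by
    by_contra h
    rw [not_nonempty_iff_eq_empty, compl_empty_iff] at h
    have h1 : ∫ s in (0 : ℝ)..k.L, ⟪p, k.fd s⟫ = ∫ s in (0 : ℝ)..k.L, (1 : ℝ) := by
      rw [intervalIntegral.integral_of_le hL.le, intervalIntegral.integral_of_le hL.le]
      refine integral_congr_ae ?_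
      filter_upwards [hU1] with s hs
      exact hs (h ▸ mem_univ s)
    rw [k.integral_inner_fd] at h1
    simp at h1
    linarith
  set ψ : ℝ → ℝ := fun s => Metric.infDist s Uᶜ with hψ
  have hψL : LipschitzWith 1 ψ := Metric.lipschitz_infDist_pt _
  have hψper : ∀ s, ψ (s + k.L) = ψ s := Metric.infDist_add_compl hUper
  have hψ0 : ∀ s, 0 ≤ ψ s := fun s => Metric.infDist_nonneg
  have hψU : ∀ s ∈ U, 0 < ψ s := fun s hs =>
    (hUo.isClosed_compl.notMem_iff_infDist_pos hUc).1 (by simpa using hs)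
  have hψUc : ∀ s ∉ U, ψ s = 0 := fun s hs => Metric.infDist_zero_of_mem hs
  have hψb : ∃ B, ∀ s, |ψ s| ≤ B :=
    Function.Periodic.exists_norm_le hψper hL hψL.continuous
  have hPL : ∃ C, LipschitzWith C fun s => perpPart (k.fd s) p :=
    exists_lipschitzWith_perpPart p k.lipd k.unit
  have hPc : Continuous fun s => perpPart (k.fd s) p := k.continuous_fd.perpPart continuous_const
  have hv : k.Variation Λ (fun s => ψ s • perpPart (k.fd s) p) (fun _ => 0) :=
    { perX := fun s => by rw [hψper, k.perd]
      perf := fun _ => rfl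
      perp := fun s => by rw [real_inner_smul_left, inner_perpPart (k.unit s), mul_zero]
      lip := exists_lipschitzWith_smul ⟨1, hψL⟩ hψb hPL
        ⟨‖p‖, fun s => norm_perpPart_le (k.unit s) p⟩
      meas := measurable_const
      bdd := ⟨0, fun _ => by simp⟩
      curv := by
        refine ⟨Λ - Λ', by linarith, ?_⟩
        obtain ⟨C, hC⟩ := hPL
        filter_upwards [hψL.ae_differentiableAt_real, hC.ae_differentiableAt_real] with s h1 h2 hs
        have hsU : s ∉ U := fun h => by linarith [hUD s h]
        have h3 : _root_.deriv ψ s = 0 := by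
          refine IsLocalMin.deriv_eq_zero (Filter.Eventually.of_forall fun t => ?_)
          rw [hψUc s hsU]
          exact hψ0 t
        rw [deriv_fun_smul h1 h2, h3, hψUc s hsU]
        simp }
  have h0 := hp _ _ hv
  have e : ∀ s, ⟪p, ψ s • perpPart (k.fd s) p⟫ = ψ s * ‖perpPart (k.fd s) p‖ ^ 2 := fun s => by
    rw [real_inner_smul_right, real_inner_comm, inner_perpPart_self (k.unit s)]
  simp only [e, mul_zero, intervalIntegral.integral_zero] at h0
  have hae := ae_eq_zero_of_intervalIntegral_eq_zero hL.le
    ((hψL.continuous.mul (hPc.norm.pow 2)).intervalIntegrable _ _)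
    (fun s => mul_nonneg (hψ0 s) (sq_nonneg _)) h0.symm
  have hfreq : ∃ᵐ s ∂volume.restrict (Ioc 0 k.L), s ∈ U := by
    intro hcon
    obtain ⟨y, hy, he⟩ := Function.Periodic.exists_mem_Ioc
      (f := fun s => s ∈ U) (fun s => propext (hUper s)) hL s₀ 0
    rw [zero_add] at hy
    have hs₀ : s₀ ∈ U := ⟨δ, hδ, hnear⟩
    have hyU : y ∈ U := he ▸ hs₀
    have hyc : y ∈ closure (Ioo 0 k.L) := by
      rw [closure_Ioo hL.ne]
      exact ⟨hy.1.le, hy.2⟩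
    obtain ⟨z, hzU, hz⟩ := mem_closure_iff.1 hyc U hUo hyU
    have h0 : volume (U ∩ Ioo 0 k.L) = 0 := by
      refine measure_mono_null ?_ (ae_iff.1 ((ae_restrict_iff' measurableSet_Ioc).1 hcon))
      rintro t ⟨htU, ht⟩ h
      exact h ⟨ht.1, ht.2.le⟩ htU
    rw [(hUo.inter isOpen_Ioo).measure_eq_zero_iff volume] at h0
    exact h0.subset ⟨hzU, hz⟩
  obtain ⟨s, hs, hs1, hs2⟩ := (hfreq.and_eventually (hU1.and hae)).exists
  refine ⟨?_, (hfreq.and_eventually hU1).mono fun s h => h.2 h.1⟩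
  have h1 : ‖perpPart (k.fd s) p‖ ^ 2 = 0 := (mul_eq_zero.1 hs2).resolve_left (hψU s hs).ne'
  rw [norm_perpPart_sq (k.unit s), hs1 hs] at h1
  nlinarith [norm_nonneg p]

end Knot

lemma norm_sq_mul_norm_sq_eq_inner_sq {n : ℕ} {x y : Euc n} (h : ∀ i j, x i * y j = x j * y i) :
    ‖x‖ ^ 2 * ‖y‖ ^ 2 = ⟪x, y⟫ ^ 2 := by
  rw [EuclideanSpace.real_norm_sq_eq, EuclideanSpace.real_norm_sq_eq, PiLp.inner_apply, sq (∑ i, _),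
    Finset.sum_mul_sum, Finset.sum_mul_sum]
  refine Finset.sum_congr rfl fun i _ => Finset.sum_congr rfl fun j _ => ?_
  simp only [RCLike.inner_apply, conj_trivial]
  calc x i ^ 2 * y j ^ 2 = (x i * y j) * (x i * y j) := by ring
    _ = (x i * y j) * (x j * y i) := by rw [h i j]
    _ = _ := by ring

lemma inner_perpPart_left {E : Type*} [NormedAddCommGroup E] [InnerProductSpace ℝ E] (u c d : E) :
    ⟪perpPart u c, d⟫ = ⟪c, perpPart u d⟫ := by
  rw [perpPart, perpPart, inner_sub_left, inner_sub_right, real_inner_smul_left,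
    real_inner_smul_right, real_inner_comm d u]
  ring

/-- The primitive of the deviation of a bounded periodic function from its mean. -/
lemma exists_primitive_sub_mean {u : ℝ → ℝ} {L B : ℝ} (hL : 0 < L) (hu : Measurable u)
    (hper : ∀ s, u (s + L) = u s) (hB : ∀ s, |u s| ≤ B) :
    ∃ φ : ℝ → ℝ, (∀ s, φ (s + L) = φ s) ∧ (∃ C, LipschitzWith C φ) ∧
      ∀ᵐ s, HasDerivAt φ (u s - (∫ r in (0 : ℝ)..L, u r) / L) s := by
  set m := (∫ r in (0 : ℝ)..L, u r) / L with hm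
  set g : ℝ → ℝ := fun s => u s - m with hg
  have hgB : ∀ s, ‖g s‖ ≤ B + |m| := fun s => (abs_sub _ _).trans (by linarith [hB s])
  have hgi : ∀ a b, IntervalIntegrable g volume a b := fun a b =>
    intervalIntegrable_of_bounded (hu.sub_const m).aestronglyMeasurable hgB a b
  have hui : IntervalIntegrable u volume 0 L :=
    intervalIntegrable_of_bounded hu.aestronglyMeasurable hB _ _
  have hg0 : ∫ s in (0 : ℝ)..L, g s = 0 := by
    rw [hg, intervalIntegral.integral_sub hui (by simp), intervalIntegral.integral_const, hm]
    simp only [sub_zero, smul_eq_mul]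
    field_simp
    ring
  have hB0 : 0 ≤ B + |m| := (norm_nonneg _).trans (hgB 0)
  refine ⟨fun s => ∫ r in (0 : ℝ)..s, g r, fun s => ?_, ⟨Real.toNNReal (B + |m|), ?_⟩, ?_⟩
  · have hgp : Function.Periodic g L := fun s => by simp only [hg, hper]
    have h1 := hgp.intervalIntegral_add_eq s 0
    rw [zero_add, hg0] at h1
    change ∫ r in (0 : ℝ)..(s + L), g r = ∫ r in (0 : ℝ)..s, g r
    rw [← intervalIntegral.integral_add_adjacent_intervals (hgi 0 s) (hgi s (s + L)), h1, add_zero]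
  · refine LipschitzWith.of_dist_le_mul fun x y => ?_
    rw [Real.coe_toNNReal _ hB0, dist_eq_norm, Real.dist_eq,
      intervalIntegral.integral_interval_sub_left (hgi _ _) (hgi _ _)]
    exact intervalIntegral.norm_integral_le_of_norm_le_const fun r _ => hgB r
  · have hloc : LocallyIntegrable g volume := by
      refine (locallyIntegrable_const (B + |m|)).mono (hu.sub_const m).aestronglyMeasurable ?_
      exact Filter.Eventually.of_forall fun s => by
        rw [Real.norm_of_nonneg hB0]; exact hgB s
    filter_upwards [LocallyIntegrable.ae_hasDerivAt_integral hloc] with s hs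
    exact hs 0

namespace Knot

variable {n : ℕ} {k : Knot n} {Λ : ℝ} {p : Euc n}

lemma inner_fd_deriv_fd {s : ℝ} (h : DifferentiableAt ℝ k.fd s) :
    ⟪_root_.deriv k.fd s, k.fd s⟫ = 0 := by
  have h1 := h.hasDerivAt.inner ℝ h.hasDerivAt
  have h2 : HasDerivAt (fun t => ⟪k.fd t, k.fd t⟫) 0 s := by
    simp only [real_inner_self_eq_norm_sq, k.unit]
    exact hasDerivAt_const _ _
  have := h1.unique h2
  rw [real_inner_comm] at this
  linarith

lemma hasDerivAt_inner_fd {s : ℝ} (h : DifferentiableAt ℝ k.fd s) (c : Euc n) :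
    HasDerivAt (fun t => ⟪c, k.fd t⟫) ⟪c, _root_.deriv k.fd s⟫ s := by
  simpa using (hasDerivAt_const s c).inner ℝ h.hasDerivAt

/-- Conservation of the angular momentum in the direction of the bivector `a ∧ b`. -/
lemma IsMultiplier.ae_momentum (hp : k.IsMultiplier Λ p) (hΛ : 0 < Λ)
    (hfreq : ∃ᵐ s ∂volume.restrict (Ioc 0 k.L), ⟪p, k.fd s⟫ = 1) {a b : Euc n}
    (ha : ⟪p, a⟫ = 0) (hb : ⟪p, b⟫ = 0) :
    ∀ᵐ s ∂volume.restrict (Ioc 0 k.L), (1 - ⟪p, k.fd s⟫) *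
      (⟪a, _root_.deriv k.fd s⟫ * ⟪b, k.fd s⟫ - ⟪b, _root_.deriv k.fd s⟫ * ⟪a, k.fd s⟫) = 0 := by
  have hL := k.Lpos
  set w : ℝ → ℝ := fun s =>
    ⟪a, _root_.deriv k.fd s⟫ * ⟪b, k.fd s⟫ - ⟪b, _root_.deriv k.fd s⟫ * ⟪a, k.fd s⟫ with hw
  set u : ℝ → ℝ := fun s => (1 - ⟪p, k.fd s⟫) * w s with hu
  obtain ⟨C, hC⟩ := k.lipd
  have hD : ∀ s, ‖_root_.deriv k.fd s‖ ≤ C := fun s => norm_deriv_le_of_lipschitz hC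
  have hwm : Measurable w :=
    ((measurable_const.inner measurable_deriv_fd).mul (continuous_inner_fd b).measurable).sub
      ((measurable_const.inner measurable_deriv_fd).mul (continuous_inner_fd a).measurable)
  have hum : Measurable u := ((continuous_inner_fd p).measurable.const_sub 1).mul hwm
  have huper : ∀ s, u (s + k.L) = u s := fun s => by
    simp only [hu, hw, k.perd, Function.Periodic.deriv_eq k.perd]
  obtain ⟨M, hub⟩ : ∃ M, ∀ s, |u s| ≤ M := by
    refine ⟨(1 + ‖p‖) * (‖a‖ * C * ‖b‖ + ‖b‖ * C * ‖a‖), fun s => ?_⟩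
    have h1 : ∀ c : Euc n, |⟪c, _root_.deriv k.fd s⟫| ≤ ‖c‖ * C := fun c =>
      (abs_real_inner_le_norm _ _).trans (by gcongr; exact hD s)
    simp only [hu, hw]
    rw [abs_mul]
    gcongr
    · exact (abs_sub _ _).trans (by rw [abs_one]; gcongr; exact k.abs_inner_fd_le p s)
    · refine (abs_sub _ _).trans ?_
      rw [abs_mul, abs_mul]
      gcongr
      exacts [h1 a, k.abs_inner_fd_le b s, h1 b, k.abs_inner_fd_le a s]
  obtain ⟨φ, hφper, hφL, hφ⟩ := exists_primitive_sub_mean hL hum huper hub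
  set m := (∫ r in (0 : ℝ)..k.L, u r) / k.L with hm
  set R : ℝ → Euc n := fun s => ⟪b, k.fd s⟫ • a - ⟪a, k.fd s⟫ • b with hR
  have hRL : ∃ C, LipschitzWith C R := by
    have h1 : ∀ c d : Euc n, ∃ C, LipschitzWith C fun s => ⟪c, k.fd s⟫ • d := fun c d =>
      exists_lipschitzWith_smul (exists_lipschitzWith_inner c k.lipd)
        ⟨‖c‖, fun s => k.abs_inner_fd_le c s⟩ ⟨0, LipschitzWith.const d⟩ ⟨‖d‖, fun _ => le_rfl⟩
    obtain ⟨C₁, h₁⟩ := h1 b a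
    obtain ⟨C₂, h₂⟩ := h1 a b
    exact ⟨_, h₁.sub h₂⟩
  have hRper : ∀ s, R (s + k.L) = R s := fun s => by simp only [hR, k.perd]
  have hXper : ∀ s, φ (s + k.L) • R (s + k.L) = φ s • R s := fun s => by rw [hφper, hRper]
  have hXL : ∃ C, LipschitzWith C fun s => φ s • R s :=
    exists_lipschitzWith_smul hφL
      (Function.Periodic.exists_norm_le hφper hL hφL.choose_spec.continuous) hRL
      (Function.Periodic.exists_norm_le hRper hL hRL.choose_spec.continuous)
  have hint := hp.integral_eq hΛ hXper (fun s => by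
    simp only [hR]
    rw [real_inner_smul_left, inner_sub_left, real_inner_smul_left, real_inner_smul_left]
    ring) hXL
  have h0 : ∀ s, ⟪p, φ s • R s⟫ = 0 := fun s => by
    simp only [hR, real_inner_smul_right, inner_sub_right, ha, hb]; ring
  simp only [h0, intervalIntegral.integral_zero, mul_zero] at hint
  have hcongr : ∫ s in (0 : ℝ)..k.L, (1 - ⟪p, k.fd s⟫) *
      ⟪_root_.deriv k.fd s, _root_.deriv (fun s => φ s • R s) s⟫ =
      ∫ s in (0 : ℝ)..k.L, u s * (u s - m) := by
    refine intervalIntegral.integral_congr_ae ?_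
    filter_upwards [hφ, k.ae_differentiableAt_fd] with s h1 h2 _
    have h3 : HasDerivAt R (⟪b, _root_.deriv k.fd s⟫ • a - ⟪a, _root_.deriv k.fd s⟫ • b) s :=
      ((hasDerivAt_inner_fd h2 b).smul_const a).sub ((hasDerivAt_inner_fd h2 a).smul_const b)
    rw [(h1.fun_smul h3).deriv]
    simp only [hu, hw, hR, inner_add_right, inner_sub_right, real_inner_smul_right,
      real_inner_comm a, real_inner_comm b]
    ring
  rw [hcongr] at hint
  have hui : IntervalIntegrable u volume 0 k.L :=
    intervalIntegrable_of_bounded hum.aestronglyMeasurable hub _ _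
  have huim : IntervalIntegrable (fun s => u s - m) volume 0 k.L := hui.sub (by simp)
  have huu : IntervalIntegrable (fun s => u s * (u s - m)) volume 0 k.L := by
    refine intervalIntegrable_of_bounded (hum.mul (hum.sub_const m)).aestronglyMeasurable
      (B := M * (M + |m|)) (fun s => ?_) _ _
    rw [Pi.mul_apply, norm_mul]
    exact mul_le_mul (hub s) ((abs_sub _ _).trans (add_le_add_left (hub s) |m|)) (abs_nonneg _)
      ((abs_nonneg _).trans (hub s))
  have h6 : ∫ s in (0 : ℝ)..k.L, (u s - m) = 0 := by
    rw [intervalIntegral.integral_sub hui (by simp), intervalIntegral.integral_const, hm]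
    simp only [sub_zero, smul_eq_mul]
    field_simp
    ring
  have h7 : ∫ s in (0 : ℝ)..k.L, (u s - m) ^ 2 = 0 := by
    have e : ∀ s, (u s - m) ^ 2 = u s * (u s - m) - m * (u s - m) := fun s => by ring
    simp only [e]
    rw [intervalIntegral.integral_sub huu (huim.const_mul m), hint,
      intervalIntegral.integral_const_mul, h6]
    ring
  have h8 : IntervalIntegrable (fun s => (u s - m) ^ 2) volume 0 k.L := by
    have e : ∀ s, (u s - m) ^ 2 = u s * (u s - m) - m * (u s - m) := fun s => by ring
    simp only [e]
    exact huu.sub (huim.const_mul m)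
  have h9 := ae_eq_zero_of_intervalIntegral_eq_zero hL.le h8 (fun s => sq_nonneg _) h7
  obtain ⟨s, hs, hs'⟩ := (hfreq.and_eventually h9).exists
  have hm0 : m = 0 := by
    have h10 := pow_eq_zero_iff two_ne_zero |>.1 hs'
    simp only [hu, hs] at h10
    linarith
  filter_upwards [h9] with t ht
  have h10 := pow_eq_zero_iff two_ne_zero |>.1 ht
  rw [hm0, sub_zero] at h10
  exact h10

lemma IsMultiplier.ae_curvature (hp : k.IsMultiplier Λ p) (hΛ0 : 0 < Λ)
    (hΛ : ∀ x y, ‖k.fd x - k.fd y‖ ≤ Λ * |x - y|) (hp1 : ‖p‖ = 1)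
    (hfreq : ∃ᵐ s ∂volume.restrict (Ioc 0 k.L), ⟪p, k.fd s⟫ = 1) :
    ∀ᵐ s ∂volume.restrict (Ioc 0 k.L), ⟪p, k.fd s⟫ ≠ 1 → ‖_root_.deriv k.fd s‖ = Λ ∧
      ⟪p, _root_.deriv k.fd s⟫ ^ 2 = Λ ^ 2 * (1 - ⟪p, k.fd s⟫ ^ 2) := by
  let e : Fin n → Euc n := fun i => EuclideanSpace.single i 1
  have he : ∀ i x, ⟪perpPart p (e i), x⟫ = perpPart p x i := fun i x => by
    rw [inner_perpPart_left]
    simp [e, EuclideanSpace.inner_single_left]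
  have hpe : ∀ i, ⟪p, perpPart p (e i)⟫ = 0 := fun i => by
    rw [real_inner_comm, inner_perpPart hp1]
  have hmom : ∀ i j, _ := fun i j => hp.ae_momentum hΛ0 hfreq (hpe i) (hpe j)
  filter_upwards [ae_all_iff.2 fun i => ae_all_iff.2 (hmom i), hp.ae_le_or,
    ae_restrict_of_ae k.ae_differentiableAt_fd] with s h1 h2 h3 hs
  have hD : ‖_root_.deriv k.fd s‖ = Λ :=
    le_antisymm (norm_deriv_fd_le hΛ s) (h2.resolve_right hs)
  refine ⟨hD, ?_⟩
  have h4 := norm_sq_mul_norm_sq_eq_inner_sq (x := perpPart p (_root_.deriv k.fd s))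
    (y := perpPart p (k.fd s)) fun i j => by
      have := (mul_eq_zero.1 (h1 i j)).resolve_left (sub_ne_zero.2 (Ne.symm hs))
      simp only [he] at this
      linarith
  have h5 : ⟪perpPart p (_root_.deriv k.fd s), perpPart p (k.fd s)⟫ =
      -(⟪p, _root_.deriv k.fd s⟫ * ⟪p, k.fd s⟫) := by
    simp only [perpPart, inner_sub_left, inner_sub_right, real_inner_smul_left,
      real_inner_smul_right, inner_fd_deriv_fd h3, real_inner_self_eq_norm_sq, hp1,
      real_inner_comm p]
    ring
  rw [norm_perpPart_sq hp1, norm_perpPart_sq hp1, hD, k.unit, h5, real_inner_comm,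
    real_inner_comm p (k.fd s)] at h4
  linarith

end Knot

namespace Knot

variable {n : ℕ} {k : Knot n} {Λ : ℝ} {p : Euc n}

/-- The first order condition for the variations `-(1 - ⟪p, T⟫ + ε)⁻¹ (p - ⟪p, T⟫ T)`. -/
lemma IsMultiplier.integral_radial (hp : k.IsMultiplier Λ p) (hΛ0 : 0 < Λ)
    (hΛ : ∀ x y, ‖k.fd x - k.fd y‖ ≤ Λ * |x - y|) (hp1 : ‖p‖ = 1)
    (hfreq : ∃ᵐ s ∂volume.restrict (Ioc 0 k.L), ⟪p, k.fd s⟫ = 1) {ε : ℝ} (hε : 0 < ε) :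
    ∫ s in (0 : ℝ)..k.L, ((1 - ⟪p, k.fd s⟫) / (1 - ⟪p, k.fd s⟫ + ε) * (1 + 2 * ⟪p, k.fd s⟫) -
      ((1 - ⟪p, k.fd s⟫) / (1 - ⟪p, k.fd s⟫ + ε)) ^ 2 * (1 + ⟪p, k.fd s⟫)) = 0 := by
  have hL := k.Lpos
  set h : ℝ → ℝ := fun s => ⟪p, k.fd s⟫ with hh
  have hhc : Continuous h := continuous_inner_fd p
  have hle : ∀ s, h s ≤ 1 := fun s => by
    have := k.abs_inner_fd_le p s
    rw [hp1] at this
    exact (abs_le.1 this).2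
  have hg : ∀ s, ε ≤ 1 - h s + ε := fun s => by linarith [hle s]
  have hg0 : ∀ s, 1 - h s + ε ≠ 0 := fun s => by linarith [hg s]
  set F : ℝ → ℝ := fun s => -(1 - h s + ε)⁻¹ with hF
  have hFc : Continuous F := (((continuous_const.sub hhc).add continuous_const).inv₀ hg0).neg
  have hFper : ∀ s, F (s + k.L) = F s := fun s => by simp only [hF, hh, k.perd]
  have hFL : ∃ C, LipschitzWith C F := by
    obtain ⟨C, hC⟩ := exists_lipschitzWith_inner p k.lipd
    refine ⟨Real.toNNReal (C / ε ^ 2), LipschitzWith.of_dist_le_mul fun x y => ?_⟩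
    rw [Real.coe_toNNReal _ (by positivity), Real.dist_eq]
    have e : F x - F y = -(h x - h y) / ((1 - h x + ε) * (1 - h y + ε)) := by
      have := hg0 x
      have := hg0 y
      simp only [hF]
      field_simp
      ring
    have h1 := hC.dist_le_mul x y
    rw [Real.dist_eq] at h1
    have h2 : ε ^ 2 ≤ (1 - h x + ε) * (1 - h y + ε) := by
      rw [sq]
      exact mul_le_mul (hg x) (hg y) hε.le (hε.le.trans (hg x))
    rw [e, abs_div, abs_neg, abs_of_pos (lt_of_lt_of_le (by positivity) h2)]
    calc _ ≤ C * dist x y / ε ^ 2 := by gcongr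
      _ = _ := by ring
  have hint := hp.integral_eq hΛ0 (X := fun s => F s • perpPart (k.fd s) p)
    (fun s => by rw [hFper, k.perd])
    (fun s => by rw [real_inner_smul_left, inner_perpPart (k.unit s), mul_zero])
    (exists_lipschitzWith_smul hFL (Function.Periodic.exists_norm_le hFper hL hFc)
      (exists_lipschitzWith_perpPart p k.lipd k.unit)
      ⟨‖p‖, fun s => norm_perpPart_le (k.unit s) p⟩)
  have e1 : ∀ s, ⟪p, F s • perpPart (k.fd s) p⟫ = -((1 - h s ^ 2) / (1 - h s + ε)) := fun s => by
    rw [real_inner_smul_right, real_inner_comm, inner_perpPart_self (k.unit s),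
      norm_perpPart_sq (k.unit s), hp1]
    simp only [hF, hh]
    ring
  have e2 : ∫ s in (0 : ℝ)..k.L, (1 - ⟪p, k.fd s⟫) * ⟪_root_.deriv k.fd s,
      _root_.deriv (fun s => F s • perpPart (k.fd s) p) s⟫ =
      ∫ s in (0 : ℝ)..k.L, Λ ^ 2 * ((1 - h s) * h s / (1 - h s + ε) -
        (1 - h s) * (1 - h s ^ 2) / (1 - h s + ε) ^ 2) := by
    rw [intervalIntegral.integral_of_le hL.le, intervalIntegral.integral_of_le hL.le]
    refine integral_congr_ae ?_
    filter_upwards [hp.ae_curvature hΛ0 hΛ hp1 hfreq,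
      ae_restrict_of_ae k.ae_differentiableAt_fd] with s h1 h2
    rcases eq_or_ne (h s) 1 with hs | hs
    · have hs' : ⟪p, k.fd s⟫ = 1 := hs
      rw [hs', hs]
      ring
    obtain ⟨h3, h4⟩ := h1 hs
    have d1 := hasDerivAt_inner_fd h2 p
    have d2 : HasDerivAt F (-(⟪p, _root_.deriv k.fd s⟫ / (1 - h s + ε) ^ 2)) s := by
      have := (((d1.const_sub 1).add_const ε).inv (hg0 s)).neg
      refine this.congr_deriv ?_
      change -(- -⟪p, _root_.deriv k.fd s⟫ / (1 - h s + ε) ^ 2) = _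
      ring
    have d3 : HasDerivAt (fun t => perpPart (k.fd t) p)
        (-(h s • _root_.deriv k.fd s + ⟪p, _root_.deriv k.fd s⟫ • k.fd s)) s :=
      (d1.smul h2.hasDerivAt).const_sub p
    have h5 := hg0 s
    rw [(d2.fun_smul d3).deriv]
    simp only [perpPart, inner_add_right, inner_sub_right, inner_neg_right, real_inner_smul_right,
      inner_fd_deriv_fd h2, real_inner_self_eq_norm_sq, h3, real_inner_comm p]
    have e : (1 - h s) * (F s * -(h s * Λ ^ 2 + ⟪p, _root_.deriv k.fd s⟫ * 0) +
        -(⟪p, _root_.deriv k.fd s⟫ / (1 - h s + ε) ^ 2) *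
          (⟪p, _root_.deriv k.fd s⟫ - h s * 0)) =
        Λ ^ 2 * ((1 - h s) * h s / (1 - h s + ε)) -
        (1 - h s) * ⟪p, _root_.deriv k.fd s⟫ ^ 2 / (1 - h s + ε) ^ 2 := by
      simp only [hF]
      field_simp
      ring
    refine e.trans ?_
    rw [h4]
    ring
  rw [e2, intervalIntegral.integral_const_mul] at hint
  have h6 := mul_left_cancel₀ (by positivity : Λ ^ 2 ≠ 0) hint
  simp only [e1] at h6
  rw [intervalIntegral.integral_neg] at h6
  have c1 : Continuous fun s => (1 - h s) * h s / (1 - h s + ε) -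
      (1 - h s) * (1 - h s ^ 2) / (1 - h s + ε) ^ 2 := by
    refine Continuous.sub (Continuous.div (by fun_prop) (by fun_prop) hg0)
      (Continuous.div (by fun_prop) (by fun_prop) fun s => pow_ne_zero 2 (hg0 s))
  have c2 : Continuous fun s => (1 - h s ^ 2) / (1 - h s + ε) :=
    Continuous.div (by fun_prop) (by fun_prop) hg0
  have h7 := intervalIntegral.integral_add (c1.intervalIntegrable (μ := volume) 0 k.L)
    (c2.intervalIntegrable 0 k.L)
  rw [h6, neg_add_cancel] at h7
  rw [← h7]
  congr 1 with s : 1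
  change (1 - h s) / (1 - h s + ε) * (1 + 2 * h s) - ((1 - h s) / (1 - h s + ε)) ^ 2 * (1 + h s) = _
  have := hg0 s
  field_simp
  ring

lemma IsMultiplier.elim (hp : k.IsMultiplier Λ p) (hΛ0 : 0 < Λ)
    (hΛ : ∀ x y, ‖k.fd x - k.fd y‖ ≤ Λ * |x - y|) (hp1 : ‖p‖ = 1)
    (hfreq : ∃ᵐ s ∂volume.restrict (Ioc 0 k.L), ⟪p, k.fd s⟫ = 1) : False := by
  have hL := k.Lpos
  set h : ℝ → ℝ := fun s => ⟪p, k.fd s⟫ with hh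
  have hhc : Continuous h := continuous_inner_fd p
  have habs : ∀ s, |h s| ≤ 1 := fun s => hp1 ▸ k.abs_inner_fd_le p s
  set S : Set ℝ := {s | h s = 1} with hS
  have hSm : MeasurableSet S := (isClosed_eq hhc continuous_const).measurableSet
  set q : ℝ → ℝ := S.indicator fun _ => 1 with hq
  have hlim : Tendsto (fun ε : ℝ => ∫ s in (0 : ℝ)..k.L,
      ((1 - h s) / (1 - h s + ε) * (1 + 2 * h s) -
      ((1 - h s) / (1 - h s + ε)) ^ 2 * (1 + h s))) (𝓝[>] 0)
      (𝓝 (∫ s in (0 : ℝ)..k.L, (h s - q s))) := by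
    refine intervalIntegral.tendsto_integral_filter_of_dominated_convergence (fun _ => 5) ?_ ?_
      (by simp) ?_
    · filter_upwards with ε
      have hm := hhc.measurable
      exact Measurable.aestronglyMeasurable (by fun_prop)
    · filter_upwards [eventually_mem_nhdsWithin] with ε hε
      refine Filter.Eventually.of_forall fun s _ => ?_
      have hε0 : 0 < ε := hε
      obtain ⟨h1, h2⟩ := abs_le.1 (habs s)
      have hr0 : 0 ≤ (1 - h s) / (1 - h s + ε) := div_nonneg (by linarith) (by linarith)
      have hr1 : (1 - h s) / (1 - h s + ε) ≤ 1 := (div_le_one (by linarith)).2 (by linarith)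
      generalize (1 - h s) / (1 - h s + ε) = r at hr0 hr1
      rw [Real.norm_eq_abs]
      have h3 : |r * (1 + 2 * h s)| ≤ 1 * 3 := by
        rw [abs_mul, abs_of_nonneg hr0]
        gcongr
        exact abs_le.2 ⟨by linarith, by linarith⟩
      have h4 : |r ^ 2 * (1 + h s)| ≤ 1 * 2 := by
        rw [abs_mul, abs_of_nonneg (sq_nonneg r)]
        gcongr
        · exact pow_le_one₀ hr0 hr1
        · exact abs_le.2 ⟨by linarith, by linarith⟩
      exact (abs_sub _ _).trans (by linarith)
    · refine Filter.Eventually.of_forall fun s _ => ?_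
      by_cases hs : s ∈ S
      · have hs1 : h s = 1 := hs
        rw [hq, indicator_of_mem hs, hs1]
        simp
      · have hs1 : 1 - h s ≠ 0 := sub_ne_zero.2 (Ne.symm hs)
        rw [hq, indicator_of_notMem hs, sub_zero]
        have hc : ContinuousAt (fun ε : ℝ => (1 - h s) / (1 - h s + ε) * (1 + 2 * h s) -
            ((1 - h s) / (1 - h s + ε)) ^ 2 * (1 + h s)) 0 := by
          have : ContinuousAt (fun ε : ℝ => (1 - h s) / (1 - h s + ε)) 0 :=
            ContinuousAt.div (by fun_prop) (by fun_prop) (by simpa using hs1)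
          fun_prop
        have h1 := hc.tendsto.mono_left (nhdsWithin_le_nhds (s := Ioi 0))
        simp only [add_zero, div_self hs1] at h1
        convert h1 using 2
        ring
  have hzero : Tendsto (fun ε : ℝ => ∫ s in (0 : ℝ)..k.L,
      ((1 - h s) / (1 - h s + ε) * (1 + 2 * h s) -
      ((1 - h s) / (1 - h s + ε)) ^ 2 * (1 + h s))) (𝓝[>] 0) (𝓝 0) := by
    refine tendsto_const_nhds.congr' ?_
    filter_upwards [eventually_mem_nhdsWithin] with ε hε
    exact (hp.integral_radial hΛ0 hΛ hp1 hfreq hε).symm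
  have h0 := tendsto_nhds_unique hlim hzero
  have hq0 : ∀ s, 0 ≤ q s := fun s => indicator_nonneg (fun _ _ => zero_le_one) s
  have hqi : IntervalIntegrable q volume 0 k.L := by
    refine intervalIntegrable_of_bounded (measurable_const.indicator hSm).aestronglyMeasurable
      (B := 1) (fun s => ?_) _ _
    rw [Real.norm_of_nonneg (hq0 s)]
    exact indicator_le_self' (fun _ _ => zero_le_one) s
  rw [intervalIntegral.integral_sub (hhc.intervalIntegrable _ _) hqi, k.integral_inner_fd,
    zero_sub, neg_eq_zero] at h0
  obtain ⟨s, hs, hs'⟩ :=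
    (hfreq.and_eventually (ae_eq_zero_of_intervalIntegral_eq_zero hL.le hqi hq0 h0)).exists
  rw [hq, indicator_of_mem (show s ∈ S from hs)] at hs'
  exact one_ne_zero hs'

/-- A knot which is somewhere curved less than `Λ` has a variation decreasing its length. -/
lemma exists_variation_integral_neg (k : Knot n) (hΛ0 : 0 < Λ)
    (hΛ : ∀ x y, ‖k.fd x - k.fd y‖ ≤ Λ * |x - y|) (hs : ∃ s, curvAt k.fd univ s < Λ) :
    ∃ X f, k.Variation Λ X f ∧ ∫ s in (0 : ℝ)..k.L, (X s + f s • k.fd s) = 0 ∧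
      ∫ s in (0 : ℝ)..k.L, f s < 0 := by
  by_contra! hno
  obtain ⟨p, hp⟩ := exists_multiplier hno
  have hp' : k.IsMultiplier Λ p := hp
  obtain ⟨s₀, hs₀⟩ := hs
  obtain ⟨Λ', hΛ', hΛ'0, δ, hδ, hnear⟩ := k.exists_norm_fd_sub_le_near hs₀ hΛ
  obtain ⟨hp1, hfreq⟩ := hp'.norm_eq_one hΛ' hΛ'0 hδ hnear
  exact hp'.elim hΛ0 hΛ hp1 hfreq

end Knot

namespace Knot

variable {n : ℕ} {k : Knot n}

lemma Near.mono {c c' : ℝ} {g gd : ℝ → Euc n} (h : k.Near c g gd) (hc : c ≤ c') :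
    k.Near c' g gd :=
  ⟨h.per, h.hasDeriv, fun s => (h.close s).trans hc, fun s => (h.closed s).trans hc⟩

lemma _root_.RelativelyExtremal.MDC_le_two_mul_RO (hext : RelativelyExtremal k)
    (hR : 0 < RO k.f k.fd univ) (hs : ∃ s, curvAt k.fd univ s < (RO k.f k.fd univ)⁻¹) :
    MDC k.f k.fd ≤ 2 * RO k.f k.fd univ := by
  by_contra! hlt
  set Λ := (RO k.f k.fd univ)⁻¹ with hΛdef
  have hΛ0 : 0 < Λ := inv_pos.2 hR
  have hΛ : ∀ x y, ‖k.fd x - k.fd y‖ ≤ Λ * |x - y| := k.norm_fd_sub_le_of_le_RO hR le_rfl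
  obtain ⟨ε, hε, hmin⟩ := hext
  obtain ⟨X, f, hv, hclosed, hneg⟩ := k.exists_variation_integral_neg hΛ0 hΛ hs
  obtain ⟨c₁, hc₁, hclass⟩ := k.exists_near_sameKnotClass
  obtain ⟨c₂, hc₂, hball⟩ := k.exists_near_inv_le_RO hR hlt
  obtain ⟨κ, hκ, hknot⟩ := k.exists_knot_of_tangent
    (lt_min (by positivity : 0 < ε / 3) (lt_min hc₁ hc₂))
  obtain ⟨U, ρ, Λ₁, hU, hρ, hUc, hρm, hU1, hρ1, hUfd, hint, hΛ₁, hchord, himp⟩ :=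
    hv.exists_improvement hΛ0 hΛ hclosed hneg hκ
  have hΛ₁0 : 0 < Λ₁ := hΛ0.trans_le hΛ₁
  obtain ⟨η, hηL, hηlip, hη⟩ := hknot U ρ Λ₁ hU hρ hUc hρm hU1 hρ1 hUfd hint hΛ₁0.le hchord
  have hRη := hball η (hη.mono ((min_le_right _ _).trans (min_le_right _ _))) Λ₁ hΛ₁ hηlip
  have hle := hmin η (hclass η (hη.mono ((min_le_right _ _).trans (min_le_left _ _)))) fun s => by
    have h := hη.mono (min_le_left _ _)
    linarith [h.close s, h.closed s]
  have h1 : η.ropelength ≤ η.L * Λ₁ := by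
    rw [ropelength, ← div_inv_eq_mul]
    exact div_le_div_of_nonneg_left η.Lpos.le (inv_pos.2 hΛ₁0) hRη
  rw [← hηL] at himp
  rw [ropelength, div_eq_mul_inv, ← hΛdef] at hle
  linarith

lemma RO_pos_of_RO_lt (h : RO k.f k.fd univ < MDC k.f k.fd / 2) : 0 < RO k.f k.fd univ := by
  obtain ⟨C, hC, hlip⟩ := k.exists_norm_fd_sub_le
  by_contra! h0
  obtain ⟨x, y, hne, hx, hy, hxy⟩ := k.exists_double_critical_of_RO_lt hC hlip
    ((mul_nonpos_of_nonpos_of_nonneg h0 hC.le).trans_lt one_pos)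
  linarith [k.MDC_le hne hx hy]

end Knot

/-- A relatively extremal knot whose curvature is somewhere below its
supremum satisfies `i(K,ℝⁿ) = R_O(K) = MDC(K)/2`. -/
theorem statement_2 {n : ℕ} (hn : 2 ≤ n) (γ : Knot n)
    (hext : RelativelyExtremal γ)
    (hs : ∃ s₀ : ℝ, curvAt γ.fd Set.univ s₀ < ⨆ s : ℝ, curvAt γ.fd Set.univ s) :
    injRad γ.f γ.fd = RO γ.f γ.fd Set.univ ∧
    RO γ.f γ.fd Set.univ = MDC γ.f γ.fd / 2 := by
  refine ⟨γ.injRad_eq_RO, γ.RO_le_half_MDC.antisymm ?_⟩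
  by_contra! hlt
  have hR := Knot.RO_pos_of_RO_lt hlt
  obtain ⟨s₀, hs₀⟩ := hs
  have hle := hext.MDC_le_two_mul_RO hR ⟨s₀, hs₀.trans_le (ciSup_le
    (γ.curvAt_le (inv_pos.2 hR) (γ.norm_fd_sub_le_of_le_RO hR le_rfl)))⟩
  linarith
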